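/- arXiv:1901.02445 — 7 statements merged into one kernel-verified Lean document; each statement's English description precedes it below -/
import Mathlib

section
/- There exist natural numbers n and m, a real number ε > 0, and a finite system Σ(x,y) of equations and inequations in the variables x = (x₁,…,xₙ) and y = (y₁,…,y_m) such that: (i) Σ has a solution in some group, and (ii) for every group G and every tuple a ∈ Gⁿ, if there exists b ∈ G^m such that (a,b) is a solution of Σ in G, then there is no (a,ε)-Følner subset of G. -/
open Filter

universe u

open scoped Classical in
/-- `H` is an `(a, ε)`-Følner subset of `G` for the tuple `a = (a 1, …, a n)`:
for each `i`, `|a i • H △ H| < ε * |H|`. -/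
def IsFolnerTuple {G : Type*} [Group G] {n : ℕ} (a : Fin n → G) (ε : ℝ) (H : Finset G) : Prop :=
  ∀ i : Fin n,
    ((((H.image (fun h => a i * h)) \ H) ∪ (H \ (H.image (fun h => a i * h)))).card : ℝ)
      < ε * H.card

/-- `(a, b)` is a solution of the finite system of equations `E` and inequations `N`
(elements of the free group on `n + m` generators) in the group `G`. -/
def IsSolution {G : Type*} [Group G] {n m : ℕ}
    (E N : Finset (FreeGroup (Fin n ⊕ Fin m))) (a : Fin n → G) (b : Fin m → G) : Prop :=
  (∀ w ∈ E, FreeGroup.lift (Sum.elim a b) w = 1) ∧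
  (∀ w ∈ N, FreeGroup.lift (Sum.elim a b) w ≠ 1)

/-- The system given by `E` and `N` has a solution in the group `G`. -/
def HasSolutionIn {n m : ℕ} (E N : Finset (FreeGroup (Fin n ⊕ Fin m)))
    (G : Type u) [Group G] : Prop :=
  ∃ (a : Fin n → G) (b : Fin m → G), IsSolution E N a b

/-- The only positive integer `n` dividing `2 ^ n - 1` is `n = 1`. -/
lemma eq_one_of_dvd_two_pow_sub_one {n : ℕ} (hn : 0 < n) (h : (n : ℤ) ∣ 2 ^ n - 1) : n = 1 := by
  by_contra hne
  have hp : n.minFac.Prime := Nat.minFac_prime hne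
  have : Fact n.minFac.Prime := ⟨hp⟩
  have h1 : ((n.minFac : ℕ) : ℤ) ∣ 2 ^ n - 1 :=
    (Int.natCast_dvd_natCast.mpr n.minFac_dvd).trans h
  have h2 : (2 : ZMod n.minFac) ^ n = 1 := by
    have := (ZMod.intCast_zmod_eq_zero_iff_dvd _ n.minFac).mpr h1
    push_cast at this
    exact sub_eq_zero.mp this
  have h20 : (2 : ZMod n.minFac) ≠ 0 := by
    intro h0
    rw [h0, zero_pow hn.ne'] at h2
    exact zero_ne_one h2
  have h3 : orderOf (2 : ZMod n.minFac) ∣ n := orderOf_dvd_of_pow_eq_one h2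
  have h4 : orderOf (2 : ZMod n.minFac) ∣ n.minFac - 1 :=
    orderOf_dvd_of_pow_eq_one (ZMod.pow_card_sub_one_eq_one h20)
  have hlt : orderOf (2 : ZMod n.minFac) < n.minFac :=
    (Nat.le_of_dvd (Nat.sub_pos_of_lt hp.one_lt) h4).trans_lt (Nat.sub_lt hp.pos one_pos)
  have h5 : orderOf (2 : ZMod n.minFac) = 1 := by
    by_contra h5
    exact absurd (Nat.minFac_le_of_dvd
      (by have := Nat.pos_of_dvd_of_pos h3 hn; omega) h3) (not_le.mpr hlt)
  rw [orderOf_eq_one_iff] at h5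
  have h6 : (1 : ZMod n.minFac) = 0 := by linear_combination h5
  exact one_ne_zero h6

/-- A nontrivial element which is conjugate to an element conjugating it to its square has
infinite order. -/
lemma orderOf_eq_zero_of_conj_sq {G : Type*} [Group G] {u a c : G} (hu : u ≠ 1)
    (hau : a * u * a⁻¹ = u ^ 2) (hca : c * a * c⁻¹ = u) : orderOf u = 0 := by
  by_contra h0
  have han : a ^ orderOf u = 1 := by
    have : c * a ^ orderOf u * c⁻¹ = 1 := by rw [← conj_pow, hca, pow_orderOf_eq_one]
    rwa [conj_eq_one_iff] at this
  have key : ∀ k : ℕ, a ^ k * u * (a ^ k)⁻¹ = u ^ (2 ^ k) := by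
    intro k
    induction k with
    | zero => simp
    | succ k ih =>
      calc a ^ (k + 1) * u * (a ^ (k + 1))⁻¹
          = a * (a ^ k * u * (a ^ k)⁻¹) * a⁻¹ := by rw [pow_succ']; group
        _ = u ^ (2 ^ (k + 1)) := by rw [ih, ← conj_pow, hau, ← pow_mul, pow_succ']
  have h1 := key (orderOf u)
  rw [han] at h1
  have h2 : u ^ ((2 : ℤ) ^ orderOf u - 1) = 1 := by
    rw [zpow_sub, zpow_one, mul_inv_eq_one]
    simp only [one_mul, inv_one, mul_one] at h1
    conv_rhs => rw [h1]
    rw [← zpow_natCast]; push_cast; rfl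
  have h3 := eq_one_of_dvd_two_pow_sub_one (Nat.pos_of_ne_zero h0)
    (orderOf_dvd_iff_zpow_eq_one.mpr h2)
  exact hu (orderOf_eq_one_iff.mp h3)

open scoped Classical in
/-- If the translates of `D` by `1`, `s`, `s ^ 2` are disjoint, then `D` occupies at most about a
third of a finite set which is almost invariant under `s`. -/
lemma three_mul_card_filter_le {G : Type*} [Group G] (s : G) (D : G → Prop)
    (h1 : ∀ g, D g → ¬ D (s * g)) (h2 : ∀ g, D g → ¬ D (s * (s * g))) (H : Finset G) :
    3 * (H.filter D).card ≤ H.card + 3 * ((H.image (fun h => s * h)) \ H).card := by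
  have step : ∀ P : G → Prop, (H.filter P).card ≤
      (H.filter (fun h => P (s⁻¹ * h))).card + ((H.image (fun h => s * h)) \ H).card := by
    intro P
    rw [← Finset.card_image_of_injective (H.filter P) (mul_right_injective s)]
    refine (Finset.card_le_card ?_).trans (Finset.card_union_le _ _)
    intro x hx
    simp only [Finset.mem_image, Finset.mem_filter, Finset.mem_union, Finset.mem_sdiff] at hx ⊢
    obtain ⟨h, ⟨hH, hP⟩, rfl⟩ := hx
    by_cases hs : s * h ∈ H
    · left; simpa [hs] using hP
    · right; exact ⟨⟨h, hH, rfl⟩, hs⟩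
  have s1 := step D
  have s2 := step (fun h => D (s⁻¹ * h))
  have d1 : Disjoint (H.filter D) (H.filter (fun h => D (s⁻¹ * h))) :=
    Finset.disjoint_filter.mpr fun x _ hx hx' => h1 _ hx' (by simpa using hx)
  have d2 : Disjoint (H.filter D ∪ H.filter (fun h => D (s⁻¹ * h)))
      (H.filter (fun h => D (s⁻¹ * (s⁻¹ * h)))) := by
    rw [Finset.disjoint_union_left]
    exact ⟨Finset.disjoint_filter.mpr fun x _ hx hx' => h2 _ hx' (by simpa using hx),
      Finset.disjoint_filter.mpr fun x _ hx hx' => h1 _ hx' (by simpa using hx)⟩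
  have hle : (H.filter D ∪ H.filter (fun h => D (s⁻¹ * h)) ∪
      H.filter (fun h => D (s⁻¹ * (s⁻¹ * h)))).card ≤ H.card :=
    Finset.card_le_card (by
      intro x hx
      simp only [Finset.mem_union, Finset.mem_filter] at hx
      tauto)
  rw [Finset.card_union_of_disjoint d2, Finset.card_union_of_disjoint d1] at hle
  omega

/-- Two subsets covering `G`, each having three disjoint translates, rule out Følner sets. -/
lemma not_isFolnerTuple_of_cover {G : Type*} [Group G] (a : Fin 2 → G) (D : Fin 2 → G → Prop)
    (hcover : ∀ g, D 0 g ∨ D 1 g)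
    (h1 : ∀ i g, D i g → ¬ D i (a i * g)) (h2 : ∀ i g, D i g → ¬ D i (a i * (a i * g)))
    (H : Finset G) : ¬ IsFolnerTuple a (1 / 6) H := by
  classical
  intro hF
  have bound : ∀ i, 3 * ((H.filter (D i)).card : ℝ) < H.card + 3 * (1 / 6 * H.card) := by
    intro i
    have hb := three_mul_card_filter_le (a i) (D i) (h1 i) (h2 i) H
    have hi := hF i
    have hsub : ((H.image (fun h => a i * h)) \ H).card ≤
        (((H.image (fun h => a i * h)) \ H) ∪ (H \ (H.image (fun h => a i * h)))).card :=
      Finset.card_le_card Finset.subset_union_left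
    have hb' : 3 * ((H.filter (D i)).card : ℝ) ≤
        H.card + 3 * ((H.image (fun h => a i * h)) \ H).card := by exact_mod_cast hb
    have hsub' : (((H.image (fun h => a i * h)) \ H).card : ℝ) < 1 / 6 * H.card := by
      refine lt_of_le_of_lt (Nat.cast_le.mpr hsub) ?_
      convert hi
    linarith
  have hc : H.card ≤ (H.filter (D 0)).card + (H.filter (D 1)).card := by
    refine (Finset.card_le_card ?_).trans (Finset.card_union_le _ _)
    intro x hx
    simp only [Finset.mem_union, Finset.mem_filter]
    have := hcover x
    tauto
  have hc' : (H.card : ℝ) ≤ (H.filter (D 0)).card + (H.filter (D 1)).card := by exact_mod_cast hc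
  have b0 := bound 0
  have b1 := bound 1
  linarith

/-- For any subset of a group there is a map from the group to the subgroup it generates which
commutes with left multiplication by elements of this subset. -/
lemma exists_equivariant_map_closure {G : Type*} [Group G] (T : Set G) :
    ∃ ρ : G → G, (∀ g, ρ g ∈ Subgroup.closure T) ∧ ∀ s ∈ T, ∀ g, ρ (s * g) = s * ρ g := by
  let r := QuotientGroup.rightRel (Subgroup.closure T)
  refine ⟨fun g => g * (Quotient.mk r g).out⁻¹, fun g => ?_, fun s hs g => ?_⟩
  · exact QuotientGroup.rightRel_apply.mp (Quotient.mk_out (s := r) g)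
  · have : Quotient.mk r (s * g) = Quotient.mk r g := by
      refine Quotient.sound (QuotientGroup.rightRel_apply.mpr ?_)
      simpa using Subgroup.subset_closure hs
    simp only [this, mul_assoc]

lemma abs_lt_abs_add_mul {x y k : ℤ} (hk : 3 ≤ k) (h : |x| ≤ |y|) (h0 : ¬ (x = 0 ∧ y = 0)) :
    |y| < |x + k * y| := by
  have hy : 0 < |y| := by
    rw [abs_pos]
    rintro rfl
    exact h0 ⟨by simpa using h, rfl⟩
  have h1 : |k * y| ≤ |x + k * y| + |x| := by
    calc |k * y| = |(x + k * y) - x| := by ring_nf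
      _ ≤ _ := abs_sub _ _
  rw [abs_mul, abs_of_pos (by omega : 0 < k)] at h1
  nlinarith

/-- Two elements `s`, `t` acting by conjugation on commuting elements `u`, `v` as the elementary
matrices with off-diagonal entry `3`, where `u` has infinite order, have no Følner sets. -/
lemma not_isFolnerTuple_of_elementary {G : Type*} [Group G] {s t u v : G}
    (huv : Commute u v) (hsu : s * u * s⁻¹ = u) (hsv : s * v * s⁻¹ = u ^ 3 * v)
    (htu : t * u * t⁻¹ = u * v ^ 3) (htv : t * v * t⁻¹ = v) (hu : orderOf u = 0)
    (H : Finset G) : ¬ IsFolnerTuple ![s, t] (1 / 6) H := by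
  let φ : ℤ → ℤ → G := fun x y => u ^ x * v ^ y
  have hmul : ∀ x y x' y', φ x y * φ x' y' = φ (x + x') (y + y') := fun x y x' y' => by
    simp only [φ, zpow_add]
    have := (huv.zpow_zpow x' y).eq
    calc u ^ x * v ^ y * (u ^ x' * v ^ y') = u ^ x * (v ^ y * u ^ x') * v ^ y' := by group
      _ = _ := by rw [← this]; group
  have hsφ : ∀ x y, s * φ x y * s⁻¹ = φ (x + 3 * y) y := fun x y => by
    have h3 : Commute (u ^ 3) v := huv.pow_left 3
    calc s * φ x y * s⁻¹ = (s * u * s⁻¹) ^ x * (s * v * s⁻¹) ^ y := by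
          simp only [φ, conj_zpow]; group
      _ = _ := by
          rw [hsu, hsv, h3.mul_zpow]
          simp only [φ, zpow_add, zpow_mul, mul_assoc]
          norm_cast
  have htφ : ∀ x y, t * φ x y * t⁻¹ = φ x (y + 3 * x) := fun x y => by
    have h3 : Commute u (v ^ 3) := huv.pow_right 3
    calc t * φ x y * t⁻¹ = (t * u * t⁻¹) ^ x * (t * v * t⁻¹) ^ y := by
          simp only [φ, conj_zpow]; group
      _ = _ := by
          rw [htu, htv, h3.mul_zpow, add_comm]
          simp only [φ, zpow_add, zpow_mul, mul_assoc]
          norm_cast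
  have huz : ∀ x : ℤ, u ^ x = 1 → x = 0 := fun x hx => by
    have := orderOf_dvd_iff_zpow_eq_one.mpr hx
    rw [hu] at this
    simpa using this
  have hker : ∀ x y, φ x y = 1 → x = 0 ∧ y = 0 := fun x y h => by
    have h' := hsφ x y
    have hm := hmul (3 * y) 0 x y
    rw [h, mul_one, mul_inv_cancel] at h'
    rw [h, mul_one, zero_add, add_comm (3 * y) x, ← h'] at hm
    have hy : y = 0 := by
      have := huz (3 * y) (by simpa [φ] using hm)
      omega
    subst hy
    exact ⟨huz x (by simpa [φ] using h), rfl⟩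
  have hinj : ∀ x y x' y', φ x y = φ x' y' → x = x' ∧ y = y' := fun x y x' y' h => by
    have h1 := hmul x y (-x') (-y')
    rw [h, hmul, add_neg_cancel, add_neg_cancel] at h1
    have := hker _ _ (h1.symm.trans (by simp [φ]))
    omega
  obtain ⟨ρ, hρ, hρT⟩ := exists_equivariant_map_closure ({s, t} : Set G)
  have hclos : ∀ f ∈ Subgroup.closure ({s, t} : Set G),
      (∀ x y, ∃ x' y', f * φ x y * f⁻¹ = φ x' y') ∧
      (∀ x y, ∃ x' y', f⁻¹ * φ x y * f = φ x' y') := by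
    intro f hf
    induction hf using Subgroup.closure_induction with
    | mem f hf =>
      rcases hf with rfl | rfl
      · refine ⟨fun x y => ⟨_, _, hsφ x y⟩, fun x y => ⟨x - 3 * y, y, ?_⟩⟩
        have := hsφ (x - 3 * y) y
        rw [sub_add_cancel] at this
        rw [← this]; group
      · refine ⟨fun x y => ⟨_, _, htφ x y⟩, fun x y => ⟨x, y - 3 * x, ?_⟩⟩
        have := htφ x (y - 3 * x)
        rw [sub_add_cancel] at this
        rw [← this]; group
    | one => exact ⟨fun x y => ⟨x, y, by simp⟩, fun x y => ⟨x, y, by simp⟩⟩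
    | mul f g _ _ hf hg =>
      refine ⟨fun x y => ?_, fun x y => ?_⟩
      · obtain ⟨x₁, y₁, h₁⟩ := hg.1 x y
        obtain ⟨x₂, y₂, h₂⟩ := hf.1 x₁ y₁
        exact ⟨x₂, y₂, by rw [← h₂, ← h₁]; group⟩
      · obtain ⟨x₁, y₁, h₁⟩ := hf.2 x y
        obtain ⟨x₂, y₂, h₂⟩ := hg.2 x₁ y₁
        exact ⟨x₂, y₂, by rw [← h₂, ← h₁]; group⟩
    | inv f _ hf => exact ⟨by simpa using hf.2, by simpa using hf.1⟩
  have hex : ∀ g, ∃ x y, ρ g * u * (ρ g)⁻¹ = φ x y := fun g => by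
    simpa [φ] using (hclos (ρ g) (hρ g)).1 1 0
  choose X Y hXY using hex
  have hne : ∀ g, ¬ (X g = 0 ∧ Y g = 0) := fun g h => by
    have := hXY g
    rw [h.1, h.2] at this
    have h1 : u = 1 := by simpa [φ] using this
    simp [h1] at hu
  have hs : ∀ g, X (s * g) = X g + 3 * Y g ∧ Y (s * g) = Y g := fun g => by
    refine hinj _ _ _ _ ?_
    rw [← hXY, ← hsφ, ← hXY, hρT s (by simp)]
    group
  have ht : ∀ g, X (t * g) = X g ∧ Y (t * g) = Y g + 3 * X g := fun g => by
    refine hinj _ _ _ _ ?_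
    rw [← hXY, ← htφ, ← hXY, hρT t (by simp)]
    group
  refine not_isFolnerTuple_of_cover _
    ![fun g => |X g| ≤ |Y g|, fun g => |Y g| ≤ |X g|] (fun g => le_total _ _) ?_ ?_ H
  · intro i g
    fin_cases i
    · intro (h : |X g| ≤ |Y g|)
      show ¬ |X (s * g)| ≤ |Y (s * g)|
      rw [(hs g).1, (hs g).2]
      exact not_le.mpr (abs_lt_abs_add_mul le_rfl h (hne g))
    · intro (h : |Y g| ≤ |X g|)
      show ¬ |Y (t * g)| ≤ |X (t * g)|
      rw [(ht g).1, (ht g).2]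
      exact not_le.mpr (abs_lt_abs_add_mul le_rfl h (fun h => hne g h.symm))
  · intro i g
    fin_cases i
    · intro (h : |X g| ≤ |Y g|)
      show ¬ |X (s * (s * g))| ≤ |Y (s * (s * g))|
      rw [(hs (s * g)).1, (hs (s * g)).2, (hs g).1, (hs g).2, add_assoc, ← add_mul]
      exact not_le.mpr (abs_lt_abs_add_mul (by norm_num) h (hne g))
    · intro (h : |Y g| ≤ |X g|)
      show ¬ |Y (t * (t * g))| ≤ |X (t * (t * g))|
      rw [(ht (t * g)).1, (ht (t * g)).2, (ht g).1, (ht g).2, add_assoc, ← add_mul]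
      exact not_le.mpr (abs_lt_abs_add_mul (by norm_num) h (fun h => hne g h.symm))

/-- Two permutations of a set, each identified with the shift on a product of a countably infinite
set with `ℤ`, are conjugate. -/
lemma exists_conj_of_shift {α B C : Type*} [Countable B] [Infinite B] [Countable C] [Infinite C]
    (f g : Equiv.Perm α) (e₁ : α ≃ B × ℤ) (e₂ : α ≃ C × ℤ)
    (h₁ : ∀ x, e₁ (f x) = ((e₁ x).1, (e₁ x).2 + 1))
    (h₂ : ∀ x, e₂ (g x) = ((e₂ x).1, (e₂ x).2 + 1)) :
    ∃ c : Equiv.Perm α, c * f * c⁻¹ = g := by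
  obtain ⟨β⟩ := nonempty_equiv_of_countable (α := B) (β := C)
  refine ⟨(e₁.trans (β.prodCongr (Equiv.refl ℤ))).trans e₂.symm, ?_⟩
  rw [mul_inv_eq_iff_eq_mul]
  ext x
  apply e₂.injective
  simp [h₁, h₂]

/-- There are permutations satisfying the relations of the system. -/
lemma exists_perm_solution : ∃ s t u v a c : Equiv.Perm ((ℚ × ℚ) × ℤ),
    u * v = v * u ∧ s * u * s⁻¹ = u ∧ s * v * s⁻¹ = u ^ 3 * v ∧ t * u * t⁻¹ = u * v ^ 3 ∧
    t * v * t⁻¹ = v ∧ a * u * a⁻¹ = u ^ 2 ∧ c * a * c⁻¹ = u ∧ u ≠ 1 := by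
  let s : Equiv.Perm ((ℚ × ℚ) × ℤ) :=
    ⟨fun p => ((p.1.1 + 3 * p.1.2, p.1.2), p.2), fun p => ((p.1.1 - 3 * p.1.2, p.1.2), p.2),
      fun p => by simp, fun p => by simp⟩
  let t : Equiv.Perm ((ℚ × ℚ) × ℤ) :=
    ⟨fun p => ((p.1.1, p.1.2 + 3 * p.1.1), p.2), fun p => ((p.1.1, p.1.2 - 3 * p.1.1), p.2),
      fun p => by simp, fun p => by simp⟩
  let u : Equiv.Perm ((ℚ × ℚ) × ℤ) :=
    ⟨fun p => ((p.1.1 + 1, p.1.2), p.2), fun p => ((p.1.1 - 1, p.1.2), p.2),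
      fun p => by simp, fun p => by simp⟩
  let v : Equiv.Perm ((ℚ × ℚ) × ℤ) :=
    ⟨fun p => ((p.1.1, p.1.2 + 1), p.2), fun p => ((p.1.1, p.1.2 - 1), p.2),
      fun p => by simp, fun p => by simp⟩
  let a : Equiv.Perm ((ℚ × ℚ) × ℤ) :=
    ⟨fun p => ((2 * p.1.1, 2 * p.1.2), p.2 + 1), fun p => ((p.1.1 / 2, p.1.2 / 2), p.2 - 1),
      fun p => by simp, fun p => by simp [mul_div_cancel₀]⟩
  have h2 (k : ℤ) : (2 : ℚ) ^ k ≠ 0 := zpow_ne_zero k two_ne_zero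
  let e₁ : (ℚ × ℚ) × ℤ ≃ (ℚ × ℚ) × ℤ :=
    ⟨fun p => ((p.1.1 / 2 ^ p.2, p.1.2 / 2 ^ p.2), p.2),
      fun p => ((p.1.1 * 2 ^ p.2, p.1.2 * 2 ^ p.2), p.2),
      fun p => by simp [h2 p.2], fun p => by simp [h2 p.2]⟩
  let e₂ : (ℚ × ℚ) × ℤ ≃ (Set.Ico (0 : ℚ) 1 × ℚ × ℤ) × ℤ :=
    ⟨fun p => ((⟨Int.fract p.1.1, Int.fract_nonneg _, Int.fract_lt_one _⟩, p.1.2, p.2), ⌊p.1.1⌋),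
      fun p => ((p.2 + p.1.1.1, p.1.2.1), p.1.2.2),
      fun p => by simp [Int.floor_add_fract],
      fun ⟨⟨⟨q, h0, h1⟩, y, k⟩, n⟩ => by
        simp [Int.fract_eq_self.mpr ⟨h0, h1⟩, Int.floor_eq_zero_iff.mpr ⟨h0, h1⟩]⟩
  have : Nonempty (Set.Ico (0 : ℚ) 1) := ⟨⟨0, by simp⟩⟩
  obtain ⟨c, hc⟩ := exists_conj_of_shift a u e₁ e₂
    (fun p => by
      have hpow : (2 : ℚ) ^ (p.2 + 1) = 2 * 2 ^ p.2 := by rw [zpow_add_one₀ two_ne_zero, mul_comm]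
      simp [a, e₁, hpow, mul_div_mul_left])
    (fun p => by simp [u, e₂])
  refine ⟨s, t, u, v, a, c, ?_, ?_, ?_, ?_, ?_, ?_, hc, ?_⟩
  · ext p <;> simp [u, v]
  · rw [mul_inv_eq_iff_eq_mul]
    ext p <;> simp [u, s]; ring
  · rw [mul_inv_eq_iff_eq_mul]
    ext p <;> simp [u, v, s, pow_succ]; ring
  · rw [mul_inv_eq_iff_eq_mul]
    ext p <;> simp [u, v, t, pow_succ]; ring
  · rw [mul_inv_eq_iff_eq_mul]
    ext p <;> simp [v, t]; ring
  · rw [mul_inv_eq_iff_eq_mul]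
    ext p <;> simp [u, a, pow_succ]; ring
  · intro h
    have := congrArg (fun f : Equiv.Perm ((ℚ × ℚ) × ℤ) => (f ((0, 0), 0)).1.1) h
    simp [u] at this

/-- Solutions are preserved by injective homomorphisms. -/
lemma IsSolution.map {G K : Type*} [Group G] [Group K] {n m : ℕ}
    {E N : Finset (FreeGroup (Fin n ⊕ Fin m))} {a : Fin n → G} {b : Fin m → G}
    (h : IsSolution E N a b) (f : G →* K) (hf : Function.Injective f) :
    IsSolution E N (f ∘ a) (f ∘ b) := by
  have key : ∀ w, FreeGroup.lift (Sum.elim (f ∘ a) (f ∘ b)) w =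
      f (FreeGroup.lift (Sum.elim a b) w) := by
    intro w
    rw [← Sum.comp_elim, ← MonoidHom.comp_apply]
    congr 1
    ext x
    simp
  refine ⟨fun w hw => ?_, fun w hw => ?_⟩
  · rw [key, h.1 w hw, map_one]
  · rw [key, map_ne_one_iff f hf]
    exact h.2 w hw

open FreeGroup in
/-- The equations of the system, in the variables `s`, `t` and `u`, `v`, `a`, `c`. -/
def elementaryEquations : Finset (FreeGroup (Fin 2 ⊕ Fin 4)) :=
  let s := of (Sum.inl 0)
  let t := of (Sum.inl 1)
  let u := of (Sum.inr 0)
  let v := of (Sum.inr 1)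
  let a := of (Sum.inr 2)
  let c := of (Sum.inr 3)
  {u * v * (v * u)⁻¹, s * u * s⁻¹ * u⁻¹, s * v * s⁻¹ * (u ^ 3 * v)⁻¹,
    t * u * t⁻¹ * (u * v ^ 3)⁻¹, t * v * t⁻¹ * v⁻¹, a * u * a⁻¹ * (u ^ 2)⁻¹, c * a * c⁻¹ * u⁻¹}

lemma isSolution_elementaryEquations_iff {G : Type*} [Group G] (x : Fin 2 → G) (y : Fin 4 → G) :
    IsSolution elementaryEquations {FreeGroup.of (Sum.inr 0)} x y ↔
      y 0 * y 1 = y 1 * y 0 ∧ x 0 * y 0 * (x 0)⁻¹ = y 0 ∧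
      x 0 * y 1 * (x 0)⁻¹ = y 0 ^ 3 * y 1 ∧ x 1 * y 0 * (x 1)⁻¹ = y 0 * y 1 ^ 3 ∧
      x 1 * y 1 * (x 1)⁻¹ = y 1 ∧ y 2 * y 0 * (y 2)⁻¹ = y 0 ^ 2 ∧
      y 3 * y 2 * (y 3)⁻¹ = y 0 ∧ y 0 ≠ 1 := by
  simp only [IsSolution, elementaryEquations, Finset.forall_mem_insert, Finset.mem_singleton,
    forall_eq, map_mul, map_inv, map_pow, FreeGroup.lift_apply_of, Sum.elim_inl, Sum.elim_inr,
    mul_inv_eq_one, and_assoc]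

/-- There are `n`, `m`, `ε > 0` and a finite system `Σ(x, y)` of equations and inequations,
with `x` of length `n` and `y` of length `m`, such that `Σ` has a solution in some group, and
such that for every group `G` and `a ∈ Gⁿ`, if `Σ(a, y)` has a solution in `G` then there is
no `(a, ε)`-Følner subset of `G`. -/
theorem no_folner_from_system :
    ∃ (n m : ℕ) (ε : ℝ) (E N : Finset (FreeGroup (Fin n ⊕ Fin m))),
      0 < ε ∧
      (∃ (G₀ : Type u) (inst₀ : Group G₀), @HasSolutionIn n m E N G₀ inst₀) ∧
      (∀ (G : Type u) [Group G] (a : Fin n → G),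
        (∃ b : Fin m → G, IsSolution E N a b) →
        ∀ H : Finset G, ¬ IsFolnerTuple a ε H) := by
  refine ⟨2, 4, 1 / 6, elementaryEquations, {FreeGroup.of (Sum.inr 0)}, by norm_num, ?_, ?_⟩
  · obtain ⟨s, t, u, v, a, c, h⟩ := exists_perm_solution
    have hsol := (isSolution_elementaryEquations_iff ![s, t] ![u, v, a, c]).mpr h
    let f : Equiv.Perm ((ℚ × ℚ) × ℤ) ≃* ULift.{u} (Equiv.Perm ((ℚ × ℚ) × ℤ)) :=
      MulEquiv.ulift.symm
    exact ⟨ULift.{u} (Equiv.Perm ((ℚ × ℚ) × ℤ)), inferInstance, _, _,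
      hsol.map f.toMonoidHom f.injective⟩
  · rintro G _ x ⟨y, hy⟩ H
    obtain ⟨huv, hsu, hsv, htu, htv, hau, hca, hu⟩ :=
      (isSolution_elementaryEquations_iff x y).mp hy
    have hx : x = ![x 0, x 1] := by
      ext i
      fin_cases i <;> rfl
    rw [hx]
    exact not_isFolnerTuple_of_elementary huv hsu hsv htu htv
      (orderOf_eq_zero_of_conj_sq hu hau hca) H
end

section
/- No existentially closed group is amenable: if G is an existentially closed group, then there exist a finite subset F of G and ε > 0 such that G contains no (F,ε)-Følner set. -/
open Filter

universe u

open scoped Classical in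
/-- `H` is an `(F, ε)`-Følner subset of `G`: for each `g ∈ F`, `|g • H △ H| < ε * |H|`. -/
def IsFolnerSet {G : Type*} [Group G] (F : Finset G) (ε : ℝ) (H : Finset G) : Prop :=
  ∀ g ∈ F,
    ((((H.image (fun h => g * h)) \ H) ∪ (H \ (H.image (fun h => g * h)))).card : ℝ)
      < ε * H.card

/-- `G` is an existentially closed group: any finite system of equations and inequations
with coefficients from `G` that has a solution in some extension `H` of `G` already has a
solution in `G`. -/
def IsEC (G : Type u) [Group G] : Prop :=
  ∀ (H : Type u) [Group H], ∀ i : G →* H, Function.Injective i →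
    ∀ (m : ℕ) (E N : Finset (FreeGroup (G ⊕ Fin m))),
      (∃ b : Fin m → H, (∀ w ∈ E, FreeGroup.lift (Sum.elim (⇑i) b) w = 1) ∧
        (∀ w ∈ N, FreeGroup.lift (Sum.elim (⇑i) b) w ≠ 1)) →
      ∃ c : Fin m → G, (∀ w ∈ E, FreeGroup.lift (Sum.elim id c) w = 1) ∧
        (∀ w ∈ N, FreeGroup.lift (Sum.elim id c) w ≠ 1)

/-- If `x s x⁻¹ = s²` and some `z` commutes with `s²` but not with `s`, then `x` has infinite
order. -/
theorem zpow_eq_one_iff_of_conj_eq_sq {G : Type*} [Group G] {x s z : G}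
    (hs : x * s * x⁻¹ = s ^ 2) (hz : Commute z (s ^ 2)) (hzs : ¬ Commute z s) (n : ℤ) :
    x ^ n = 1 ↔ n = 0 := by
  have conj_pow : ∀ k : ℕ, x ^ k * s * (x ^ k)⁻¹ = s ^ 2 ^ k := by
    intro k
    induction k with
    | zero => simp
    | succ k ih =>
      calc x ^ (k + 1) * s * (x ^ (k + 1))⁻¹ = x * (x ^ k * s * (x ^ k)⁻¹) * x⁻¹ := by
            rw [pow_succ']; group
        _ = (x * s * x⁻¹) ^ 2 ^ k := by rw [ih, conj_pow]
        _ = s ^ 2 ^ (k + 1) := by rw [hs, ← pow_mul, pow_succ']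
  refine ⟨fun h => ?_, fun h => by simp [h]⟩
  by_contra hn
  have hk : x ^ n.natAbs = 1 := pow_natAbs_eq_one.mpr h
  obtain ⟨k, hk'⟩ := Nat.exists_eq_succ_of_ne_zero (Int.natAbs_ne_zero.mpr hn)
  have h1 := conj_pow n.natAbs
  rw [hk, hk', Nat.succ_eq_add_one, pow_succ', pow_mul] at h1
  apply hzs
  simp only [one_mul, inv_one, mul_one] at h1
  rw [h1]
  exact hz.pow_right _

/-- Elements `x, y` generate an abelian subgroup on which `a` and `b` act by the elementary
matrices with off-diagonal entry `2`, and `x` has infinite order, as witnessed by `s` and `z`. -/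
structure IsSanovSystem {G : Type*} [Group G] (x y a b s z : G) : Prop where
  x_y : x * y * x⁻¹ * y⁻¹ = 1
  a_x : a * x * a⁻¹ * x⁻¹ = 1
  a_y : a * y * a⁻¹ * (x ^ 2 * y)⁻¹ = 1
  b_x : b * x * b⁻¹ * (x * y ^ 2)⁻¹ = 1
  b_y : b * y * b⁻¹ * y⁻¹ = 1
  x_s : x * s * x⁻¹ * (s ^ 2)⁻¹ = 1
  z_sq : z * s ^ 2 * z⁻¹ * (s ^ 2)⁻¹ = 1
  z_s : z * s * z⁻¹ * s⁻¹ ≠ 1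

namespace IsSanovSystem

variable {G : Type*} [Group G] {x y a b s z : G}

theorem commute (h : IsSanovSystem x y a b s z) : Commute x y :=
  mul_inv_eq_iff_eq_mul.mp (mul_inv_eq_one.mp h.x_y)

theorem x_zpow_eq_one_iff (h : IsSanovSystem x y a b s z) (n : ℤ) : x ^ n = 1 ↔ n = 0 := by
  refine zpow_eq_one_iff_of_conj_eq_sq (mul_inv_eq_one.mp h.x_s)
    (mul_inv_eq_iff_eq_mul.mp (mul_inv_eq_one.mp h.z_sq)) (fun hc => h.z_s ?_) n
  rw [hc.eq]; group

theorem conj_a (h : IsSanovSystem x y a b s z) (p q : ℤ) :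
    a * (x ^ p * y ^ q) * a⁻¹ = x ^ (p + 2 * q) * y ^ q := by
  rw [← MulAut.conj_apply, map_mul, map_zpow, map_zpow, MulAut.conj_apply, MulAut.conj_apply,
    mul_inv_eq_one.mp h.a_x, mul_inv_eq_one.mp h.a_y, (h.commute.pow_left 2).mul_zpow, zpow_add,
    zpow_mul, mul_assoc]
  norm_cast

theorem conj_b (h : IsSanovSystem x y a b s z) (p q : ℤ) :
    b * (x ^ p * y ^ q) * b⁻¹ = x ^ p * y ^ (q + 2 * p) := by
  rw [← MulAut.conj_apply, map_mul, map_zpow, map_zpow, MulAut.conj_apply, MulAut.conj_apply,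
    mul_inv_eq_one.mp h.b_x, mul_inv_eq_one.mp h.b_y, (h.commute.pow_right 2).mul_zpow, add_comm,
    zpow_add, zpow_mul, mul_assoc]
  norm_cast

theorem zpow_mul_zpow_inj (h : IsSanovSystem x y a b s z) {p q p' q' : ℤ}
    (he : x ^ p * y ^ q = x ^ p' * y ^ q') : p = p' ∧ q = q' := by
  have he' : x ^ (p + 2 * q) * y ^ q = x ^ (p' + 2 * q') * y ^ q' := by
    rw [← h.conj_a, ← h.conj_a, he]
  have key : x ^ (2 * q) = x ^ (2 * q') := by
    rw [add_comm, zpow_add, mul_assoc, he, add_comm p', zpow_add, mul_assoc] at he'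
    exact mul_right_cancel he'
  have inj : ∀ {m n : ℤ}, x ^ m = x ^ n → m = n := fun {m n} hmn => by
    have := (h.x_zpow_eq_one_iff (m - n)).mp (by rw [zpow_sub, hmn, mul_inv_cancel])
    omega
  have hq : q = q' := by have := inj key; omega
  subst hq
  exact ⟨inj (mul_right_cancel he), rfl⟩

theorem exists_conj_eq (h : IsSanovSystem x y a b s z) {g : G}
    (hg : g ∈ Subgroup.closure {a, b}) :
    ∃ p q : ℤ, Odd p ∧ Even q ∧ g * x * g⁻¹ = x ^ p * y ^ q := by
  have conj_mul : ∀ u v : G, u * v * x * (u * v)⁻¹ = u * (v * x * v⁻¹) * u⁻¹ := by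
    intro u v; group
  induction hg using Subgroup.closure_induction_left with
  | one => exact ⟨1, 0, odd_one, Even.zero, by simp⟩
  | mul_left u hu v _ ih =>
    obtain ⟨p, q, hp, hq, he⟩ := ih
    rw [conj_mul, he]
    rcases hu with rfl | rfl
    · exact ⟨p + 2 * q, q, hp.add_even (even_two_mul q), hq, h.conj_a p q⟩
    · exact ⟨p, q + 2 * p, hp, hq.add (even_two_mul p), h.conj_b p q⟩
  | inv_mul_cancel u hu v _ ih =>
    obtain ⟨p, q, hp, hq, he⟩ := ih
    rw [conj_mul, he]
    rcases hu with rfl | rfl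
    · refine ⟨p - 2 * q, q, hp.sub_even (even_two_mul q), hq, ?_⟩
      have := h.conj_a (p - 2 * q) q
      rw [sub_add_cancel] at this
      rw [← this]; group
    · refine ⟨p, q - 2 * p, hp, hq.sub (even_two_mul p), ?_⟩
      have := h.conj_b p (q - 2 * p)
      rw [sub_add_cancel] at this
      rw [← this]; group

/-- A map from `G` to pairs (odd, even) of integers which is equivariant for `a` and `b` acting
on `G` by left multiplication and on `ℤ × ℤ` by elementary matrices. -/
theorem exists_equivariant (h : IsSanovSystem x y a b s z) :
    ∃ p q : G → ℤ, (∀ g, Odd (p g)) ∧ (∀ g, Even (q g)) ∧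
      (∀ g, p (a * g) = p g + 2 * q g ∧ q (a * g) = q g) ∧
      (∀ g, p (b * g) = p g ∧ q (b * g) = q g + 2 * p g) := by
  let S := Subgroup.closure {a, b}
  let r : G → G := fun g => (QuotientGroup.mk g⁻¹ : G ⧸ S).out
  have hr : ∀ g, g * r g ∈ S := fun g => by
    have : (QuotientGroup.mk g⁻¹ : G ⧸ S) = QuotientGroup.mk (r g) :=
      (QuotientGroup.out_eq' _).symm
    simpa using QuotientGroup.eq.mp this
  have hr' : ∀ u ∈ S, ∀ g, r (u * g) = r g := fun u hu g => by
    have : (QuotientGroup.mk (u * g)⁻¹ : G ⧸ S) = QuotientGroup.mk g⁻¹ :=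
      QuotientGroup.eq.mpr (by simpa using hu)
    simp only [r, this]
  choose p q hp hq he using fun g => h.exists_conj_eq (hr g)
  have equiv : ∀ u ∈ S, ∀ g, x ^ p (u * g) * y ^ q (u * g) = u * (x ^ p g * y ^ q g) * u⁻¹ := by
    intro u hu g
    rw [← he, ← he, hr' u hu]; group
  refine ⟨p, q, hp, hq, fun g => ?_, fun g => ?_⟩
  · apply h.zpow_mul_zpow_inj
    rw [equiv a (Subgroup.subset_closure (by simp)), h.conj_a]
  · apply h.zpow_mul_zpow_inj
    rw [equiv b (Subgroup.subset_closure (by simp)), h.conj_b]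

end IsSanovSystem

open scoped Classical in
theorem card_le_of_mul_mem {G : Type*} [Group G] (g : G) (H : Finset G) (A B : G → Prop)
    [DecidablePred A] [DecidablePred B] (hAB : ∀ h, ¬ B h → A (g * h)) :
    H.card ≤ (H.filter A).card + (H.filter B).card +
      (((H.image (fun h => g * h)) \ H) ∪ (H \ (H.image (fun h => g * h)))).card := by
  have hsub : (H.filter (fun h => ¬ B h)).image (fun h => g * h) ⊆
      H.filter A ∪ (((H.image (fun h => g * h)) \ H) ∪ (H \ (H.image (fun h => g * h)))) := by
    intro k hk
    obtain ⟨h, hh, rfl⟩ := Finset.mem_image.mp hk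
    rw [Finset.mem_filter] at hh
    have := Finset.mem_image_of_mem (fun h => g * h) hh.1
    have := hAB h hh.2
    by_cases hgh : g * h ∈ H <;> simp_all
  have h1 := (Finset.card_le_card hsub).trans (Finset.card_union_le _ _)
  rw [Finset.card_image_of_injective _ (mul_right_injective g)] at h1
  have h2 := H.card_filter_add_card_filter_not B
  omega

open scoped Classical in
theorem IsSanovSystem.not_isFolnerSet {G : Type*} [Group G] {x y a b s z : G}
    (h : IsSanovSystem x y a b s z) (H : Finset G) : ¬ IsFolnerSet {a, b} (1 / 4) H := by
  intro hF
  obtain ⟨p, q, hp, hq, ha, hb⟩ := h.exists_equivariant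
  have hFa := hF a (by simp)
  have hFb := hF b (by simp)
  let A₁ : G → Prop := fun g => (0 ≤ q g ∧ q g < p g) ∨ (q g ≤ 0 ∧ p g < q g)
  let B₁ : G → Prop := fun g => (0 < q g ∧ p g < - q g) ∨ (q g < 0 ∧ - q g < p g)
  let A₂ : G → Prop := fun g => (0 < p g ∧ p g < q g) ∨ (p g < 0 ∧ q g < p g)
  let B₂ : G → Prop := fun g => (0 < p g ∧ q g < - p g) ∨ (p g < 0 ∧ - p g < q g)
  have h₁ := card_le_of_mul_mem a H A₁ B₁ fun g hg => by
    obtain ⟨k, hk⟩ := hp g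
    obtain ⟨l, hl⟩ := hq g
    simp only [A₁, B₁, ha] at hg ⊢
    omega
  have h₂ := card_le_of_mul_mem b H A₂ B₂ fun g hg => by
    obtain ⟨k, hk⟩ := hp g
    obtain ⟨l, hl⟩ := hq g
    simp only [A₂, B₂, hb] at hg ⊢
    omega
  have hdisj : (H.filter A₁).card + (H.filter B₁).card + (H.filter A₂).card +
      (H.filter B₂).card ≤ H.card := by
    simp only [Finset.card_filter, ← Finset.sum_add_distrib, Finset.card_eq_sum_ones H]
    refine Finset.sum_le_sum fun g _ => ?_
    simp only [A₁, B₁, A₂, B₂]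
    split_ifs <;> omega
  have h₁' := (Nat.cast_le (α := ℝ)).mpr h₁
  have h₂' := (Nat.cast_le (α := ℝ)).mpr h₂
  have hdisj' := (Nat.cast_le (α := ℝ)).mpr hdisj
  have hcard : (0 : ℝ) ≤ H.card := Nat.cast_nonneg _
  push_cast at h₁' h₂' hdisj'
  linarith

theorem exists_isSanovSystem_perm :
    ∃ x y a b s z : Equiv.Perm (ℤ × ℤ × ℚ), IsSanovSystem x y a b s z := by
  let x : Equiv.Perm (ℤ × ℤ × ℚ) :=
    { toFun := fun v => (v.1, v.2.1, 2 ^ v.1 * v.2.2)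
      invFun := fun v => (v.1, v.2.1, 2 ^ (-v.1) * v.2.2)
      left_inv := fun ⟨n, m, r⟩ => by simp [zpow_ne_zero]
      right_inv := fun ⟨n, m, r⟩ => by simp [zpow_ne_zero] }
  let y : Equiv.Perm (ℤ × ℤ × ℚ) :=
    { toFun := fun v => (v.1, v.2.1, 2 ^ v.2.1 * v.2.2)
      invFun := fun v => (v.1, v.2.1, 2 ^ (-v.2.1) * v.2.2)
      left_inv := fun ⟨n, m, r⟩ => by simp [zpow_ne_zero]
      right_inv := fun ⟨n, m, r⟩ => by simp [zpow_ne_zero] }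
  let a : Equiv.Perm (ℤ × ℤ × ℚ) :=
    { toFun := fun v => (v.1, v.2.1 - 2 * v.1, v.2.2)
      invFun := fun v => (v.1, v.2.1 + 2 * v.1, v.2.2)
      left_inv := fun ⟨n, m, r⟩ => by simp
      right_inv := fun ⟨n, m, r⟩ => by simp }
  let b : Equiv.Perm (ℤ × ℤ × ℚ) :=
    { toFun := fun v => (v.1 - 2 * v.2.1, v.2.1, v.2.2)
      invFun := fun v => (v.1 + 2 * v.2.1, v.2.1, v.2.2)
      left_inv := fun ⟨n, m, r⟩ => by simp
      right_inv := fun ⟨n, m, r⟩ => by simp }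
  let s : Equiv.Perm (ℤ × ℤ × ℚ) :=
    { toFun := fun v => (v.1, v.2.1, if v.1 = 1 then v.2.2 + 1 else v.2.2)
      invFun := fun v => (v.1, v.2.1, if v.1 = 1 then v.2.2 - 1 else v.2.2)
      left_inv := fun ⟨n, m, r⟩ => by by_cases hv : n = 1 <;> simp [hv]
      right_inv := fun ⟨n, m, r⟩ => by by_cases hv : n = 1 <;> simp [hv] }
  let z : Equiv.Perm (ℤ × ℤ × ℚ) :=
    { toFun := fun v => (v.1, v.2.1, if v.1 = 1 ∧ Even ⌊v.2.2⌋ then v.2.2 + 2 else v.2.2)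
      invFun := fun v => (v.1, v.2.1, if v.1 = 1 ∧ Even ⌊v.2.2⌋ then v.2.2 - 2 else v.2.2)
      left_inv := fun ⟨n, m, r⟩ => by
        by_cases hv : n = 1 <;> by_cases he : Even ⌊r⌋ <;> simp [hv, he]
      right_inv := fun ⟨n, m, r⟩ => by
        by_cases hv : n = 1 <;> by_cases he : Even ⌊r⌋ <;> simp [hv, he] }
  refine ⟨x, y, a, b, s, z, ?_, ?_, ?_, ?_, ?_, ?_, ?_, ?_⟩
  · rw [mul_inv_eq_one, mul_inv_eq_iff_eq_mul]
    ext v <;> simp [x, y]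
    ring
  · rw [mul_inv_eq_one, mul_inv_eq_iff_eq_mul]
    ext v <;> simp [x, a]
  · rw [mul_inv_eq_one, mul_inv_eq_iff_eq_mul]
    ext v <;> simp [x, y, a, pow_two]
    rw [zpow_sub₀ two_ne_zero, two_mul, zpow_add₀ two_ne_zero]
    field_simp
  · rw [mul_inv_eq_one, mul_inv_eq_iff_eq_mul]
    ext v <;> simp [x, y, b, pow_two]
    rw [zpow_sub₀ two_ne_zero, two_mul, zpow_add₀ two_ne_zero]
    field_simp
  · rw [mul_inv_eq_one, mul_inv_eq_iff_eq_mul]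
    ext v <;> simp [y, b]
  · rw [mul_inv_eq_one, mul_inv_eq_iff_eq_mul]
    ext v <;> simp [x, s, pow_two]
    by_cases hv : v.1 = 1 <;> simp [hv]
    ring
  · rw [mul_inv_eq_one, mul_inv_eq_iff_eq_mul]
    have s_sq : ∀ v, (s ^ 2) v = (v.1, v.2.1, if v.1 = 1 then v.2.2 + 2 else v.2.2) := fun v => by
      by_cases hv : v.1 = 1 <;> simp [s, hv, pow_two, add_assoc, one_add_one_eq_two]
    ext v <;> simp only [Equiv.Perm.mul_apply, s_sq] <;> simp [z]
    by_cases hv : v.1 = 1 <;> by_cases he : Even ⌊v.2.2⌋ <;> simp [hv, he]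
  · rw [Ne, mul_inv_eq_one, mul_inv_eq_iff_eq_mul]
    intro he
    have := congrArg (fun v => v.2.2) (DFunLike.congr_fun he (1, 0, 0))
    norm_num [s, z] at this

theorem IsEC.exists_isSanovSystem {G : Type u} [Group G] (hG : IsEC G) :
    ∃ x y a b s z : G, IsSanovSystem x y a b s z := by
  classical
  obtain ⟨x, y, a, b, s, z, h⟩ := exists_isSanovSystem_perm
  let X : Fin 6 → FreeGroup (G ⊕ Fin 6) := fun j => FreeGroup.of (Sum.inr j)
  obtain ⟨c, hE, hN⟩ := hG (G × Equiv.Perm (ℤ × ℤ × ℚ)) (MonoidHom.inl _ _)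
    (fun _ _ huv => congrArg Prod.fst huv) 6
    {X 0 * X 1 * (X 0)⁻¹ * (X 1)⁻¹, X 2 * X 0 * (X 2)⁻¹ * (X 0)⁻¹,
      X 2 * X 1 * (X 2)⁻¹ * (X 0 ^ 2 * X 1)⁻¹, X 3 * X 0 * (X 3)⁻¹ * (X 0 * X 1 ^ 2)⁻¹,
      X 3 * X 1 * (X 3)⁻¹ * (X 1)⁻¹, X 0 * X 4 * (X 0)⁻¹ * (X 4 ^ 2)⁻¹,
      X 5 * X 4 ^ 2 * (X 5)⁻¹ * (X 4 ^ 2)⁻¹}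
    {X 5 * X 4 * (X 5)⁻¹ * (X 4)⁻¹}
    ⟨fun j => (1, ![x, y, a, b, s, z] j), by
      obtain ⟨h1, h2, h3, h4, h5, h6, h7, h8⟩ := h
      simp only [Finset.mem_insert, Finset.mem_singleton, forall_eq_or_imp, forall_eq, map_mul,
        map_inv, map_pow, X, FreeGroup.lift_apply_of, Sum.elim_inr, Prod.ext_iff, Ne,
        Prod.fst_mul, Prod.snd_mul, Prod.fst_inv, Prod.snd_inv, Prod.pow_fst, Prod.pow_snd,
        Prod.fst_one, Prod.snd_one, one_pow, inv_one, mul_one, true_and]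
      exact ⟨⟨h1, h2, h3, h4, h5, h6, h7⟩, h8⟩⟩
  simp only [Finset.mem_insert, Finset.mem_singleton, forall_eq_or_imp, forall_eq, map_mul,
    map_inv, map_pow, X, FreeGroup.lift_apply_of, Sum.elim_inr] at hE hN
  obtain ⟨h1, h2, h3, h4, h5, h6, h7⟩ := hE
  exact ⟨c 0, c 1, c 2, c 3, c 4, c 5, h1, h2, h3, h4, h5, h6, h7, hN⟩

/-- No existentially closed group is amenable: if `G` is e.c., then there are a finite subset
`F` of `G` and `ε > 0` such that `G` contains no `(F, ε)`-Følner set. -/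
theorem ec_not_amenable {G : Type u} [Group G] (hG : IsEC G) :
    ∃ (F : Finset G) (ε : ℝ), 0 < ε ∧ ∀ H : Finset G, ¬ IsFolnerSet F ε H := by
  classical
  obtain ⟨x, y, a, b, s, z, h⟩ := hG.exists_isSanovSystem
  exact ⟨{a, b}, 1 / 4, by norm_num, h.not_isFolnerSet⟩
end

section
/- No locally universal group is amenable: if G is a locally universal group, then there exist a finite subset F of G and ε > 0 such that G contains no (F,ε)-Følner set. -/
open Filter

universe u

/-- `G` is locally universal: every group embeds into some ultrapower of `G`
(realized as the group of germs of functions `I → G` with respect to an ultrafilter on `I`). -/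
def IsLocallyUniversal (G : Type u) [Group G] : Prop :=
  ∀ (H : Type u) [Group H], ∃ (I : Type u) (UU : Ultrafilter I)
    (f : H →* Filter.Germ (UU : Filter I) G), Function.Injective f

/-- A two-colouring of `G` on which `a` and an element `b` of order dividing three act
paradoxically obstructs the Følner condition. -/
theorem not_isFolnerSet_of_coloring {G : Type*} [Group G] [DecidableEq G] {a b : G} (hb : b ^ 3 = 1)
    (B : Set G) (haB : ∀ g ∈ B, a * g ∉ B) (hbB : ∀ g ∉ B, b * g ∈ B ∧ b⁻¹ * g ∈ B)
    (H : Finset G) : ¬ IsFolnerSet {a, b, b⁻¹} (1 / 10) H := by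
  classical
  intro hH
  have escape : ∀ g ∈ ({a, b, b⁻¹} : Finset G),
      (((H.image (fun h => g * h)) \ H).card : ℝ) < 1 / 10 * H.card := by
    intro g hg
    refine lt_of_le_of_lt ?_ (hH g hg)
    norm_cast
    refine Finset.card_le_card ?_
    intro x hx
    simp only [Finset.mem_union, Finset.mem_sdiff, Finset.mem_image] at hx ⊢
    exact Or.inl hx
  have ea := escape a (by simp)
  have eb := escape b (by simp)
  have eb' := escape b⁻¹ (by simp)
  set HB := H.filter (· ∈ B)
  set HA := H.filter (· ∉ B)
  have hsum : HB.card + HA.card = H.card := Finset.card_filter_add_card_filter_not _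
  have hBA : HB.card ≤ HA.card + ((H.image (fun h => a * h)) \ H).card := by
    rw [← Finset.card_image_of_injective HB (mul_right_injective a)]
    refine (Finset.card_le_card ?_).trans (Finset.card_union_le _ _)
    intro x hx
    obtain ⟨h, hh, rfl⟩ := Finset.mem_image.1 hx
    obtain ⟨hhH, hhB⟩ := Finset.mem_filter.1 hh
    by_cases hxH : a * h ∈ H
    · exact Finset.mem_union_left _ (Finset.mem_filter.2 ⟨hxH, haB h hhB⟩)
    · exact Finset.mem_union_right _
        (Finset.mem_sdiff.2 ⟨Finset.mem_image_of_mem _ hhH, hxH⟩)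
  have hdisj : Disjoint (HA.image (fun h => b * h)) (HA.image (fun h => b⁻¹ * h)) := by
    rw [Finset.disjoint_left]
    intro x hx hx'
    obtain ⟨h, hh, rfl⟩ := Finset.mem_image.1 hx
    obtain ⟨h', hh', he⟩ := Finset.mem_image.1 hx'
    have h1 : h' = b⁻¹ * h := by
      have hbb : b * b = b⁻¹ := by
        rw [eq_inv_iff_mul_eq_one, ← hb, pow_succ, pow_two]
      rw [← hbb, mul_assoc, ← he, mul_inv_cancel_left]
    exact (Finset.mem_filter.1 hh').2 (h1 ▸ (hbB h (Finset.mem_filter.1 hh).2).2)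
  have hAB : HA.card + HA.card ≤ HB.card + (((H.image (fun h => b * h)) \ H).card
      + ((H.image (fun h => b⁻¹ * h)) \ H).card) := by
    have h1 : (HA.image (fun h => b * h)).card = HA.card :=
      Finset.card_image_of_injective HA (mul_right_injective b)
    have h2 : (HA.image (fun h => b⁻¹ * h)).card = HA.card :=
      Finset.card_image_of_injective HA (mul_right_injective b⁻¹)
    have h3 := Finset.card_union_of_disjoint hdisj
    rw [h1, h2] at h3
    rw [← h3]
    refine (Finset.card_le_card (t := HB ∪ (((H.image (fun h => b * h)) \ H)
      ∪ ((H.image (fun h => b⁻¹ * h)) \ H))) ?_).trans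
      ((Finset.card_union_le _ _).trans (Nat.add_le_add_left (Finset.card_union_le _ _) _))
    intro x hx
    rcases Finset.mem_union.1 hx with hx | hx <;> obtain ⟨h, hh, rfl⟩ := Finset.mem_image.1 hx <;>
      obtain ⟨hhH, hhB⟩ := Finset.mem_filter.1 hh
    · by_cases hxH : b * h ∈ H
      · exact Finset.mem_union_left _ (Finset.mem_filter.2 ⟨hxH, (hbB h hhB).1⟩)
      · exact Finset.mem_union_right _ (Finset.mem_union_left _
          (Finset.mem_sdiff.2 ⟨Finset.mem_image_of_mem _ hhH, hxH⟩))
    · by_cases hxH : b⁻¹ * h ∈ H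
      · exact Finset.mem_union_left _ (Finset.mem_filter.2 ⟨hxH, (hbB h hhB).2⟩)
      · exact Finset.mem_union_right _ (Finset.mem_union_right _
          (Finset.mem_sdiff.2 ⟨Finset.mem_image_of_mem _ hhH, hxH⟩))
  rify at hsum hBA hAB
  linarith

/-- An embedding of `Γ` into `G` admits a `Γ`-equivariant retraction. -/
theorem exists_equivariant_retraction {Γ G : Type*} [Group Γ] [Group G] (φ : Γ →* G)
    (hφ : Function.Injective φ) : ∃ r : G → Γ, ∀ γ g, r (φ γ * g) = γ * r g := by
  let s := QuotientGroup.rightRel φ.range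
  have key : ∀ g : G, ∃ γ : Γ, φ γ = g * (Quotient.mk s g).out⁻¹ := fun g =>
    QuotientGroup.rightRel_apply.1 (Quotient.exact (Quotient.out_eq (Quotient.mk s g)))
  choose r hr using key
  refine ⟨r, fun γ g => hφ ?_⟩
  have hmk : Quotient.mk s (φ γ * g) = Quotient.mk s g :=
    Quotient.sound (QuotientGroup.rightRel_apply.2 ⟨γ⁻¹, by simp⟩)
  rw [hr, map_mul, hr, hmk, mul_assoc]

/-- `P` and its conjugate by the involution `a` commute, and conjugation by `b` and `b⁻¹`,
where `b ^ 3 = 1`, moves the conjugate `a P a⁻¹` into the nonabelian subgroup `P`. -/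
structure IsPingPongTriple {G : Type*} [Group G] (P : Subgroup G) (a b : G) : Prop where
  sq_eq_one : a ^ 2 = 1
  cube_eq_one : b ^ 3 = 1
  commute : ∀ x ∈ P, ∀ y ∈ P, Commute x (a * y * a⁻¹)
  conj_mem : ∀ x ∈ P, b * (a * x * a⁻¹) * b⁻¹ ∈ P
  inv_conj_mem : ∀ x ∈ P, b⁻¹ * (a * x * a⁻¹) * b ∈ P
  not_commute : ∃ x ∈ P, ∃ y ∈ P, ¬ Commute x y

namespace IsPingPongTriple

variable {G : Type*} [Group G] {P : Subgroup G} {a b : G}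

/-- The elements of `P` outside its centre. -/
def noncentral (P : Subgroup G) : Set G := {x | x ∈ P ∧ ∃ y ∈ P, ¬ Commute x y}

theorem conj_notMem_noncentral (h : IsPingPongTriple P a b) {x : G} (hx : x ∈ noncentral P) :
    a⁻¹ * x * a ∉ noncentral P := by
  rintro ⟨hx', -⟩
  obtain ⟨hxP, y, hy, hxy⟩ := hx
  have := h.commute y hy _ hx'
  rw [show a * (a⁻¹ * x * a) * a⁻¹ = x by group] at this
  exact hxy this.symm

theorem conj_mem_noncentral (h : IsPingPongTriple P a b) {x : G}
    (hx : a⁻¹ * x * a ∈ noncentral P) :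
    b * x * b⁻¹ ∈ noncentral P ∧ b⁻¹ * x * b ∈ noncentral P := by
  obtain ⟨hxP, y, hy, hxy⟩ := hx
  have hxy' : ¬ Commute x (a * y * a⁻¹) := by
    intro hc
    apply hxy
    have := (Commute.conj_iff a⁻¹).2 hc
    rwa [show a⁻¹ * (a * y * a⁻¹) * a⁻¹⁻¹ = y by group, inv_inv] at this
  have hx1 := h.conj_mem _ hxP
  have hx2 := h.inv_conj_mem _ hxP
  rw [show a * (a⁻¹ * x * a) * a⁻¹ = x by group] at hx1 hx2
  refine ⟨⟨hx1, _, h.conj_mem _ hy, ?_⟩, ⟨hx2, _, h.inv_conj_mem _ hy, ?_⟩⟩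
  · exact fun hc => hxy' ((Commute.conj_iff b).1 hc)
  · intro hc
    apply hxy'
    rw [← Commute.conj_iff b⁻¹, inv_inv]
    exact hc

theorem ne_one_left (h : IsPingPongTriple P a b) : a ≠ 1 := by
  rintro rfl
  obtain ⟨x, hx, y, hy, hxy⟩ := h.not_commute
  exact h.conj_notMem_noncentral ⟨hx, y, hy, hxy⟩ (by simpa using ⟨hx, y, hy, hxy⟩)

theorem ne_one_right (h : IsPingPongTriple P a b) : b ≠ 1 := by
  rintro rfl
  obtain ⟨x, hx, y, hy, hxy⟩ := h.not_commute
  have hx' : x ∈ noncentral P := ⟨hx, y, hy, hxy⟩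
  have h1 : a⁻¹ * (a * x * a⁻¹) * a ∈ noncentral P := by
    rwa [show a⁻¹ * (a * x * a⁻¹) * a = x by group]
  have h2 := (h.conj_mem_noncentral h1).1
  simp only [one_mul, inv_one, mul_one] at h2
  exact h.conj_notMem_noncentral h2 h1

/-- The cyclic factors generated by the two elements of a ping-pong triple. -/
abbrev factor (a b : G) (i : Bool) : Subgroup G := Subgroup.zpowers (bif i then b else a)

theorem eq_of_mem_factor_false (h : IsPingPongTriple P a b) {x : G} (hx : x ∈ factor a b false)
    (hx1 : x ≠ 1) : x = a := by
  obtain ⟨n, rfl⟩ := hx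
  simp only [cond_false] at hx1 ⊢
  have ha : a ^ (2 : ℤ) = 1 := by exact_mod_cast h.sq_eq_one
  rcases Int.even_or_odd' n with ⟨k, rfl | rfl⟩
  · exact absurd (by rw [zpow_mul, ha, one_zpow]) hx1
  · rw [zpow_add, zpow_mul, ha, one_zpow, one_mul, zpow_one]

theorem eq_of_mem_factor_true (h : IsPingPongTriple P a b) {x : G} (hx : x ∈ factor a b true)
    (hx1 : x ≠ 1) : x = b ∨ x = b⁻¹ := by
  obtain ⟨n, rfl⟩ := hx
  simp only [cond_true] at hx1 ⊢
  have hb : b ^ (3 : ℤ) = 1 := by exact_mod_cast h.cube_eq_one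
  have hn : n = 3 * (n / 3) ∨ n = 3 * (n / 3) + 1 ∨ n = 3 * (n / 3 + 1) + -1 := by omega
  rcases hn with hn | hn | hn <;> rw [hn] at hx1 ⊢
  · exact absurd (by rw [zpow_mul, hb, one_zpow]) hx1
  · left; rw [zpow_add, zpow_mul, hb, one_zpow, one_mul, zpow_one]
  · right; rw [zpow_add, zpow_mul, hb, one_zpow, one_mul, zpow_neg_one]

theorem lift_injective (h : IsPingPongTriple P a b) :
    Function.Injective (Monoid.CoprodI.lift fun i => (factor a b i).subtype) := by
  let f : ∀ i, factor a b i →* MulAut G := fun i => MulAut.conj.comp (factor a b i).subtype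
  let X : Bool → Set G := fun i =>
    bif i then noncentral P else {x | a⁻¹ * x * a ∈ noncentral P}
  have hf : Monoid.CoprodI.lift f =
      MulAut.conj.comp (Monoid.CoprodI.lift fun i => (factor a b i).subtype) := by
    ext i x : 2
    simp [f]
  suffices hinj : Function.Injective (Monoid.CoprodI.lift f) by
    rw [hf, MonoidHom.coe_comp] at hinj
    exact hinj.of_comp
  refine Monoid.CoprodI.lift_injective_of_ping_pong f (Or.inr ⟨true, ?_⟩) X ?_ ?_ ?_
  · have : orderOf b = 3 := orderOf_eq_prime h.cube_eq_one h.ne_one_right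
    have hcard : Nat.card (factor a b true) = 3 := by simpa [factor, Nat.card_zpowers] using this
    have : Finite (factor a b true) := Nat.finite_of_card_ne_zero (by omega)
    rw [← Nat.cast_card, hcard]
    norm_num
  · obtain ⟨x, hx, y, hy, hxy⟩ := h.not_commute
    have hx' : x ∈ noncentral P := ⟨hx, y, hy, hxy⟩
    rintro (_ | _)
    · refine ⟨a * x * a⁻¹, ?_⟩
      simp only [X, cond_false, Set.mem_ofPred_eq]
      rwa [show a⁻¹ * (a * x * a⁻¹) * a = x by group]
    · exact ⟨x, hx'⟩
  · have hd : Disjoint (X false) (X true) :=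
      Set.disjoint_left.2 fun x hx hx' => h.conj_notMem_noncentral hx' hx
    rintro (_ | _) (_ | _) hij
    · exact absurd rfl hij
    · exact hd
    · exact hd.symm
    · exact absurd rfl hij
  · rintro (_ | _) (_ | _) hij ⟨k, hk⟩ hk1
    · exact absurd rfl hij
    · have hk1' : k ≠ 1 := fun hc => hk1 (Subtype.ext hc)
      obtain rfl := h.eq_of_mem_factor_false hk hk1'
      rintro _ ⟨x, hx, rfl⟩
      simp only [X, f, cond_false, cond_true, Set.mem_ofPred_eq, MonoidHom.comp_apply,
        Subgroup.subtype_apply, MulAut.smul_def, MulAut.conj_apply] at hx ⊢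
      rwa [show k⁻¹ * (k * x * k⁻¹) * k = x by group]
    · have hk1' : k ≠ 1 := fun hc => hk1 (Subtype.ext hc)
      rintro _ ⟨x, hx, rfl⟩
      have hx' := h.conj_mem_noncentral hx
      rcases h.eq_of_mem_factor_true hk hk1' with rfl | rfl
      · exact hx'.1
      · simpa [X, f] using hx'.2
    · exact absurd rfl hij

theorem exists_coloring (h : IsPingPongTriple P a b) :
    ∃ B : Set G, (∀ g ∈ B, a * g ∉ B) ∧ ∀ g ∉ B, b * g ∈ B ∧ b⁻¹ * g ∈ B := by
  classical
  obtain ⟨r, hr⟩ := exists_equivariant_retraction _ h.lift_injective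
  let ω : G → Monoid.CoprodI.Word (fun i => factor a b i) :=
    fun g => r g • Monoid.CoprodI.Word.empty
  have hω : ∀ (i : Bool) (k : G) (hk : k ∈ factor a b i), k ≠ 1 → ∀ g,
      (ω g).fstIdx ≠ some i → (ω (k * g)).fstIdx = some i := by
    intro i k hk hk1 g hg
    have hk1' : (⟨k, hk⟩ : factor a b i) ≠ 1 := fun hc => hk1 (congrArg Subtype.val hc)
    have : ω (k * g) = Monoid.CoprodI.Word.cons ⟨k, hk⟩ (ω g) hg hk1' := by
      rw [Monoid.CoprodI.Word.cons_eq_smul]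
      have := hr (Monoid.CoprodI.of (M := fun i => factor a b i) ⟨k, hk⟩) g
      rw [Monoid.CoprodI.lift_of] at this
      simp only [ω, ← mul_smul]
      rw [← this]
      rfl
    rw [this, Monoid.CoprodI.Word.fstIdx_cons]
  have hbm : b ∈ factor a b true := Subgroup.mem_zpowers b
  refine ⟨{g | (ω g).fstIdx = some true}, fun g hg hag => ?_, fun g hg => ⟨?_, ?_⟩⟩
  · have := hω false a (Subgroup.mem_zpowers a) h.ne_one_left g
      (by rw [show (ω g).fstIdx = some true from hg]; simp)
    rw [show (ω (a * g)).fstIdx = some true from hag] at this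
    simp at this
  · exact hω true b hbm h.ne_one_right g hg
  · exact hω true b⁻¹ (inv_mem hbm) (inv_ne_one.2 h.ne_one_right) g hg

/-- A ping-pong triple for a generated subgroup can be checked on generators. -/
theorem of_closure {S : Set G} (ha : a ^ 2 = 1) (hb : b ^ 3 = 1)
    (hcomm : ∀ x ∈ S, ∀ y ∈ S, Commute x (a * y * a⁻¹))
    (hconj : ∀ x ∈ S, b * (a * x * a⁻¹) * b⁻¹ ∈ Subgroup.closure S)
    (hconj' : ∀ x ∈ S, b⁻¹ * (a * x * a⁻¹) * b ∈ Subgroup.closure S)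
    (hnc : ∃ x ∈ S, ∃ y ∈ S, ¬ Commute x y) : IsPingPongTriple (Subgroup.closure S) a b := by
  have hcl : ∀ g : G, (∀ x ∈ S, g * x * g⁻¹ ∈ Subgroup.closure S) →
      ∀ x ∈ Subgroup.closure S, g * x * g⁻¹ ∈ Subgroup.closure S := by
    intro g hg x hx
    have : Subgroup.closure S ≤ (Subgroup.closure S).comap (MulAut.conj g).toMonoidHom :=
      (Subgroup.closure_le _).2 fun x hx => hg x hx
    exact this hx
  refine ⟨ha, hb, fun x hx y hy => ?_, fun x hx => ?_, fun x hx => ?_, ?_⟩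
  · have h1 : ∀ y ∈ S, Commute x (a * y * a⁻¹) := by
      intro y hy
      have : Subgroup.closure S ≤ Subgroup.centralizer {a * y * a⁻¹} :=
        (Subgroup.closure_le _).2 fun z hz =>
          Subgroup.mem_centralizer_singleton_iff.2 (hcomm z hz y hy)
      exact Subgroup.mem_centralizer_singleton_iff.1 (this hx)
    have : Subgroup.closure S ≤
        (Subgroup.centralizer {x}).comap (MulAut.conj a).toMonoidHom :=
      (Subgroup.closure_le _).2 fun z hz =>
        Subgroup.mem_centralizer_singleton_iff.2 (h1 z hz).symm
    exact (Subgroup.mem_centralizer_singleton_iff.1 (this hy)).symm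
  · have := hcl (b * a) (fun x hx => by simpa [mul_assoc] using hconj x hx) x hx
    simpa [mul_assoc] using this
  · have := hcl (b⁻¹ * a) (fun x hx => by simpa [mul_assoc] using hconj' x hx) x hx
    simpa [mul_assoc] using this
  · obtain ⟨x, hx, y, hy, hxy⟩ := hnc
    exact ⟨x, Subgroup.subset_closure hx, y, Subgroup.subset_closure hy, hxy⟩

end IsPingPongTriple

/-- A group embedding into an ultrapower of `G` satisfies only those finite systems of equations
and inequations that have a solution in `G`. -/
theorem exists_freeGroup_hom_of_injective_germ {Γ G I α : Type*} [Group Γ] [Group G]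
    {U : Ultrafilter I} {f : Γ →* Filter.Germ (U : Filter I) G} (hf : Function.Injective f)
    (φ : FreeGroup α →* Γ) {S : Set (FreeGroup α)} (hS : S.Finite) :
    ∃ ψ : FreeGroup α →* G, ∀ s ∈ S, ψ s = 1 ↔ φ s = 1 := by
  have hlift : ∀ k : α, ∃ p : I → G, (p : Filter.Germ (U : Filter I) G) = f (φ (.of k)) :=
    fun k => Quotient.exists_rep (f (φ (.of k)))
  choose p hp using hlift
  let Ψ : FreeGroup α →* (I → G) := FreeGroup.lift p
  have hΨ : (Filter.Germ.coeMulHom (U : Filter I)).comp Ψ = f.comp φ := by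
    ext k
    simpa [Ψ] using hp k
  have hs : ∀ s ∈ S, ∀ᶠ i in (U : Filter I), (Ψ s i = 1 ↔ φ s = 1) := by
    intro s _
    have hs : ((Ψ s : I → G) : Filter.Germ (U : Filter I) G) = f (φ s) :=
      DFunLike.congr_fun hΨ s
    have hiff : (∀ᶠ i in (U : Filter I), Ψ s i = 1) ↔ φ s = 1 := by
      rw [← map_eq_one_iff f hf, ← hs]
      exact Filter.Germ.coe_eq.symm
    by_cases h : φ s = 1
    · simpa [h] using hiff.2 h
    · simpa [h] using Ultrafilter.eventually_not.2 (fun hc => h (hiff.1 hc))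
  obtain ⟨i, hi⟩ := ((Filter.eventually_all_finite hS).2 hs).exists
  exact ⟨(Pi.evalMonoidHom _ i).comp Ψ, hi⟩

open scoped commutatorElement in
/-- Ping-pong triples with finitely generated subgroup pass from a group embedded into an
ultrapower of `G` to `G` itself. -/
theorem exists_isPingPongTriple_of_injective_germ {Γ G I : Type*} [Group Γ] [Group G]
    {U : Ultrafilter I} {f : Γ →* Filter.Germ (U : Filter I) G} (hf : Function.Injective f)
    {T : Set Γ} (hT : T.Finite) {a b : Γ} (h : IsPingPongTriple (Subgroup.closure T) a b)
    (hnc : ∃ x ∈ T, ∃ y ∈ T, ¬ Commute x y) :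
    ∃ (P : Subgroup G) (a' b' : G), IsPingPongTriple P a' b' := by
  let φ : FreeGroup Γ →* Γ := FreeGroup.lift id
  have hφ : ∀ x, φ (.of x) = x := fun x => by simp [φ]
  let R : Set (FreeGroup Γ) := FreeGroup.of '' T
  have hφR : φ '' R = T := by
    simp only [R, Set.image_image, hφ, Set.image_id']
  have hword : ∀ x ∈ Subgroup.closure T, ∃ w ∈ Subgroup.closure R, φ w = x := by
    intro x hx
    rw [← hφR, ← MonoidHom.map_closure] at hx
    exact hx
  have hA : ∀ x : T, ∃ w ∈ Subgroup.closure R, φ w = b * (a * x * a⁻¹) * b⁻¹ := fun x =>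
    hword _ (h.conj_mem _ (Subgroup.subset_closure x.2))
  have hB : ∀ x : T, ∃ w ∈ Subgroup.closure R, φ w = b⁻¹ * (a * x * a⁻¹) * b := fun x =>
    hword _ (h.inv_conj_mem _ (Subgroup.subset_closure x.2))
  choose u hu hu' using hA
  choose v hv hv' using hB
  let A : FreeGroup Γ := .of a
  let B : FreeGroup Γ := .of b
  let o : T → FreeGroup Γ := fun x => .of x.1
  have : Finite T := hT
  let S : Set (FreeGroup Γ) :=
    {A ^ 2, B ^ 3} ∪ Set.range (fun x : T × T => ⁅o x.1, A * o x.2 * A⁻¹⁆)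
      ∪ Set.range (fun x : T => u x / (B * (A * o x * A⁻¹) * B⁻¹))
      ∪ Set.range (fun x : T => v x / (B⁻¹ * (A * o x * A⁻¹) * B))
      ∪ Set.range (fun x : T × T => ⁅o x.1, o x.2⁆)
  have hS : S.Finite := ((((Set.toFinite _).union (Set.finite_range _)).union
    (Set.finite_range _)).union (Set.finite_range _)).union (Set.finite_range _)
  obtain ⟨ψ, hψ⟩ := exists_freeGroup_hom_of_injective_germ hf φ hS
  have hcl : ∀ w ∈ Subgroup.closure R, ψ w ∈ Subgroup.closure (ψ '' R) := by
    intro w hw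
    rw [← MonoidHom.map_closure]
    exact ⟨w, hw, rfl⟩
  refine ⟨Subgroup.closure (ψ '' R), ψ A, ψ B, IsPingPongTriple.of_closure ?_ ?_ ?_ ?_ ?_ ?_⟩
  · rw [← map_pow, hψ _ (by simp [S]), map_pow, hφ]
    exact h.sq_eq_one
  · rw [← map_pow, hψ _ (by simp [S]), map_pow, hφ]
    exact h.cube_eq_one
  · rintro _ ⟨_, ⟨x, hx, rfl⟩, rfl⟩ _ ⟨_, ⟨y, hy, rfl⟩, rfl⟩
    have hmem : ⁅o ⟨x, hx⟩, A * o ⟨y, hy⟩ * A⁻¹⁆ ∈ S :=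
      Or.inl (Or.inl (Or.inl (Or.inr ⟨(⟨x, hx⟩, ⟨y, hy⟩), rfl⟩)))
    have := (hψ _ hmem).2 (by
      simp only [map_commutatorElement, map_mul, map_inv, commutatorElement_eq_one_iff_commute,
        o, A, hφ]
      exact h.commute x (Subgroup.subset_closure hx) y (Subgroup.subset_closure hy))
    simpa only [map_commutatorElement, map_mul, map_inv,
      commutatorElement_eq_one_iff_commute] using this
  · rintro _ ⟨_, ⟨x, hx, rfl⟩, rfl⟩
    have hmem : u ⟨x, hx⟩ / (B * (A * o ⟨x, hx⟩ * A⁻¹) * B⁻¹) ∈ S :=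
      Or.inl (Or.inl (Or.inr ⟨⟨x, hx⟩, rfl⟩))
    have := (hψ _ hmem).2 (by simp only [map_div, map_mul, map_inv, hu', o, A, B, hφ, div_self'])
    rw [map_div, div_eq_one] at this
    simp only [map_mul, map_inv] at this
    exact this ▸ hcl _ (hu _)
  · rintro _ ⟨_, ⟨x, hx, rfl⟩, rfl⟩
    have hmem : v ⟨x, hx⟩ / (B⁻¹ * (A * o ⟨x, hx⟩ * A⁻¹) * B) ∈ S :=
      Or.inl (Or.inr ⟨⟨x, hx⟩, rfl⟩)
    have := (hψ _ hmem).2 (by simp only [map_div, map_mul, map_inv, hv', o, A, B, hφ, div_self'])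
    rw [map_div, div_eq_one] at this
    simp only [map_mul, map_inv] at this
    exact this ▸ hcl _ (hv _)
  · obtain ⟨x, hx, y, hy, hxy⟩ := hnc
    refine ⟨_, ⟨_, ⟨x, hx, rfl⟩, rfl⟩, _, ⟨_, ⟨y, hy, rfl⟩, rfl⟩, fun hc => hxy ?_⟩
    have hmem : ⁅o ⟨x, hx⟩, o ⟨y, hy⟩⁆ ∈ S := Or.inr ⟨(⟨x, hx⟩, ⟨y, hy⟩), rfl⟩
    have := (hψ _ hmem).1 (by
      simpa only [map_commutatorElement, commutatorElement_eq_one_iff_commute] using hc)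
    simpa only [map_commutatorElement, commutatorElement_eq_one_iff_commute, o, hφ] using this

/-- Indices of the blocks (first letters) of a list: three families of blocks, each indexed
by `ℤ`. -/
abbrev Block : Type := ℤ × ZMod 3

namespace ListPerm

open Equiv

/-- The permutation of lists acting on the tail of a list by a permutation depending on its
head. -/
def blocks {β : Type*} : (β → Perm (List β)) →* Perm (List β) where
  toFun f :=
    { toFun := fun l => l.casesOn [] fun k m => k :: f k m
      invFun := fun l => l.casesOn [] fun k m => k :: (f k)⁻¹ m
      left_inv := by rintro (_ | ⟨k, m⟩) <;> simp
      right_inv := by rintro (_ | ⟨k, m⟩) <;> simp }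
  map_one' := by ext1 (_ | ⟨k, m⟩) <;> rfl
  map_mul' f g := by ext1 (_ | ⟨k, m⟩) <;> rfl

/-- The permutation of lists acting on the head of a list. -/
def onHead {β : Type*} : Perm β →* Perm (List β) where
  toFun σ :=
    { toFun := fun l => l.casesOn [] fun k m => σ k :: m
      invFun := fun l => l.casesOn [] fun k m => σ⁻¹ k :: m
      left_inv := by rintro (_ | ⟨k, m⟩) <;> simp
      right_inv := by rintro (_ | ⟨k, m⟩) <;> simp }
  map_one' := by ext1 (_ | ⟨k, m⟩) <;> rfl
  map_mul' f g := by ext1 (_ | ⟨k, m⟩) <;> rfl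

section

variable {β : Type*} (f : β → Perm (List β)) (σ : Perm β) (k : β) (m : List β)

@[simp] theorem blocks_nil : blocks f [] = [] := rfl

@[simp] theorem blocks_cons : blocks f (k :: m) = k :: f k m := rfl

@[simp] theorem onHead_nil : onHead σ [] = [] := rfl

@[simp] theorem onHead_cons : onHead σ (k :: m) = σ k :: m := rfl

theorem onHead_mul_blocks :
    onHead σ * blocks f * (onHead σ)⁻¹ = blocks (fun k => f (σ⁻¹ k)) := by
  rw [mul_inv_eq_iff_eq_mul]
  ext1 (_ | ⟨k, m⟩) <;> simp

end

/-- The permutation of the blocks cycling the three families. -/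
def cycle : Perm Block := (Equiv.refl ℤ).prodCongr (Equiv.addRight 1)

/-- The permutation of the blocks shifting family `0`. -/
def shift : Perm Block where
  toFun k := if k.2 = 0 then (k.1 + 1, k.2) else k
  invFun k := if k.2 = 0 then (k.1 - 1, k.2) else k
  left_inv := by rintro ⟨n, j⟩; by_cases h : j = 0 <;> simp [h]
  right_inv := by rintro ⟨n, j⟩; by_cases h : j = 0 <;> simp [h]

/-- The map acting on the blocks with nonnegative index as `c`, `s` and itself on family `0`, `1`
and `2`, respectively. -/
def spreadAux (c s : List Block → List Block) : List Block → List Block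
  | [] => []
  | k :: m => k :: (if k.1 < 0 then m else if k.2 = 0 then c m else if k.2 = 1 then s m
      else spreadAux c s m)

theorem spreadAux_leftInverse {c c' s s' : List Block → List Block}
    (hc : Function.LeftInverse c' c) (hs : Function.LeftInverse s' s) :
    Function.LeftInverse (spreadAux c' s') (spreadAux c s) := by
  intro l
  induction l with
  | nil => rfl
  | cons k m ih =>
    simp only [spreadAux]
    split_ifs <;> simp [hc m, hs m, ih]

/-- The permutation acting on the blocks with nonnegative index as `onHead cycle`,
`onHead shift` and itself on family `0`, `1` and `2`, respectively. -/
def spread : Perm (List Block) where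
  toFun := spreadAux (onHead cycle) (onHead shift)
  invFun := spreadAux (onHead cycle).symm (onHead shift).symm
  left_inv := spreadAux_leftInverse (onHead cycle).left_inv (onHead shift).left_inv
  right_inv := spreadAux_leftInverse (onHead cycle).right_inv (onHead shift).right_inv

/-- The three generators, indexed by the families. -/
def gen (j : ZMod 3) : Perm (List Block) :=
  if j = 0 then onHead cycle else if j = 1 then onHead shift else spread

theorem spread_eq_blocks : spread = blocks fun k => if k.1 < 0 then 1 else gen k.2 := by
  ext1 (_ | ⟨k, m⟩)
  · rfl
  · rw [blocks_cons]
    change k :: _ = _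
    simp only [gen]
    split_ifs <;> rfl

/-- The generated subgroup. -/
abbrev genGroup : Subgroup (Perm (List Block)) := Subgroup.closure (Set.range gen)

theorem onHead_cycle_mem : onHead cycle ∈ genGroup := Subgroup.subset_closure ⟨0, rfl⟩

theorem onHead_shift_mem : onHead shift ∈ genGroup := Subgroup.subset_closure ⟨1, rfl⟩

theorem spread_mem : spread ∈ genGroup := Subgroup.subset_closure ⟨2, rfl⟩

theorem blocks_mulSingle_cycle {x : Perm (List Block)} {k : Block} :
    blocks (Pi.mulSingle k x) ∈ genGroup → blocks (Pi.mulSingle (cycle k) x) ∈ genGroup := by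
  intro h
  have := mul_mem (mul_mem onHead_cycle_mem h) (inv_mem onHead_cycle_mem)
  rw [onHead_mul_blocks] at this
  convert this using 2
  ext1 k'
  simp only [Pi.mulSingle_apply, Equiv.Perm.inv_eq_iff_eq]

/-- The shift of family `j`. -/
def shiftAt (j : ZMod 3) : Perm Block := cycle ^ j.val * shift * (cycle ^ j.val)⁻¹

theorem onHead_shiftAt_mem (j : ZMod 3) : onHead (shiftAt j) ∈ genGroup := by
  simp only [shiftAt, map_mul, map_inv, map_pow]
  exact mul_mem (mul_mem (pow_mem onHead_cycle_mem _) onHead_shift_mem)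
    (inv_mem (pow_mem onHead_cycle_mem _))

theorem cycle_pow_apply (n : ℕ) (k : Block) : (cycle ^ n) k = (k.1, k.2 + n) := by
  induction n with
  | zero => simp
  | succ n ih => rw [pow_succ', Perm.mul_apply, ih]; simp [cycle, add_assoc]

theorem shiftAt_apply (j : ZMod 3) (k : Block) :
    shiftAt j k = if k.2 = j then (k.1 + 1, k.2) else k := by
  have : ((cycle ^ j.val)⁻¹ : Perm Block) k = (k.1, k.2 - j) := by
    rw [Equiv.Perm.inv_eq_iff_eq, cycle_pow_apply]; simp
  rw [shiftAt, Perm.mul_apply, Perm.mul_apply, this, cycle_pow_apply]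
  by_cases h : k.2 = j
  · simp [shift, h]
  · simp [shift, h, sub_eq_zero]

theorem blocks_mulSingle_gen_mem (j : ZMod 3) :
    blocks (Pi.mulSingle ((0, j) : Block) (gen j)) ∈ genGroup := by
  have h := mul_mem (mul_mem (onHead_shiftAt_mem j) spread_mem) (inv_mem (onHead_shiftAt_mem j))
  have h' := mul_mem spread_mem (inv_mem h)
  rw [spread_eq_blocks, onHead_mul_blocks, ← map_inv, ← map_mul] at h'
  convert h' using 2
  ext1 ⟨n, i⟩
  have hinv : ((shiftAt j)⁻¹ : Perm Block) (n, i) = if i = j then (n - 1, i) else (n, i) := by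
    rw [Equiv.Perm.inv_eq_iff_eq, shiftAt_apply]
    by_cases hi : i = j <;> simp [hi]
  simp only [Pi.mul_apply, Pi.inv_apply, hinv, Pi.mulSingle_apply, Prod.mk.injEq]
  by_cases hi : i = j
  · subst hi
    rcases lt_trichotomy n 0 with hn | rfl | hn
    · have : n - 1 < 0 := by omega
      simp [hn, this, hn.ne]
    · simp
    · have h1 : ¬ n < 0 := by omega
      have h2 : ¬ n < 1 := by omega
      simp [h1, h2, hn.ne']
  · simp [hi]

theorem blocks_mulSingle_mem {x : Perm (List Block)} (hx : x ∈ genGroup) (i : ZMod 3) :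
    blocks (Pi.mulSingle ((0, i) : Block) x) ∈ genGroup := by
  have : genGroup ≤ genGroup.comap
      (blocks.comp (MonoidHom.mulSingle (fun _ : Block => Perm (List Block)) ((0, i) : Block))) := by
    rw [genGroup, Subgroup.closure_le]
    rintro _ ⟨j, rfl⟩
    have hpow : ∀ n : ℕ,
        blocks (Pi.mulSingle ((cycle ^ n) ((0, j) : Block)) (gen j)) ∈ genGroup := by
      intro n
      induction n with
      | zero => exact blocks_mulSingle_gen_mem j
      | succ n ih => rw [pow_succ']; exact blocks_mulSingle_cycle ih
    have := hpow (i - j).val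
    rw [cycle_pow_apply] at this
    simpa using this
  exact this hx

/-- The points of the model: two copies of the space of lists. -/
abbrev Model : Type := Bool × List Block

/-- The action of a permutation of lists on the copy `true`. -/
def incl : Perm (List Block) →* Perm Model where
  toFun x :=
    { toFun := fun p => if p.1 then (p.1, x p.2) else p
      invFun := fun p => if p.1 then (p.1, x⁻¹ p.2) else p
      left_inv := by rintro ⟨_ | _, l⟩ <;> simp
      right_inv := by rintro ⟨_ | _, l⟩ <;> simp }
  map_one' := by ext1 ⟨_ | _, l⟩ <;> rfl
  map_mul' x y := by ext1 ⟨_ | _, l⟩ <;> rfl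

@[simp] theorem incl_true (x : Perm (List Block)) (l : List Block) :
    incl x (true, l) = (true, x l) := rfl

@[simp] theorem incl_false (x : Perm (List Block)) (l : List Block) :
    incl x (false, l) = (false, l) := rfl

/-- The involution exchanging the two copies. -/
def flip : Perm Model where
  toFun p := (!p.1, p.2)
  invFun p := (!p.1, p.2)
  left_inv := by rintro ⟨_ | _, l⟩ <;> rfl
  right_inv := by rintro ⟨_ | _, l⟩ <;> rfl

/-- The map cycling the copy `false` and the blocks `(0, 0)` and `(0, 1)` of the copy `true`. -/
def rotateAux : Model → Model
  | (false, l) => (true, (0, 0) :: l)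
  | (true, []) => (true, [])
  | (true, k :: m) => if k = (0, 0) then (true, (0, 1) :: m)
      else if k = (0, 1) then (false, m) else (true, k :: m)

theorem rotateAux_cube (p : Model) : rotateAux (rotateAux (rotateAux p)) = p := by
  rcases p with ⟨_ | _, _ | ⟨k, m⟩⟩
  · simp [rotateAux]
  · simp [rotateAux]
  · simp [rotateAux]
  · by_cases h0 : k = (0, 0)
    · simp [rotateAux, h0]
    · by_cases h1 : k = (0, 1)
      · simp [rotateAux, h1]
      · simp [rotateAux, h0, h1]

/-- The permutation of order three underlying `rotateAux`. -/
def rotate : Perm Model where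
  toFun := rotateAux
  invFun p := rotateAux (rotateAux p)
  left_inv := rotateAux_cube
  right_inv := rotateAux_cube

@[simp] theorem flip_inv : flip⁻¹ = flip := rfl

@[simp] theorem flip_apply (i : Bool) (l : List Block) : flip (i, l) = (!i, l) := rfl

theorem rotate_conj (x : Perm (List Block)) :
    rotate * (flip * incl x * flip⁻¹) * rotate⁻¹ =
      incl (blocks (Pi.mulSingle ((0, 0) : Block) x)) := by
  rw [mul_inv_eq_iff_eq_mul, ← mul_assoc, mul_inv_eq_iff_eq_mul]
  ext1 ⟨_ | _, _ | ⟨k, m⟩⟩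
  all_goals simp [rotate, rotateAux]
  split_ifs <;> simp_all

theorem rotate_inv_conj (x : Perm (List Block)) :
    rotate⁻¹ * (flip * incl x * flip⁻¹) * rotate =
      incl (blocks (Pi.mulSingle ((0, 1) : Block) x)) := by
  rw [mul_assoc, inv_mul_eq_iff_eq_mul]
  ext1 ⟨_ | _, _ | ⟨k, m⟩⟩
  all_goals simp [rotate, rotateAux]
  split_ifs <;> simp_all

theorem not_commute_gen : ¬ Commute (incl (gen 0)) (incl (gen 1)) := by
  intro h
  have := Equiv.congr_fun h.eq (true, [((0, 0) : Block)])
  simp [gen, cycle, shift] at this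

theorem isPingPongTriple :
    IsPingPongTriple (Subgroup.closure (Set.range fun j => incl (gen j))) flip rotate := by
  have hmem : ∀ x ∈ genGroup, incl x ∈ Subgroup.closure (Set.range fun j => incl (gen j)) := by
    intro x hx
    have := Subgroup.mem_map_of_mem incl hx
    rwa [genGroup, MonoidHom.map_closure, ← Set.range_comp] at this
  refine IsPingPongTriple.of_closure ?_ ?_ ?_ ?_ ?_ ?_
  · ext1 ⟨_ | _, l⟩ <;> rfl
  · ext1 p
    exact rotateAux_cube p
  · rintro _ ⟨i, rfl⟩ _ ⟨j, rfl⟩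
    ext1 ⟨_ | _, l⟩ <;> simp
  · rintro _ ⟨j, rfl⟩
    rw [rotate_conj]
    exact hmem _ (blocks_mulSingle_mem (Subgroup.subset_closure ⟨j, rfl⟩) 0)
  · rintro _ ⟨j, rfl⟩
    rw [rotate_inv_conj]
    exact hmem _ (blocks_mulSingle_mem (Subgroup.subset_closure ⟨j, rfl⟩) 1)
  · exact ⟨_, ⟨0, rfl⟩, _, ⟨1, rfl⟩, not_commute_gen⟩

end ListPerm

/-- No locally universal group is amenable: if `G` is locally universal, then there are a
finite subset `F` of `G` and `ε > 0` such that `G` contains no `(F, ε)`-Følner set. -/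
theorem locally_universal_not_amenable {G : Type u} [Group G] (hG : IsLocallyUniversal G) :
    ∃ (F : Finset G) (ε : ℝ), 0 < ε ∧ ∀ H : Finset G, ¬ IsFolnerSet F ε H := by
  classical
  obtain ⟨I, U, f, hf⟩ := hG (ULift.{u} (Equiv.Perm ListPerm.Model))
  have hf' : Function.Injective (f.comp MulEquiv.ulift.symm.toMonoidHom) :=
    hf.comp MulEquiv.ulift.symm.injective
  obtain ⟨P, a, b, h⟩ := exists_isPingPongTriple_of_injective_germ hf' (Set.finite_range _)
    ListPerm.isPingPongTriple ⟨_, ⟨0, rfl⟩, _, ⟨1, rfl⟩, ListPerm.not_commute_gen⟩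
  obtain ⟨B, haB, hbB⟩ := h.exists_coloring
  exact ⟨{a, b, b⁻¹}, 1 / 10, by norm_num,
    not_isFolnerSet_of_coloring h.cube_eq_one B haB hbB⟩
end

section
/- Every finitely generated group with solvable word problem embeds into every locally universal group: if S is a group for which there exist k ∈ ℕ and a surjective group homomorphism π from the free group on k generators onto S such that the set {w : π(w) = 1} is a computable subset of the free group on k generators, and G is a locally universal group, then there is an injective group homomorphism from S into G. -/
open Filter

universe u

/-- `S` is a finitely generated group with solvable word problem: there is a surjection
`π : F_k → S` from a free group on `k` generators such that `{w : π w = 1}` is a computable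
(decidable) subset of `F_k`, where elements of `F_k` are presented by words, i.e. lists of
generators and their inverses. -/
def HasSolvableWordProblem (S : Type*) [Group S] : Prop :=
  ∃ (k : ℕ) (π : FreeGroup (Fin k) →* S), Function.Surjective π ∧
    ComputablePred (fun l : List (Fin k × Bool) => π (FreeGroup.mk l) = 1)

namespace HNNExtension

section OfHoms

variable {A G : Type} [Group A] [Group G] {j₀ j₁ : A →* G}
  (h₀ : Function.Injective j₀) (h₁ : Function.Injective j₁)

/-- The isomorphism between the ranges of two injective homomorphisms with the same domain. -/
noncomputable def rangeEquiv : j₀.range ≃* j₁.range :=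
  (j₀.ofInjective h₀).symm.trans (j₁.ofInjective h₁)

theorem coe_rangeEquiv (a : A) : (rangeEquiv h₀ h₁ ⟨j₀ a, a, rfl⟩ : G) = j₁ a := by
  have : (j₀.ofInjective h₀).symm ⟨j₀ a, a, rfl⟩ = a := by
    rw [MulEquiv.symm_apply_eq]; rfl
  simp only [rangeEquiv, MulEquiv.trans_apply, this]
  rfl

/-- The HNN extension in which the stable letter conjugates `j₀ a` to `j₁ a`. -/
abbrev OfHoms : Type := HNNExtension G j₀.range j₁.range (rangeEquiv h₀ h₁)

theorem t_mul_of_ofHoms (a : A) :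
    (t : OfHoms h₀ h₁) * of (j₀ a) = of (j₁ a) * t := by
  have := t_mul_of (φ := rangeEquiv h₀ h₁) ⟨j₀ a, a, rfl⟩
  rwa [coe_rangeEquiv] at this

theorem exists_eq_reducedWord_prod {B C : Subgroup G} {φ : B ≃* C} (x : HNNExtension G B C φ) :
    ∃ w : NormalWord.ReducedWord G B C, w.prod φ = x := by
  obtain ⟨d⟩ := NormalWord.TransversalPair.nonempty G B C
  exact ⟨(NormalWord.equiv φ d x).toReducedWord, (NormalWord.equiv φ d).symm_apply_apply x⟩

/-- An embedding of base groups which reflects the associated subgroups induces an embedding of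
HNN extensions. -/
theorem exists_map_injective {A' G' : Type} [Group A'] [Group G'] {j₀' j₁' : A' →* G'}
    (h₀' : Function.Injective j₀') (h₁' : Function.Injective j₁') {j : G →* G'}
    (hj : Function.Injective j) (hm : ∀ a, ∃ a', j (j₀ a) = j₀' a' ∧ j (j₁ a) = j₁' a')
    (hr₀ : ∀ g, j g ∈ j₀'.range → g ∈ j₀.range) (hr₁ : ∀ g, j g ∈ j₁'.range → g ∈ j₁.range) :
    ∃ J : OfHoms h₀ h₁ →* OfHoms h₀' h₁', Function.Injective J ∧
      (∀ g, J (of g) = of (j g)) ∧ J t = t := by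
  let J : OfHoms h₀ h₁ →* OfHoms h₀' h₁' := lift (of.comp j) t (by
    rintro ⟨_, a, rfl⟩
    rw [coe_rangeEquiv]
    obtain ⟨a', ha₀, ha₁⟩ := hm a
    simp only [MonoidHom.comp_apply, ha₀, ha₁]
    exact t_mul_of_ofHoms h₀' h₁' a')
  have hJof (g : G) : J (of g) = of (j g) := lift_of _ _ _ _
  have hJt : J t = t := lift_t _ _ _
  refine ⟨J, (injective_iff_map_eq_one J).2 fun x hx => ?_, hJof, hJt⟩
  obtain ⟨w, rfl⟩ := exists_eq_reducedWord_prod x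
  let w' : NormalWord.ReducedWord G' j₀'.range j₁'.range :=
    ⟨j w.head, w.toList.map (Prod.map id j), by
      rw [List.isChain_map]
      refine w.chain.imp fun a b hab h => hab ?_
      obtain ⟨u, g⟩ := a
      rcases Int.units_eq_one_or u with rfl | rfl
      · exact hr₀ g h
      · exact hr₁ g h⟩
  have hw : J (w.prod _) = w'.prod _ := by
    simp only [NormalWord.ReducedWord.prod, map_mul, hJof, map_list_prod, List.map_map, w']
    congr 3
    funext a
    simp [hJof, hJt]
  have hnil := ReducedWord.toList_eq_nil_of_mem_of_range (rangeEquiv h₀' h₁') w'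
    (by rw [← hw, hx]; exact one_mem _)
  have hnil' : w.toList = [] := List.map_eq_nil_iff.1 hnil
  have hprod : w.prod (rangeEquiv h₀ h₁) = of w.head := by
    simp [NormalWord.ReducedWord.prod, hnil']
  rw [hprod, hJof, map_eq_one_iff _ (of_injective _), map_eq_one_iff j hj] at hx
  rw [hprod, hx, map_one]

end OfHoms

/-- A finite family of partial isomorphisms can be realized simultaneously by conjugation in
an overgroup. -/
theorem exists_conj_family {ε : Type} [Finite ε] {G : Type} [Group G] {M : ε → Type}
    [∀ e, Group (M e)] {J₀ J₁ : ∀ e, M e →* G} (h₀ : ∀ e, Function.Injective (J₀ e))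
    (h₁ : ∀ e, Function.Injective (J₁ e)) :
    ∃ (K : Type) (_ : Group K) (i : G →* K) (r : ε → K), Function.Injective i ∧
      ∀ e a, r e * i (J₀ e a) = i (J₁ e a) * r e := by
  classical
  cases nonempty_fintype ε
  suffices ∀ s : Finset ε, ∃ (K : Type) (_ : Group K) (i : G →* K) (r : ε → K),
      Function.Injective i ∧ ∀ e ∈ s, ∀ a, r e * i (J₀ e a) = i (J₁ e a) * r e by
    simpa using this Finset.univ
  intro s
  induction s using Finset.induction_on with
  | empty => exact ⟨G, _, MonoidHom.id G, fun _ => 1, Function.injective_id, by simp⟩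
  | insert e s he ih =>
    obtain ⟨K, _, i, r, hi, hr⟩ := ih
    have h₀' : Function.Injective (i.comp (J₀ e)) := hi.comp (h₀ e)
    have h₁' : Function.Injective (i.comp (J₁ e)) := hi.comp (h₁ e)
    refine ⟨OfHoms h₀' h₁', inferInstance, of.comp i,
      Function.update (fun e' => of (r e')) e t, (of_injective _).comp hi, fun e' he' a => ?_⟩
    rcases Finset.mem_insert.1 he' with rfl | hs
    · simpa using t_mul_of_ofHoms h₀' h₁' a
    · rw [Function.update_of_ne (by rintro rfl; exact he hs)]
      simp only [MonoidHom.comp_apply, ← map_mul, hr e' hs a]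

end HNNExtension

namespace FreeGroup

section Shift

variable {α V V' : Type}

/-- The endomorphism of the free group on `V ⊕ α` killing the letters in `V` outside `D`. -/
noncomputable def retract (D : Set V) : FreeGroup (V ⊕ α) →* FreeGroup (V ⊕ α) :=
  open Classical in
  lift (Sum.elim (fun v => if v ∈ D then of (Sum.inl v) else 1) fun i => of (Sum.inr i))

/-- The subgroup of the free group on `V ⊕ α` generated by the letters in `D` and in `α`. -/
noncomputable def supportedOn (D : Set V) : Subgroup (FreeGroup (V ⊕ α)) :=
  (retract D).eqLocus (MonoidHom.id _)

/-- The homomorphism renaming the letters in `V` and multiplying them by a word in `α`. -/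
def shift (g : V → V') (y : FreeGroup α) : FreeGroup (V ⊕ α) →* FreeGroup (V' ⊕ α) :=
  lift (Sum.elim (fun v => map Sum.inr y * of (Sum.inl (g v))) fun i => of (Sum.inr i))

@[simp]
theorem retract_inr (D : Set V) (i : α) : retract D (of (Sum.inr i)) = of (Sum.inr i) := by
  simp [retract]

theorem retract_inl_of_mem {D : Set V} {v : V} (hv : v ∈ D) :
    retract D (of (Sum.inl v : V ⊕ α)) = of (Sum.inl v) := by
  simp [retract, hv]

theorem retract_inl_of_notMem {D : Set V} {v : V} (hv : v ∉ D) :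
    retract D (of (Sum.inl v : V ⊕ α)) = 1 := by
  simp [retract, hv]

@[simp]
theorem shift_inl (g : V → V') (y : FreeGroup α) (v : V) :
    shift g y (of (Sum.inl v)) = map Sum.inr y * of (Sum.inl (g v)) := by
  simp [shift]

@[simp]
theorem shift_inr (g : V → V') (y : FreeGroup α) (i : α) :
    shift g y (of (Sum.inr i)) = of (Sum.inr i) := by
  simp [shift]

@[simp]
theorem retract_map_inr (D : Set V) (y : FreeGroup α) :
    retract D (map Sum.inr y) = map Sum.inr y := by
  have : (retract D).comp (map Sum.inr) = map (Sum.inr : α → V ⊕ α) := by ext i; simp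
  exact DFunLike.congr_fun this y

@[simp]
theorem shift_map_inr (g : V → V') (y w : FreeGroup α) :
    shift g y (map Sum.inr w) = map Sum.inr w := by
  have : (shift g y).comp (map Sum.inr) = map (Sum.inr : α → V' ⊕ α) := by ext i; simp
  exact DFunLike.congr_fun this w

theorem shift_eq_map (g : V → V') (y : FreeGroup α) (l : FreeGroup (V ⊕ α)) :
    shift g y l = map (Sum.map g id) (shift id y l) := by
  have hmap (w : FreeGroup α) : map (Sum.map g id) (map (Sum.inr : α → V ⊕ α) w) =
      map Sum.inr w := by
    rw [map.comp]; rfl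
  have : shift g y = (map (Sum.map g id)).comp (shift id y) := by
    ext x
    cases x <;> simp [hmap]
  exact DFunLike.congr_fun this l

theorem shift_inv_shift (y : FreeGroup α) (l : FreeGroup (V ⊕ α)) :
    shift id y⁻¹ (shift id y l) = l := by
  have : (shift id y⁻¹).comp (shift id y) = MonoidHom.id (FreeGroup (V ⊕ α)) := by
    ext x
    cases x <;> simp
  exact DFunLike.congr_fun this l

theorem shift_injective {g : V → V'} (hg : Function.Injective g) (y : FreeGroup α) :
    Function.Injective (shift g y) := by
  intro a b hab
  rw [shift_eq_map, shift_eq_map g] at hab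
  exact Function.LeftInverse.injective (shift_inv_shift y)
    (map_injective (hg.sumMap Function.injective_id) hab)

theorem mem_supportedOn {D : Set V} {l : FreeGroup (V ⊕ α)} :
    l ∈ supportedOn D ↔ retract D l = l := Iff.rfl

theorem retract_map (g : V → V') (D : Set V') (l : FreeGroup (V ⊕ α)) :
    retract D (map (Sum.map g id) l) = map (Sum.map g id) (retract (g ⁻¹' D) l) := by
  have : (retract D).comp (map (Sum.map g id)) =
      (map (Sum.map g (id : α → α))).comp (retract (g ⁻¹' D)) := by
    ext x
    rcases x with v | i
    · by_cases hv : g v ∈ D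
      · simp [retract_inl_of_mem hv, retract_inl_of_mem (show v ∈ g ⁻¹' D from hv)]
      · simp [retract_inl_of_notMem hv, retract_inl_of_notMem (show v ∉ g ⁻¹' D from hv)]
    · simp
  exact DFunLike.congr_fun this l

theorem shift_id_mem_supportedOn {D : Set V} (y : FreeGroup α) {l : FreeGroup (V ⊕ α)}
    (hl : l ∈ supportedOn D) : shift id y l ∈ supportedOn D := by
  have : ((retract D).comp (shift id y)).comp (retract D) = (shift id y).comp (retract D) := by
    ext x
    rcases x with v | i
    · by_cases hv : v ∈ D
      · simp [retract_inl_of_mem hv]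
      · simp [retract_inl_of_notMem hv]
    · simp
  rw [mem_supportedOn] at hl ⊢
  simpa [hl] using DFunLike.congr_fun this l

theorem shift_mem_supportedOn {g : V → V'} (hg : Function.Injective g) {D : Set V'}
    (y : FreeGroup α) {l : FreeGroup (V ⊕ α)} :
    shift g y l ∈ supportedOn D ↔ l ∈ supportedOn (g ⁻¹' D) := by
  have h1 : shift g y l ∈ supportedOn D ↔ shift id y l ∈ supportedOn (g ⁻¹' D) := by
    rw [shift_eq_map, mem_supportedOn, mem_supportedOn, retract_map,
      (map_injective (hg.sumMap Function.injective_id)).eq_iff]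
  rw [h1]
  refine ⟨fun h => ?_, fun h => shift_id_mem_supportedOn y h⟩
  rw [← shift_inv_shift y l]
  exact shift_id_mem_supportedOn _ h

/-- Two homomorphisms which agree on the letters in `D` and in `α` agree on `supportedOn D`. -/
theorem eqOn_supportedOn {M : Type} [Group M] {D : Set V} {f f' : FreeGroup (V ⊕ α) →* M}
    (hD : ∀ v ∈ D, f (of (Sum.inl v)) = f' (of (Sum.inl v)))
    (hα : ∀ i, f (of (Sum.inr i)) = f' (of (Sum.inr i))) {l : FreeGroup (V ⊕ α)}
    (hl : l ∈ supportedOn D) : f l = f' l := by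
  have : f.comp (retract D) = f'.comp (retract D) := by
    ext x
    rcases x with v | i
    · by_cases hv : v ∈ D
      · simp [retract_inl_of_mem hv, hD v hv]
      · simp [retract_inl_of_notMem hv]
    · simp [hα]
  rw [mem_supportedOn] at hl
  rw [← hl]
  exact DFunLike.congr_fun this l

theorem inl_mem_supportedOn {D : Set V} {v : V} (hv : v ∈ D) :
    of (Sum.inl v : V ⊕ α) ∈ supportedOn D :=
  retract_inl_of_mem hv

theorem inr_mem_supportedOn (D : Set V) (i : α) :
    of (Sum.inr i : V ⊕ α) ∈ supportedOn D :=
  retract_inr D i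

end Shift

section ActGroup

variable (α V P H : Type) [Group P] [MulAction P V] [Group H]

/-- The action of `P` on the free group on `V ⊕ α` by permutations of the letters in `V`. -/
def actHom : P →* MulAut (FreeGroup (V ⊕ α)) :=
  MonoidHom.mk' (fun g => freeGroupCongr ((MulAction.toPerm g).sumCongr (Equiv.refl α)))
    fun a b => by
      have : (freeGroupCongr ((MulAction.toPerm (a * b) : Equiv.Perm V).sumCongr
          (Equiv.refl α))).toMonoidHom =
        (freeGroupCongr ((MulAction.toPerm a : Equiv.Perm V).sumCongr
          (Equiv.refl α))).toMonoidHom.comp (freeGroupCongr ((MulAction.toPerm b :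
          Equiv.Perm V).sumCongr (Equiv.refl α))).toMonoidHom := by
        ext x
        cases x <;> simp [mul_smul]
      exact MulEquiv.ext fun x => DFunLike.congr_fun this x

variable {α V P}

@[simp]
theorem actHom_inl (p : P) (v : V) :
    actHom α V P p (of (Sum.inl v)) = of (Sum.inl (p • v)) := by
  simp [actHom]

@[simp]
theorem actHom_inr (p : P) (i : α) :
    actHom α V P p (of (Sum.inr i)) = of (Sum.inr i) := by
  simp [actHom]

variable (α V P)

/-- The product of `H` with the semidirect product of the free group on `V ⊕ α` by `P`. -/
abbrev ActGroup : Type := (FreeGroup (V ⊕ α) ⋊[actHom α V P] P) × H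

variable {α V P H}
variable (P H) in
/-- The inclusion of `supportedOn D`. -/
noncomputable def supportedInl (D : Set V) :
    (supportedOn D : Subgroup (FreeGroup (V ⊕ α))) →* ActGroup α V P H :=
  (MonoidHom.inl _ _).comp (SemidirectProduct.inl.comp (Subgroup.subtype _))

variable (P) in
/-- The graph of a homomorphism to `H` on `supportedOn D`. -/
noncomputable def supportedGraph (D : Set V) (θ : FreeGroup (V ⊕ α) →* H) :
    (supportedOn D : Subgroup (FreeGroup (V ⊕ α))) →* ActGroup α V P H :=
  (SemidirectProduct.inl.comp (Subgroup.subtype _)).prod (θ.comp (Subgroup.subtype _))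

theorem supportedInl_injective (D : Set V) :
    Function.Injective (supportedInl P H D : _ →* ActGroup α V P H) := fun a b h => by
  have := congrArg (fun x : ActGroup α V P H => x.1.left) h
  exact Subtype.ext this

theorem supportedGraph_injective (D : Set V) (θ : FreeGroup (V ⊕ α) →* H) :
    Function.Injective (supportedGraph P D θ) := fun a b h => by
  have := congrArg (fun x : ActGroup α V P H => x.1.left) h
  exact Subtype.ext this

theorem mem_range_supportedInl {D : Set V} {x : ActGroup α V P H} :
    x ∈ (supportedInl P H D).range ↔ x.1.left ∈ supportedOn D ∧ x.1.right = 1 ∧ x.2 = 1 := by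
  constructor
  · rintro ⟨a, rfl⟩
    exact ⟨a.2, rfl, rfl⟩
  · rintro ⟨h1, h2, h3⟩
    exact ⟨⟨_, h1⟩, Prod.ext (SemidirectProduct.ext rfl h2.symm) h3.symm⟩

theorem mem_range_supportedGraph {D : Set V} {θ : FreeGroup (V ⊕ α) →* H} {x : ActGroup α V P H} :
    x ∈ (supportedGraph P D θ).range ↔
      x.1.left ∈ supportedOn D ∧ x.1.right = 1 ∧ x.2 = θ x.1.left := by
  constructor
  · rintro ⟨a, rfl⟩
    exact ⟨a.2, rfl, rfl⟩
  · rintro ⟨h1, h2, h3⟩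
    exact ⟨⟨_, h1⟩, Prod.ext (SemidirectProduct.ext rfl h2.symm) h3.symm⟩

variable (P) in
/-- The HNN extension in which the stable letter multiplies elements of `supportedOn D` by their
images under `θ`. -/
abbrev GraphHNN (D : Set V) (θ : FreeGroup (V ⊕ α) →* H) : Type :=
  HNNExtension.OfHoms (supportedInl_injective (P := P) (H := H) D) (supportedGraph_injective D θ)

theorem exists_graphHNN_embedding {V' P' : Type} [Group P'] [MulAction P' V'] {g : V' → V}
    (hg : Function.Injective g) {ψ : P' →* P} (hψ : Function.Injective ψ)
    (hgψ : ∀ p v, g (p • v) = ψ p • g v) {D : Set V} (y : FreeGroup α)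
    {θ : FreeGroup (V ⊕ α) →* H} {θ' : FreeGroup (V' ⊕ α) →* H}
    (hα : ∀ i, θ' (of (Sum.inr i)) = θ (of (Sum.inr i)))
    (hV : ∀ v, g v ∈ D →
      θ' (of (Sum.inl v)) = θ (map Sum.inr y) * θ (of (Sum.inl (g v)))) :
    ∃ J : GraphHNN P' (g ⁻¹' D) θ' →* GraphHNN P D θ, Function.Injective J ∧
      (∀ l p h, J (HNNExtension.of (⟨l, p⟩, h)) = HNNExtension.of (⟨shift g y l, ψ p⟩, h)) ∧
      J HNNExtension.t = HNNExtension.t := by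
  have hcomm (p : P') : (shift g y).comp (actHom α V' P' p).toMonoidHom =
      ((actHom α V P (ψ p)).toMonoidHom).comp (shift g y) := by
    have hmap (p : P) (w : FreeGroup α) :
        actHom α V P p (map Sum.inr w) = map Sum.inr w := by
      have : (actHom α V P p).toMonoidHom.comp (map Sum.inr) = map (Sum.inr : α → V ⊕ α) := by
        ext i; simp
      exact DFunLike.congr_fun this w
    ext x
    cases x <;> simp [hgψ, hmap]
  let j : ActGroup α V' P' H →* ActGroup α V P H :=
    (SemidirectProduct.map (shift g y) ψ hcomm).prodMap (MonoidHom.id H)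
  have hj : Function.Injective j := by
    rintro ⟨⟨l, p⟩, h⟩ ⟨⟨l', p'⟩, h'⟩ hab
    have h1 : shift g y l = shift g y l' := congrArg (fun x : ActGroup α V P H => x.1.left) hab
    have h2 : ψ p = ψ p' := congrArg (fun x : ActGroup α V P H => x.1.right) hab
    have h3 : h = h' := congrArg (fun x : ActGroup α V P H => x.2) hab
    rw [shift_injective hg y h1, hψ h2, h3]
  have hθ {l : FreeGroup (V' ⊕ α)} (hl : l ∈ supportedOn (g ⁻¹' D)) :
      θ' l = θ (shift g y l) := by
    refine eqOn_supportedOn (f' := θ.comp (shift g y)) (fun v hv => ?_) (fun i => ?_) hl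
    · simpa using hV v hv
    · simpa using hα i
  obtain ⟨J, hJ, hJof, hJt⟩ := HNNExtension.exists_map_injective
    (supportedInl_injective (P := P') (H := H) (g ⁻¹' D)) (supportedGraph_injective (g ⁻¹' D) θ')
    (supportedInl_injective (P := P) (H := H) D) (supportedGraph_injective D θ) hj
    (fun a => by
      refine ⟨⟨shift g y a, (shift_mem_supportedOn hg y).2 a.2⟩, ?_, ?_⟩
      · exact Prod.ext (SemidirectProduct.ext rfl (_root_.map_one ψ)) rfl
      · exact Prod.ext (SemidirectProduct.ext rfl (_root_.map_one ψ)) (hθ a.2))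
    (fun x hx => by
      rw [mem_range_supportedInl] at hx ⊢
      exact ⟨(shift_mem_supportedOn hg y).1 hx.1, (map_eq_one_iff ψ hψ).1 hx.2.1, hx.2.2⟩)
    (fun x hx => by
      rw [mem_range_supportedGraph] at hx ⊢
      have h1 := (shift_mem_supportedOn hg y).1 hx.1
      exact ⟨h1, (map_eq_one_iff ψ hψ).1 hx.2.1, hx.2.2.trans (hθ h1).symm⟩)
  exact ⟨J, hJ, fun l p h => hJof _, hJt⟩

end ActGroup

end FreeGroup

/-- A family of transitions between configurations `(q, u)`, where `q` is a state and `u` is an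
integer vector. The transitions are parametrized by a finitely generated abelian group and
carry a word `y`. -/
structure ShiftEdge (α Q C : Type) where
  /-- the parameters -/
  P : Type
  [grp : AddCommGroup P]
  fg : AddGroup.FG P
  /-- the linear part of the source -/
  ψ₀ : P →+ (C → ℤ)
  /-- the linear part of the target -/
  ψ₁ : P →+ (C → ℤ)
  injective₀ : Function.Injective ψ₀
  injective₁ : Function.Injective ψ₁
  /-- the state of the source -/
  q₀ : Q
  /-- the state of the target -/
  q₁ : Q
  /-- the offset of the source -/
  u₀ : C → ℤ
  /-- the offset of the target -/
  u₁ : C → ℤ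
  /-- the word carried by the transitions -/
  y : FreeGroup α

attribute [instance] ShiftEdge.grp

namespace ShiftEdge

variable {α Q C ε : Type}

/-- The source of the transition with parameter `p`. -/
def src (E : ShiftEdge α Q C) (p : E.P) : Q × (C → ℤ) := (E.q₀, E.u₀ + E.ψ₀ p)

/-- The target of the transition with parameter `p`. -/
def tgt (E : ShiftEdge α Q C) (p : E.P) : Q × (C → ℤ) := (E.q₁, E.u₁ + E.ψ₁ p)

/-- There is an undirected path labelled by `w` from `β₀` or `β₁` to a configuration. -/
inductive Reach (E : ε → ShiftEdge α Q C) (β₀ β₁ : Q × (C → ℤ)) :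
    Q × (C → ℤ) → FreeGroup α → Prop
  | base₀ : Reach E β₀ β₁ β₀ 1
  | base₁ : Reach E β₀ β₁ β₁ 1
  | forward {e p w} : Reach E β₀ β₁ ((E e).src p) w → Reach E β₀ β₁ ((E e).tgt p) (w * (E e).y)
  | backward {e p w} :
      Reach E β₀ β₁ ((E e).tgt p) w → Reach E β₀ β₁ ((E e).src p) (w * (E e).y⁻¹)

section Forced

variable {Γ : Type*} [Group Γ] (Ω : Multiplicative (C → ℤ) →* Γ) (T : Q → Γ)

/-- The conjugate of the letter for the state by the vector. -/
def cfgElt (a : Q × (C → ℤ)) : Γ :=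
  Ω (Multiplicative.ofAdd a.2) * T a.1 * (Ω (Multiplicative.ofAdd a.2))⁻¹

theorem cfgElt_add (q : Q) (u v : C → ℤ) :
    cfgElt Ω T (q, u + v) = Ω (Multiplicative.ofAdd v) * cfgElt Ω T (q, u) *
      (Ω (Multiplicative.ofAdd v))⁻¹ := by
  simp [cfgElt, add_comm u v, ofAdd_add, mul_assoc]

variable {Ω T}

theorem commute_hom_of_commute_of {X : FreeGroup α →* Γ} {g : Γ}
    (h : ∀ i, Commute (X (FreeGroup.of i)) g) (w : FreeGroup α) : Commute (X w) g := by
  induction w using FreeGroup.induction_on with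
  | C1 => simp
  | of i => exact h i
  | inv_of i hi => simpa using hi.inv_left
  | mul a b ha hb => simpa using ha.mul_left hb

theorem conj_src {E : ε → ShiftEdge α Q C} {X : FreeGroup α →* Γ} {R : ε → Γ}
    (hXΩ : ∀ i v, Commute (X (FreeGroup.of i)) (Ω v))
    (hRT : ∀ e, R e * cfgElt Ω T ((E e).q₀, (E e).u₀) * (R e)⁻¹ =
      X (E e).y * cfgElt Ω T ((E e).q₁, (E e).u₁))
    (hRΩ : ∀ e p, R e * Ω (Multiplicative.ofAdd ((E e).ψ₀ p)) * (R e)⁻¹ =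
      Ω (Multiplicative.ofAdd ((E e).ψ₁ p)))
    (hRX : ∀ e i, Commute (X (FreeGroup.of i)) (R e)) (e : ε) (p : (E e).P) (w : FreeGroup α) :
    R e * (X w * cfgElt Ω T ((E e).src p)) * (R e)⁻¹ =
      X (w * (E e).y) * cfgElt Ω T ((E e).tgt p) := by
  rw [src, tgt, cfgElt_add, cfgElt_add]
  have h1 := commute_hom_of_commute_of (hRX e) w
  have h2 := commute_hom_of_commute_of (fun i => hXΩ i (Multiplicative.ofAdd ((E e).ψ₁ p))) (E e).y
  set a := Ω (Multiplicative.ofAdd ((E e).ψ₀ p))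
  set b := Ω (Multiplicative.ofAdd ((E e).ψ₁ p))
  set c := cfgElt Ω T ((E e).q₀, (E e).u₀)
  set d := cfgElt Ω T ((E e).q₁, (E e).u₁)
  calc R e * (X w * (a * c * a⁻¹)) * (R e)⁻¹
      = (R e * X w) * (a * c * a⁻¹) * (R e)⁻¹ := by group
    _ = X w * (R e * a * (R e)⁻¹) * (R e * c * (R e)⁻¹) * (R e * a * (R e)⁻¹)⁻¹ := by
        rw [← h1.eq]; group
    _ = X w * (b * X (E e).y) * d * b⁻¹ := by rw [hRΩ, hRT]; simp [b, d, mul_assoc]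
    _ = X (w * (E e).y) * (b * d * b⁻¹) := by rw [← h2.eq, map_mul]; simp [mul_assoc]

theorem Reach.commute {E : ε → ShiftEdge α Q C} {X : FreeGroup α →* Γ} {R : ε → Γ} {Z : Γ}
    (hXΩ : ∀ i v, Commute (X (FreeGroup.of i)) (Ω v))
    (hRT : ∀ e, R e * cfgElt Ω T ((E e).q₀, (E e).u₀) * (R e)⁻¹ =
      X (E e).y * cfgElt Ω T ((E e).q₁, (E e).u₁))
    (hRΩ : ∀ e p, R e * Ω (Multiplicative.ofAdd ((E e).ψ₀ p)) * (R e)⁻¹ =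
      Ω (Multiplicative.ofAdd ((E e).ψ₁ p)))
    (hRX : ∀ e i, Commute (X (FreeGroup.of i)) (R e)) (hRZ : ∀ e, Commute Z (R e))
    {β₀ β₁ : Q × (C → ℤ)} (h₀ : Commute Z (cfgElt Ω T β₀)) (h₁ : Commute Z (cfgElt Ω T β₁))
    {a : Q × (C → ℤ)} {w : FreeGroup α} (ha : Reach E β₀ β₁ a w) :
    Commute Z (X w * cfgElt Ω T a) := by
  induction ha with
  | base₀ => simpa using h₀
  | base₁ => simpa using h₁
  | @forward e p w _ ih =>
    rw [← conj_src hXΩ hRT hRΩ hRX]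
    exact ((hRZ e).mul_right ih).mul_right (hRZ e).inv_right
  | @backward e p w _ ih =>
    have := conj_src hXΩ hRT hRΩ hRX e p (w * (E e).y⁻¹)
    rw [inv_mul_cancel_right] at this
    rw [← this] at ih
    have := ((hRZ e).inv_right.mul_right ih).mul_right (hRZ e)
    simpa [mul_assoc] using this

theorem hom_eq_one_of_reach {E : ε → ShiftEdge α Q C} {X X' : FreeGroup α →* Γ} {R : ε → Γ} {Z : Γ}
    (hXΩ : ∀ i v, Commute (X (FreeGroup.of i)) (Ω v))
    (hXX : ∀ i j, Commute (X (FreeGroup.of i)) (X' (FreeGroup.of j)))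
    (hZX : ∀ i, Z * X (FreeGroup.of i) * Z⁻¹ = X (FreeGroup.of i) * X' (FreeGroup.of i))
    (hRT : ∀ e, R e * cfgElt Ω T ((E e).q₀, (E e).u₀) * (R e)⁻¹ =
      X (E e).y * cfgElt Ω T ((E e).q₁, (E e).u₁))
    (hRΩ : ∀ e p, R e * Ω (Multiplicative.ofAdd ((E e).ψ₀ p)) * (R e)⁻¹ =
      Ω (Multiplicative.ofAdd ((E e).ψ₁ p)))
    (hRX : ∀ e i, Commute (X (FreeGroup.of i)) (R e)) (hRZ : ∀ e, Commute Z (R e))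
    {β₀ β₁ : Q × (C → ℤ)} (h₀ : Commute Z (cfgElt Ω T β₀)) (h₁ : Commute Z (cfgElt Ω T β₁))
    {a : Q × (C → ℤ)} {w : FreeGroup α} (ha : Reach E β₀ β₁ a 1) (haw : Reach E β₀ β₁ a w) :
    X' w = 1 := by
  have h1 := ha.commute hXΩ hRT hRΩ hRX hRZ h₀ h₁
  have h2 := haw.commute hXΩ hRT hRΩ hRX hRZ h₀ h₁
  rw [map_one, one_mul] at h1
  have hZw : Commute Z (X w) := by simpa [mul_assoc] using h2.mul_right h1.inv_right
  have hXX' (v v' : FreeGroup α) : Commute (X v) (X' v') :=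
    commute_hom_of_commute_of
      (fun i => (commute_hom_of_commute_of (fun j => (hXX i j).symm) v').symm) v
  let f : FreeGroup α →* Γ := MonoidHom.mk' (fun v => X v * X' v) fun v v' => by
    simp only [map_mul, mul_assoc]
    rw [← mul_assoc (X' v), ← (hXX' v' v).eq, mul_assoc]
  have hf : f = (MulAut.conj Z).toMonoidHom.comp X := by
    ext i; simp [f, hZX]
  have hw : X w * X' w = Z * X w * Z⁻¹ := DFunLike.congr_fun hf w
  rw [hZw.eq, mul_inv_cancel_right] at hw
  exact mul_eq_left.1 hw

end Forced

section Vectors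

variable [Finite C]

open Classical in
/-- The homomorphism sending the letter `k` to the `k`-th unit vector. -/
noncomputable def vectorHom (C : Type) : FreeGroup C →* Multiplicative (C → ℤ) :=
  FreeGroup.lift fun k => Multiplicative.ofAdd (Pi.single k 1)

theorem vectorHom_surjective : Function.Surjective (vectorHom C) := by
  classical
  cases nonempty_fintype C
  rw [← MonoidHom.range_eq_top, eq_top_iff]
  rintro u -
  have hu : u = ∏ k, (Multiplicative.ofAdd (Pi.single k 1 : C → ℤ)) ^ (u.toAdd k) := by
    refine Multiplicative.toAdd.injective ?_
    ext j
    rw [toAdd_prod]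
    simp [Finset.sum_apply, Pi.single_apply]
  rw [hu]
  exact Subgroup.prod_mem _ fun k _ => Subgroup.zpow_mem _
    (MonoidHom.mem_range.2 ⟨FreeGroup.of k, by simp [vectorHom]⟩) _

/-- A word representing a vector. -/
noncomputable def vectorWord (v : C → ℤ) : FreeGroup C :=
  Function.surjInv vectorHom_surjective (Multiplicative.ofAdd v)

theorem vectorHom_vectorWord (v : C → ℤ) :
    vectorHom C (vectorWord v) = Multiplicative.ofAdd v :=
  Function.surjInv_eq _ _

theorem exists_hom_of_commute {Γ : Type*} [Group Γ] {U : C → Γ}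
    (hU : ∀ k k', Commute (U k) (U k')) :
    ∃ Ω : Multiplicative (C → ℤ) →* Γ, Ω.comp (vectorHom C) = FreeGroup.lift U := by
  classical
  cases nonempty_fintype C
  let Ω' : (C → Multiplicative ℤ) →* Γ := MonoidHom.noncommPiCoprod (fun k => zpowersHom Γ (U k))
    fun i j _ x y => by
      simpa using (hU i j).zpow_zpow _ _
  refine ⟨Ω'.comp (MulEquiv.piMultiplicative _).toMonoidHom, ?_⟩
  ext k
  have : (MulEquiv.piMultiplicative fun _ : C => ℤ) (Multiplicative.ofAdd (Pi.single k 1)) =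
      Pi.mulSingle k (Multiplicative.ofAdd 1) := by
    ext j
    by_cases hj : j = k
    · subst hj; simp
    · simp [hj]
  simp only [vectorHom, MonoidHom.comp_apply, FreeGroup.lift_apply_of, MulEquiv.coe_toMonoidHom,
    this, Ω']
  refine (MonoidHom.noncommPiCoprod_mulSingle (N := fun _ : C => Multiplicative ℤ) _ k
    (Multiplicative.ofAdd (1 : ℤ))).trans ?_
  simp [zpowersHom_apply]

end Vectors

end ShiftEdge

namespace ShiftEdge

open scoped commutatorElement

/-- The auxiliary letters of the finite system of relations attached to a family of edges. -/
inductive Letter (α Q C ε : Type) : Type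
  | u (k : C)
  | t (q : Q)
  | x (i : α)
  | r (e : ε)
  | z

variable {α Q C ε : Type}

/-- An auxiliary letter as an element of the free group. -/
def aux (l : Letter α Q C ε) : FreeGroup (α ⊕ Letter α Q C ε) := FreeGroup.of (Sum.inr l)

/-- The copy of a word in the auxiliary letters. -/
def copyRel : FreeGroup α →* FreeGroup (α ⊕ Letter α Q C ε) :=
  FreeGroup.map fun i => Sum.inr (Letter.x i)

variable [Finite C]

/-- The word of a vector in the auxiliary letters. -/
noncomputable def vecRel (v : C → ℤ) : FreeGroup (α ⊕ Letter α Q C ε) :=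
  FreeGroup.map (fun k => Sum.inr (Letter.u k)) (vectorWord v)

/-- The word of a configuration in the auxiliary letters. -/
noncomputable def cfgRel (a : Q × (C → ℤ)) : FreeGroup (α ⊕ Letter α Q C ε) :=
  vecRel a.2 * aux (.t a.1) * (vecRel a.2)⁻¹

/-- The finite system of relations attached to a finite family of edges. -/
noncomputable def relators (E : ε → ShiftEdge α Q C) (s : ∀ e, Set (E e).P)
    (β₀ β₁ : Q × (C → ℤ)) : Set (FreeGroup (α ⊕ Letter α Q C ε)) :=
  (Set.range fun k : C × C => ⁅aux (Letter.u k.1 : Letter α Q C ε), aux (.u k.2)⁆) ∪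
  (Set.range fun k : α × C => ⁅aux (Letter.x k.1 : Letter α Q C ε), aux (.u k.2)⁆) ∪
  (Set.range fun k : α × α => ⁅aux (Letter.x k.1 : Letter α Q C ε), FreeGroup.of (Sum.inl k.2)⁆) ∪
  (Set.range fun i : α => aux .z * aux (.x i) * (aux .z)⁻¹ *
    (aux (.x i) * FreeGroup.of (Sum.inl i))⁻¹) ∪
  (Set.range fun e : ε => aux (.r e) * cfgRel ((E e).q₀, (E e).u₀) *
    (aux (.r e))⁻¹ * (copyRel (E e).y * cfgRel ((E e).q₁, (E e).u₁))⁻¹) ∪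
  (⋃ e, (fun p => aux (.r e) * vecRel ((E e).ψ₀ p) *
    (aux (.r e))⁻¹ * (vecRel ((E e).ψ₁ p))⁻¹) '' s e) ∪
  (Set.range fun k : ε × α => ⁅aux (Letter.x k.2 : Letter α Q C ε), aux (.r k.1)⁆) ∪
  (Set.range fun e : ε => ⁅aux (Letter.z : Letter α Q C ε), aux (.r e)⁆) ∪
  {⁅aux (Letter.z : Letter α Q C ε), cfgRel β₀⁆, ⁅aux (Letter.z : Letter α Q C ε), cfgRel β₁⁆}

theorem finite_relators [Finite α] [Finite ε] (E : ε → ShiftEdge α Q C) {s : ∀ e, Set (E e).P}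
    (hs : ∀ e, (s e).Finite) (β₀ β₁ : Q × (C → ℤ)) : (relators E s β₀ β₁).Finite := by
  have := Set.finite_iUnion fun e => (hs e).image fun p =>
    (aux (.r e) * vecRel ((E e).ψ₀ p) * (aux (.r e))⁻¹ * (vecRel ((E e).ψ₁ p))⁻¹ :
      FreeGroup (α ⊕ Letter α Q C ε))
  simp only [relators, Set.finite_union]
  simp only [this, Set.toFinite, and_self]

theorem forall_relators {Γ : Type*} [Group Γ] {E : ε → ShiftEdge α Q C} {s : ∀ e, Set (E e).P}
    {β₀ β₁ : Q × (C → ℤ)} {f : FreeGroup (α ⊕ Letter α Q C ε) →* Γ}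
    {Ω : Multiplicative (C → ℤ) →* Γ} {T : Q → Γ} {X X' : FreeGroup α →* Γ} {R : ε → Γ} {Z : Γ}
    (hΩ : ∀ v, f (vecRel v) = Ω (Multiplicative.ofAdd v))
    (hT : ∀ q, f (aux (.t q)) = T q)
    (hX : ∀ i, f (aux (.x i)) = X (FreeGroup.of i))
    (hX' : ∀ i, f (FreeGroup.of (Sum.inl i)) = X' (FreeGroup.of i))
    (hR : ∀ e, f (aux (.r e)) = R e) (hZ : f (aux .z) = Z) :
    (∀ r ∈ relators E s β₀ β₁, f r = 1) ↔
      (∀ k k', Commute (f (aux (.u k))) (f (aux (.u k')))) ∧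
      (∀ i k, Commute (X (FreeGroup.of i)) (f (aux (.u k)))) ∧
      (∀ i j, Commute (X (FreeGroup.of i)) (X' (FreeGroup.of j))) ∧
      (∀ i, Z * X (FreeGroup.of i) * Z⁻¹ = X (FreeGroup.of i) * X' (FreeGroup.of i)) ∧
      (∀ e, R e * cfgElt Ω T ((E e).q₀, (E e).u₀) * (R e)⁻¹ =
        X (E e).y * cfgElt Ω T ((E e).q₁, (E e).u₁)) ∧
      (∀ e, ∀ p ∈ s e, R e * Ω (Multiplicative.ofAdd ((E e).ψ₀ p)) * (R e)⁻¹ =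
        Ω (Multiplicative.ofAdd ((E e).ψ₁ p))) ∧
      (∀ e i, Commute (X (FreeGroup.of i)) (R e)) ∧ (∀ e, Commute Z (R e)) ∧
      Commute Z (cfgElt Ω T β₀) ∧ Commute Z (cfgElt Ω T β₁) := by
  have hcfg (a) : f (cfgRel a) = cfgElt Ω T a := by
    simp [cfgRel, cfgElt, hΩ, hT]
  have hcopy (w) : f (copyRel w) = X w := by
    have : f.comp copyRel = X := by
      ext i; exact hX i
    exact DFunLike.congr_fun this w
  have himage : (∀ r ∈ ⋃ e, (fun p => (aux (.r e) * vecRel ((E e).ψ₀ p) *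
      (aux (.r e))⁻¹ * (vecRel ((E e).ψ₁ p))⁻¹ : FreeGroup (α ⊕ Letter α Q C ε))) '' s e, f r = 1) ↔
      ∀ e, ∀ p ∈ s e, R e * Ω (Multiplicative.ofAdd ((E e).ψ₀ p)) * (R e)⁻¹ =
        Ω (Multiplicative.ofAdd ((E e).ψ₁ p)) := by
    simp only [Set.mem_iUnion, Set.mem_image]
    constructor
    · intro h e p hp
      simpa [hΩ, hR, mul_inv_eq_one] using h _ ⟨e, p, hp, rfl⟩
    · rintro h _ ⟨e, p, hp, rfl⟩
      simpa [hΩ, hR, mul_inv_eq_one] using h e p hp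
  simp only [relators, Set.mem_union, or_imp, forall_and] at himage ⊢
  rw [himage]
  simp only [Set.forall_mem_range, Set.mem_insert_iff, Set.mem_singleton_iff, or_imp, forall_and,
    forall_eq, map_mul, map_inv, map_commutatorElement, hX, hX', hR, hZ, hcfg, hcopy,
    mul_inv_eq_one, commutatorElement_eq_one_iff_commute, Prod.forall, and_assoc]

end ShiftEdge

namespace ShiftEdge

section Model

variable {α Q C ε : Type}

/-- Integer vectors act on configurations by translation. -/
instance translation : MulAction (Multiplicative (C → ℤ)) (Q × (C → ℤ)) where
  smul v a := (a.1, v.toAdd + a.2)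
  one_smul a := Prod.ext rfl (zero_add a.2)
  mul_smul v w a := Prod.ext rfl (add_assoc v.toAdd w.toAdd a.2)

theorem translation_smul (v : C → ℤ) (a : Q × (C → ℤ)) :
    Multiplicative.ofAdd v • a = (a.1, v + a.2) := rfl

open FreeGroup in
/-- The homomorphism recording the values of configurations. -/
def valueHom {V H : Type} [Group H] (val : V → H) (x : FreeGroup α →* H) :
    FreeGroup (V ⊕ α) →* H :=
  lift (Sum.elim (fun v => (val v)⁻¹) fun i => x (of i))

theorem valueHom_map_inr {V H : Type} [Group H] (val : V → H) (x : FreeGroup α →* H)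
    (w : FreeGroup α) : valueHom val x (FreeGroup.map Sum.inr w) = x w := by
  have : (valueHom val x).comp (FreeGroup.map Sum.inr) = x := by ext i; simp [valueHom]
  exact DFunLike.congr_fun this w

theorem exists_edge_embeddings (E : ShiftEdge α Q C) {H : Type} [Group H] (x : FreeGroup α →* H)
    {D : Set (Q × (C → ℤ))} {val : Q × (C → ℤ) → H} (hD : ∀ p, E.src p ∈ D ↔ E.tgt p ∈ D)
    (hval : ∀ p, E.src p ∈ D → val (E.tgt p) = val (E.src p) * x E.y) :
    ∃ (M : Type) (_ : Group M)
      (J₀ J₁ : M →* FreeGroup.GraphHNN (Multiplicative (C → ℤ)) D (valueHom val x)),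
      Function.Injective J₀ ∧ Function.Injective J₁ ∧
      (∃ m, J₀ m = HNNExtension.of
          (SemidirectProduct.inl (FreeGroup.of (Sum.inl (E.q₀, E.u₀))), 1) ∧
        J₁ m = HNNExtension.of (SemidirectProduct.inl
          (FreeGroup.map Sum.inr E.y * FreeGroup.of (Sum.inl (E.q₁, E.u₁))), 1)) ∧
      (∀ p, ∃ m, J₀ m = HNNExtension.of
          (SemidirectProduct.inr (Multiplicative.ofAdd (E.ψ₀ p)), 1) ∧
        J₁ m = HNNExtension.of (SemidirectProduct.inr (Multiplicative.ofAdd (E.ψ₁ p)), 1)) ∧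
      (∀ i, ∃ m, J₀ m = HNNExtension.of
          (SemidirectProduct.inl (FreeGroup.of (Sum.inr i)), 1) ∧
        J₁ m = HNNExtension.of (SemidirectProduct.inl (FreeGroup.of (Sum.inr i)), 1)) ∧
      ∃ m, J₀ m = HNNExtension.t ∧ J₁ m = HNNExtension.t := by
  have h₀ : Function.Injective E.src := fun p p' h =>
    E.injective₀ (add_left_cancel (congrArg Prod.snd h))
  have h₁ : Function.Injective E.tgt := fun p p' h =>
    E.injective₁ (add_left_cancel (congrArg Prod.snd h))
  obtain ⟨J₀, hJ₀, hof₀, ht₀⟩ :=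
    FreeGroup.exists_graphHNN_embedding (α := α) (P' := Multiplicative E.P)
    (P := Multiplicative (C → ℤ)) h₀ (ψ := AddMonoidHom.toMultiplicative E.ψ₀) E.injective₀
    (fun p v => Prod.ext rfl (by
      change E.u₀ + E.ψ₀ (p.toAdd + v) = E.ψ₀ p.toAdd + (E.u₀ + E.ψ₀ v)
      rw [map_add]; abel)) (D := D) 1 (θ := valueHom val x)
    (θ' := valueHom (fun p => val (E.src p)) x) (fun i => by simp [valueHom])
    (fun v _ => by simp [valueHom])
  have H₁ := FreeGroup.exists_graphHNN_embedding (α := α) (P' := Multiplicative E.P)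
    (P := Multiplicative (C → ℤ)) h₁ (ψ := AddMonoidHom.toMultiplicative E.ψ₁) E.injective₁
    (fun p v => Prod.ext rfl (by
      change E.u₁ + E.ψ₁ (p.toAdd + v) = E.ψ₁ p.toAdd + (E.u₁ + E.ψ₁ v)
      rw [map_add]; abel)) (D := D) E.y (θ := valueHom val x)
    (θ' := valueHom (fun p => val (E.src p)) x) (fun i => by simp [valueHom])
    (fun v hv => by
      rw [valueHom_map_inr]
      simp [valueHom, hval v ((hD v).2 hv)])
  rw [← show E.src ⁻¹' D = E.tgt ⁻¹' D from Set.ext hD] at H₁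
  obtain ⟨J₁, hJ₁, hof₁, ht₁⟩ := H₁
  refine ⟨_, _, J₀, J₁, hJ₀, hJ₁, ⟨_, (hof₀ (FreeGroup.of (Sum.inl 0)) 1 1).trans ?_,
    (hof₁ _ _ _).trans ?_⟩, fun p => ⟨_, (hof₀ 1 (Multiplicative.ofAdd p) 1).trans ?_,
    (hof₁ _ _ _).trans ?_⟩, fun i => ⟨_, (hof₀ (FreeGroup.of (Sum.inr i)) 1 1).trans ?_,
    (hof₁ _ _ _).trans ?_⟩, _, ht₀, ht₁⟩
  · simp [src]
  · simp [tgt]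
  · simp
  · simp
  · simp
  · simp

theorem exists_model [Finite C] [Finite ε] (E : ε → ShiftEdge α Q C) {s : ∀ e, Set (E e).P}
    {β₀ β₁ : Q × (C → ℤ)} {H : Type} [Group H] (x : FreeGroup α →* H)
    {D : Set (Q × (C → ℤ))} {val : Q × (C → ℤ) → H} (h₀ : β₀ ∈ D) (h₁ : β₁ ∈ D)
    (hv₀ : val β₀ = 1) (hv₁ : val β₁ = 1)
    (hE : ∀ e p, ((E e).src p ∈ D ↔ (E e).tgt p ∈ D) ∧
      ((E e).src p ∈ D → val ((E e).tgt p) = val ((E e).src p) * x (E e).y)) :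
    ∃ (K : Type) (_ : Group K) (i : H →* K) (f : FreeGroup (α ⊕ Letter α Q C ε) →* K),
      Function.Injective i ∧ (∀ r ∈ relators E s β₀ β₁, f r = 1) ∧
      ∀ a, f (FreeGroup.of (Sum.inl a)) = i (x (FreeGroup.of a)) := by
  choose M grpM J₀ J₁ hJ₀ hJ₁ mT mΩ mX mZ using fun e =>
    exists_edge_embeddings (E e) x (fun p => (hE e p).1) (fun p => (hE e p).2)
  obtain ⟨K, grpK, i, R, hi, hR⟩ := HNNExtension.exists_conj_family hJ₀ hJ₁
  let b : FreeGroup ((Q × (C → ℤ)) ⊕ α) →* K :=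
    i.comp (HNNExtension.of.comp ((MonoidHom.inl _ _).comp SemidirectProduct.inl))
  let Ω : Multiplicative (C → ℤ) →* K :=
    i.comp (HNNExtension.of.comp ((MonoidHom.inl _ _).comp SemidirectProduct.inr))
  let j : H →* K := i.comp (HNNExtension.of.comp (MonoidHom.inr _ _))
  let Z : K := i HNNExtension.t
  have hcfg (a : Q × (C → ℤ)) :
      cfgElt Ω (fun q => b (FreeGroup.of (Sum.inl (q, 0)))) a = b (FreeGroup.of (Sum.inl a)) := by
    have := SemidirectProduct.inl_aut (φ := FreeGroup.actHom α (Q × (C → ℤ))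
      (Multiplicative (C → ℤ))) (Multiplicative.ofAdd a.2) (FreeGroup.of (Sum.inl (a.1, 0)))
    rw [FreeGroup.actHom_inl, translation_smul, add_zero] at this
    rw [show a = (a.1, a.2) from rfl]
    simp only [cfgElt, b, MonoidHom.comp_apply, this, map_mul, map_inv, Ω]
  have hZb (l) (hl : l ∈ FreeGroup.supportedOn D) :
      Z * b l = b l * j (valueHom val x l) * Z := by
    have := congrArg i (HNNExtension.t_mul_of_ofHoms
      (FreeGroup.supportedInl_injective (P := Multiplicative (C → ℤ)) (H := H) D)
      (FreeGroup.supportedGraph_injective D (valueHom val x)) ⟨l, hl⟩)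
    rw [map_mul, map_mul] at this
    refine this.trans ?_
    simp only [b, j, Z, MonoidHom.comp_apply, ← map_mul]
    congr 3
    exact Prod.ext (mul_one _).symm (one_mul _).symm
  have hbΩ (k : α) (v) : Commute (b (FreeGroup.of (Sum.inr k))) (Ω v) := by
    have := SemidirectProduct.inl_aut (φ := FreeGroup.actHom α (Q × (C → ℤ))
      (Multiplicative (C → ℤ))) v (FreeGroup.of (Sum.inr k))
    rw [FreeGroup.actHom_inr, map_inv, eq_mul_inv_iff_mul_eq] at this
    simp only [b, Ω, MonoidHom.comp_apply, commute_iff_eq, ← map_mul, this]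
  have hbj (l h) : Commute (b l) (j h) := by
    simp only [b, j, MonoidHom.comp_apply]
    exact (((Commute.one_right _).prod (Commute.one_left _)).map _).map i
  let asg : Letter α Q C ε → K
    | .u k => Ω (vectorHom C (FreeGroup.of k))
    | .t q => b (FreeGroup.of (Sum.inl (q, 0)))
    | .x k => b (FreeGroup.of (Sum.inr k))
    | .r e => R e
    | .z => Z
  let f : FreeGroup (α ⊕ Letter α Q C ε) →* K :=
    FreeGroup.lift (Sum.elim (fun k => j (x (FreeGroup.of k))) asg)
  have hf (l) : f (aux l) = asg l := by simp [f, aux]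
  refine ⟨K, grpK, j, f, ?_, ?_, fun a => by simp [f]⟩
  · intro h h' hh
    exact (Prod.mk.inj (HNNExtension.of_injective _ (hi hh))).2
  have hfΩ (v) : f (vecRel v) = Ω (Multiplicative.ofAdd v) := by
    have : f.comp (FreeGroup.map fun k => Sum.inr (Letter.u k)) = Ω.comp (vectorHom C) := by
      ext k; exact hf (.u k)
    rw [← vectorHom_vectorWord v]
    exact DFunLike.congr_fun this _
  refine (forall_relators (X := b.comp (FreeGroup.map Sum.inr)) (X' := j.comp x) hfΩ
    (fun q => hf (.t q)) (fun k => hf (.x k)) (fun k => by simp [f]) (fun e => hf (.r e))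
    (hf .z)).2 ⟨?_, ?_, ?_, ?_, ?_, ?_, ?_, ?_, ?_, ?_⟩
  · intro k k'
    rw [hf, hf]
    exact (Commute.all _ _).map Ω
  · intro k k'
    rw [hf]
    exact hbΩ _ _
  · exact fun k k' => hbj _ _
  · intro k
    have := hZb _ (FreeGroup.inr_mem_supportedOn D k)
    rw [mul_inv_eq_iff_eq_mul]
    simpa [valueHom] using this
  · intro e
    obtain ⟨m, hm₀, hm₁⟩ := mT e
    have := hR e m
    rw [hm₀, hm₁] at this
    rw [hcfg, hcfg, mul_inv_eq_iff_eq_mul, MonoidHom.comp_apply b, ← map_mul b]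
    exact this
  · intro e p _
    obtain ⟨m, hm₀, hm₁⟩ := mΩ e p
    have := hR e m
    rw [hm₀, hm₁] at this
    rw [mul_inv_eq_iff_eq_mul]
    exact this
  · intro e k
    obtain ⟨m, hm₀, hm₁⟩ := mX e k
    have := hR e m
    rw [hm₀, hm₁] at this
    exact this.symm
  · intro e
    obtain ⟨m, hm₀, hm₁⟩ := mZ e
    have := hR e m
    rw [hm₀, hm₁] at this
    exact this.symm
  · rw [hcfg]
    have := hZb _ (FreeGroup.inl_mem_supportedOn h₀)
    rw [valueHom, FreeGroup.lift_apply_of, Sum.elim_inl, hv₀, inv_one, map_one, mul_one] at this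
    exact this
  · rw [hcfg]
    have := hZb _ (FreeGroup.inl_mem_supportedOn h₁)
    rw [valueHom, FreeGroup.lift_apply_of, Sum.elim_inl, hv₁, inv_one, map_one, mul_one] at this
    exact this

theorem eq_one_of_relators [Finite C] (E : ε → ShiftEdge α Q C) {s : ∀ e, Set (E e).P}
    (hs : ∀ e, AddSubgroup.closure (s e) = ⊤) {β₀ β₁ a : Q × (C → ℤ)} {w : FreeGroup α}
    (ha : Reach E β₀ β₁ a 1) (haw : Reach E β₀ β₁ a w) {Γ : Type*} [Group Γ]
    (f : FreeGroup (α ⊕ Letter α Q C ε) →* Γ) (hf : ∀ r ∈ relators E s β₀ β₁, f r = 1) :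
    f (FreeGroup.map Sum.inl w) = 1 := by
  have hU (k k' : C) : Commute (f (aux (.u k))) (f (aux (.u k'))) := by
    rw [← commutatorElement_eq_one_iff_commute, ← map_commutatorElement]
    refine hf _ ?_
    iterate 8 left
    exact ⟨(k, k'), rfl⟩
  obtain ⟨Ω, hΩ⟩ := exists_hom_of_commute hU
  have hfΩ (v) : f (vecRel v) = Ω (Multiplicative.ofAdd v) := by
    have : f.comp (FreeGroup.map fun k => Sum.inr (Letter.u k)) = Ω.comp (vectorHom C) := by
      rw [hΩ]; ext k; simp [aux]
    rw [← vectorHom_vectorWord v]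
    exact DFunLike.congr_fun this _
  obtain ⟨-, hXU, hXX, hZX, hRT, hRΩ, hRX, hRZ, h₀, h₁⟩ := (forall_relators
    (X := f.comp copyRel) (X' := f.comp (FreeGroup.map Sum.inl)) (T := fun q => f (aux (.t q)))
    (R := fun e => f (aux (.r e))) hfΩ (fun _ => rfl)
    (fun k => by simp [copyRel, aux]) (fun k => by simp) (fun _ => rfl) rfl).1 hf
  refine hom_eq_one_of_reach (X' := f.comp (FreeGroup.map Sum.inl)) (fun k v => ?_) hXX hZX hRT
    (fun e p => ?_) hRX hRZ h₀ h₁ ha haw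
  · obtain ⟨v, rfl⟩ := vectorHom_surjective v
    rw [← MonoidHom.comp_apply Ω, hΩ]
    exact (commute_hom_of_commute_of (fun i => by simpa using (hXU k i).symm) v).symm
  · have hp : p ∈ AddSubgroup.closure (s e) := hs e ▸ AddSubgroup.mem_top p
    induction hp using AddSubgroup.closure_induction with
    | mem p hp => exact hRΩ e p hp
    | zero => simp
    | add p q _ _ hp hq => simp only [map_add, ofAdd_add, map_mul, ← hp, ← hq]; group
    | neg p _ hp => simp only [map_neg, ofAdd_neg, map_inv, ← hp]; group

/-- A set of words described by a finite family of edges is enforced by finitely many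
relations. -/
theorem exists_finite_relations_of_edges [Finite α] [Finite C] [Finite ε]
    (E : ε → ShiftEdge α Q C) {β₀ β₁ : Q × (C → ℤ)} {L : Set (FreeGroup α)}
    (hsound : ∀ w ∈ L, ∃ a, Reach E β₀ β₁ a 1 ∧ Reach E β₀ β₁ a w)
    (hcomplete : ∀ {H : Type} [Group H] (x : FreeGroup α →* H), (∀ w ∈ L, x w = 1) →
      ∃ (D : Set (Q × (C → ℤ))) (val : Q × (C → ℤ) → H), β₀ ∈ D ∧ β₁ ∈ D ∧ val β₀ = 1 ∧
        val β₁ = 1 ∧ ∀ e p, ((E e).src p ∈ D ↔ (E e).tgt p ∈ D) ∧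
          ((E e).src p ∈ D → val ((E e).tgt p) = val ((E e).src p) * x (E e).y)) :
    ∃ (Var : Type) (Rel : Set (FreeGroup (α ⊕ Var))), Rel.Finite ∧
      (∀ {Γ : Type u} [Group Γ] (f : FreeGroup (α ⊕ Var) →* Γ), (∀ r ∈ Rel, f r = 1) →
        ∀ w ∈ L, f (FreeGroup.map Sum.inl w) = 1) ∧
      ∀ {H : Type} [Group H] (x : FreeGroup α →* H), (∀ w ∈ L, x w = 1) →
        ∃ (K : Type) (_ : Group K) (i : H →* K) (f : FreeGroup (α ⊕ Var) →* K),
          Function.Injective i ∧ (∀ r ∈ Rel, f r = 1) ∧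
          ∀ a, f (FreeGroup.of (Sum.inl a)) = i (x (FreeGroup.of a)) := by
  choose S hS using fun e => AddGroup.fg_def.1 (E e).fg
  refine ⟨_, relators E (fun e => (S e : Set (E e).P)) β₀ β₁,
    finite_relators E (fun e => (S e).finite_toSet) β₀ β₁, fun f hf w hw => ?_, fun x hx => ?_⟩
  · obtain ⟨a, ha, haw⟩ := hsound w hw
    exact eq_one_of_relators E hS ha haw f hf
  · obtain ⟨D, val, h₀, h₁, hv₀, hv₁, hE⟩ := hcomplete x hx
    exact exists_model E x h₀ h₁ hv₀ hv₁ hE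

end Model

end ShiftEdge

namespace StackMachine

open Turing PartrecToTM2

/-- The base `5` digit of a stack symbol; the digit `0` stands for the bottom of the stack. -/
def digit : Option Γ' → ℤ
  | none => 0
  | some .bit0 => 1
  | some .bit1 => 2
  | some .cons => 3
  | some .consₗ => 4

/-- The stack symbol of the last base `5` digit of an integer. -/
def top (s : ℤ) : Option Γ' :=
  if s % 5 = 0 then none else if s % 5 = 1 then some .bit0 else if s % 5 = 2 then some .bit1
  else if s % 5 = 3 then some .cons else some .consₗ

theorem digit_top (s : ℤ) : digit (top s) = s % 5 := by
  unfold top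
  split_ifs <;> simp only [digit] <;> omega

theorem top_add (s : ℤ) (o : Option Γ') : top (5 * s + digit o) = o := by
  unfold top
  rcases o with _ | _ | _ | _ | _ <;> simp [digit, Int.add_emod]

theorem add_digit_ediv (s : ℤ) (o : Option Γ') : (5 * s + digit o) / 5 = s := by
  rcases o with _ | _ | _ | _ | _ <;> simp only [digit] <;> omega

theorem ediv_add_digit_top (s : ℤ) : 5 * (s / 5) + digit (top s) = s := by
  rw [digit_top]; omega

/-- The integer with the given stack of digits. -/
def stackCode (l : List Γ') : ℤ := l.foldr (fun g s => 5 * s + digit (some g)) 0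

@[simp]
theorem stackCode_nil : stackCode [] = 0 := rfl

theorem stackCode_cons (g : Γ') (l : List Γ') :
    stackCode (g :: l) = 5 * stackCode l + digit (some g) := rfl

theorem top_stackCode (l : List Γ') : top (stackCode l) = l.head? := by
  cases l with
  | nil => rfl
  | cons g l => rw [stackCode_cons, top_add, List.head?_cons]

theorem stackCode_ediv (l : List Γ') : stackCode l / 5 = stackCode l.tail := by
  cases l with
  | nil => rfl
  | cons g l => rw [stackCode_cons, add_digit_ediv, List.tail_cons]

theorem stackCode_eq (l : List Γ') : stackCode l = 5 * stackCode l.tail + digit l.head? := by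
  rw [← stackCode_ediv, ← top_stackCode, ediv_add_digit_top]

/-- The stack on which a statement acts. -/
def key : Stmt' → K'
  | .push k _ _ => k
  | .peek k _ _ => k
  | .pop k _ _ => k
  | _ => .main

/-- The effect of a statement: the new statement, the new value of the variable, and the affine
function applied to the integer of the tail of the stack. -/
def next : Stmt' → Option Γ' → Option Γ' → (Option Stmt' × Option Γ') × ℤ × ℤ
  | .push _ f q, v, o => ((some q, v), 25, 5 * digit o + digit (some (f v)))
  | .peek _ f q, v, o => ((some q, f v o), 5, digit o)
  | .pop _ f q, v, some g => ((some q, f v (some g)), 1, 0)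
  | .pop _ f q, v, none => ((some q, f v none), 5, 0)
  | .load f q, v, o => ((some q, f v), 5, digit o)
  | .branch f q₁ q₂, v, o => ((some (cond (f v) q₁ q₂), v), 5, digit o)
  | .goto f, v, o => ((some (tr (f v)), v), 5, digit o)
  | .halt, v, o => ((none, v), 5, digit o)

theorem next_ne_zero (q : Stmt') (v o : Option Γ') : (next q v o).2.1 ≠ 0 := by
  rcases q with _ | _ | _ | _ | _ | _ | _
  case pop => cases o <;> simp [next]
  all_goals simp [next]

/-- Configurations: a statement and a variable together with integers encoding the stacks and an
additional integer which is left unchanged. -/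
abbrev IntCfg : Type := (Option Stmt' × Option Γ') × (Option K' → ℤ)

/-- The evaluation of a single statement on configurations. -/
def intStep : IntCfg → Option IntCfg
  | ((none, _), _) => none
  | ((some q, v), u) => some ((next q v (top (u (some (key q))))).1,
      Function.update u (some (key q)) ((next q v (top (u (some (key q))))).2.1 *
        (u (some (key q)) / 5) + (next q v (top (u (some (key q))))).2.2))

/-- The integers encoding stacks. -/
def stackVec (c : ℤ) (S : K' → List Γ') : Option K' → ℤ
  | none => c
  | some k => stackCode (S k)

theorem update_stackVec (c : ℤ) (S : K' → List Γ') (k : K') (l : List Γ') :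
    Function.update (stackVec c S) (some k) (stackCode l) = stackVec c (Function.update S k l) := by
  funext k'
  rcases k' with _ | k'
  · simp [stackVec]
  · by_cases h : k' = k
    · subst h; simp [stackVec]
    · simp [stackVec, h]

/-- The configuration of a configuration with stacks. -/
def toIntCfg (c : ℤ) (a : Cfg') : IntCfg := ((a.l.map tr, a.var), stackVec c a.stk)

theorem intStep_stackVec (c : ℤ) (q : Stmt') (v : Option Γ') (S : K' → List Γ')
    {r : Option Stmt' × Option Γ'} {m n : ℤ} (h : next q v (S (key q)).head? = (r, m, n))
    {l : List Γ'} (hl : m * stackCode (S (key q)).tail + n = stackCode l) :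
    intStep ((some q, v), stackVec c S) =
      some (r, stackVec c (Function.update S (key q) l)) := by
  have h1 : stackVec c S (some (key q)) = stackCode (S (key q)) := rfl
  simp only [intStep, h1, top_stackCode, stackCode_ediv, h, hl, update_stackVec]

theorem intStep_stackVec_of_next (c : ℤ) (q : Stmt') (v : Option Γ') (S : K' → List Γ')
    {r : Option Stmt' × Option Γ'} (h : ∀ o, next q v o = (r, 5, digit o)) :
    intStep ((some q, v), stackVec c S) = some (r, stackVec c S) := by
  have := intStep_stackVec c q v S (h _) (stackCode_eq (S (key q))).symm
  rwa [Function.update_eq_self] at this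

theorem reaches₁_stepAux (c : ℤ) (q : Stmt') (v : Option Γ') (S : K' → List Γ') :
    StateTransition.Reaches₁ intStep ((some q, v), stackVec c S)
      (toIntCfg c (TM2.stepAux q v S)) := by
  induction q generalizing v S with
  | push k f q ih =>
    refine .head (intStep_stackVec c (.push k f q) v S rfl (l := f v :: S k) ?_) (ih _ _)
    rw [stackCode_cons, stackCode_eq (S k)]
    simp only [key]
    ring
  | peek k f q ih =>
    refine .head (intStep_stackVec c (.peek k f q) v S rfl (stackCode_eq (S k)).symm) ?_
    rw [show Function.update S (key (.peek k f q)) (S k) = S from Function.update_eq_self k S]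
    exact ih _ _
  | pop k f q ih =>
    refine .head (intStep_stackVec c (.pop k f q) v S (r := (some q, f v (S k).head?))
      (m := if (S k).head?.isSome then 1 else 5) (n := 0) ?_ (l := (S k).tail) ?_) (ih _ _)
    · rcases h : (S k).head? with _ | g <;> simp [key, h, next]
    · rcases h : S k with _ | ⟨g, l⟩ <;> simp [key, h]
  | load f q ih =>
    exact .head (intStep_stackVec_of_next c _ v S fun o => rfl) (ih _ _)
  | branch f q₁ q₂ ih₁ ih₂ =>
    refine .head (intStep_stackVec_of_next c _ v S fun o => rfl) ?_
    rw [TM2.stepAux]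
    cases f v
    · exact ih₂ _ _
    · exact ih₁ _ _
  | goto f => exact .single (intStep_stackVec_of_next c _ v S fun o => rfl)
  | halt => exact .single (intStep_stackVec_of_next c _ v S fun o => rfl)

theorem respects_intStep (c : ℤ) : StateTransition.Respects (TM2.step tr) intStep
    fun a b => toIntCfg c a = b := by
  refine StateTransition.fun_respects.2 ?_
  rintro ⟨_ | l, v, S⟩
  · rfl
  · exact reaches₁_stepAux c (tr l) v S

theorem exists_code_of_computable {g : ℕ → ℕ} (hg : Computable g) :
    ∃ c : ToPartrec.Code, ∀ n v, v ∈ c.eval [n] ↔ v = [0] ∧ n ∈ Set.range g := by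
  let f : ℕ →. ℕ := fun n => (Nat.rfind fun e => Part.some (decide (g e = n))).map fun _ => 0
  have hf : Partrec f := by
    refine Partrec.map (Partrec.rfind (p := fun n e => Part.some (decide (g e = n))) ?_)
      (Computable.const 0).to₂
    exact ((Primrec.eq (α := ℕ)).decide.to_comp.comp (hg.comp Computable.snd) Computable.fst)
  obtain ⟨c, hc⟩ := ToPartrec.Code.exists_code (Nat.Partrec'.part_iff₁.2 hf)
  refine ⟨c, fun n v => ?_⟩
  have := hc (n ::ᵥ List.Vector.nil)
  rw [show (n ::ᵥ List.Vector.nil).1 = [n] from rfl] at this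
  rw [this]
  simp only [f, List.Vector.head_cons, Part.map_eq_map, Part.mem_map_iff, Set.mem_range]
  constructor
  · rintro ⟨_, ⟨e, he, rfl⟩, rfl⟩
    exact ⟨rfl, e, by simpa using Nat.rfind_spec he⟩
  · rintro ⟨rfl, e, he⟩
    have hd : (Nat.rfind fun e => Part.some (decide (g e = n))).Dom :=
      Nat.rfind_dom'.2 ⟨e, by simp [he], fun _ => trivial⟩
    exact ⟨0, ⟨_, Part.get_mem hd, rfl⟩, rfl⟩

theorem reaches_of_mem_eval {c : ToPartrec.Code} {w v : List ℕ} (h : v ∈ c.eval w) (z : ℤ) :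
    StateTransition.Reaches intStep (toIntCfg z (init c w)) (toIntCfg z (halt v)) := by
  have h1 : halt v ∈ StateTransition.eval (TM2.step tr) (init c w) := by
    rw [tr_eval]; exact Part.mem_map _ h
  have h2 := StateTransition.tr_eval' _ _ _ (respects_intStep z) (init c w)
  have h3 : toIntCfg z (halt v) ∈ StateTransition.eval intStep (toIntCfg z (init c w)) := by
    rw [h2]; exact Part.mem_map _ h1
  exact (StateTransition.mem_eval.1 h3).1

theorem exists_mem_eval_of_reaches {c : ToPartrec.Code} {w v : List ℕ} {z : ℤ}
    (h : StateTransition.Reaches intStep (toIntCfg z (init c w)) (toIntCfg z (halt v))) :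
    ∃ v', v' ∈ c.eval w := by
  have h3 : toIntCfg z (halt v) ∈ StateTransition.eval intStep (toIntCfg z (init c w)) :=
    StateTransition.mem_eval.2 ⟨h, rfl⟩
  rw [StateTransition.tr_eval' _ _ _ (respects_intStep z) (init c w)] at h3
  obtain ⟨a, ha, -⟩ := (Part.mem_map_iff _).1 h3
  rw [tr_eval] at ha
  obtain ⟨v', hv', -⟩ := (Part.mem_map_iff _).1 ha
  exact ⟨v', hv'⟩

/-- The integer encoding the stack of the numeral `2 ^ e * (2 * n + 1)`, where `v` is the integer
encoding the stack of `n`. -/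
def pushNum : ℕ → ℤ → ℤ
  | 0, v => 5 * v + 2
  | e + 1, v => 5 * pushNum e v + 1

theorem pushNum_eq (e : ℕ) (v : ℤ) : pushNum e v = pushNum e 0 + 5 ^ (e + 1) * v := by
  induction e with
  | zero => simp only [pushNum]; ring
  | succ e ih => rw [pushNum, ih, pushNum]; ring

theorem pushNum_inj {e e' : ℕ} {v v' : ℤ} (h : pushNum e v = pushNum e' v') : e = e' ∧ v = v' := by
  induction e generalizing e' with
  | zero =>
    rcases e' with _ | e' <;> simp only [pushNum] at h
    · exact ⟨rfl, by omega⟩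
    · omega
  | succ e ih =>
    rcases e' with _ | e' <;> simp only [pushNum] at h
    · omega
    · have := ih (by omega : pushNum e v = pushNum e' v')
      omega

theorem pushNum_ne (e : ℕ) (v : ℤ) : pushNum e v ≠ 3 := by
  cases e <;> simp only [pushNum] <;> omega

theorem trNat_two_mul_add_one (n : ℕ) : trNat (2 * n + 1) = .bit1 :: trNat n := by
  rw [trNat, trNat, Nat.cast_add, Nat.cast_mul, Nat.cast_one, Nat.cast_two, two_mul]
  rcases (n : Num) with _ | p
  · rfl
  · rw [Num.bit1_of_bit1]; rfl

theorem trNat_two_mul {n : ℕ} (hn : n ≠ 0) : trNat (2 * n) = .bit0 :: trNat n := by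
  rw [trNat, trNat, Nat.cast_mul, Nat.cast_two, two_mul]
  rcases h : (n : Num) with _ | p
  · exact absurd (by simpa using congrArg (fun x : Num => (x : ℕ)) h) hn
  · rw [Num.bit0_of_bit0]; rfl

theorem stackCode_numeral (e n : ℕ) :
    stackCode (trList [2 ^ e * (2 * n + 1)]) = pushNum e (stackCode (trList [n])) := by
  simp only [trList]
  induction e with
  | zero => rw [pow_zero, one_mul, trNat_two_mul_add_one]; rfl
  | succ e ih => rw [pow_succ', mul_assoc, trNat_two_mul (by positivity), pushNum, ← ih]; rfl

variable {β : Type}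

/-- The number of a list. -/
def listCode [Encodable β] (l : List β) : ℕ :=
  l.foldr (fun i n => 2 ^ Encodable.encode i * (2 * n + 1)) 0

theorem primrec_listCode [Primcodable β] : Primrec (listCode : List β → ℕ) := by
  have hpow : Primrec fun n : ℕ => 2 ^ n := by
    refine (Primrec.nat_rec₁ 1 (f := fun _ m => 2 * m)
      (Primrec.nat_mul.comp (Primrec.const 2) Primrec.snd)).of_eq fun n => ?_
    induction n with
    | zero => rfl
    | succ n ih => rw [pow_succ', ← ih]
  refine Primrec.list_foldr (f := fun l : List β => l) (g := fun _ => 0)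
    (h := fun _ p => 2 ^ Encodable.encode p.1 * (2 * p.2 + 1)) Primrec.id (Primrec.const 0) ?_
  exact Primrec.nat_mul.comp (hpow.comp (Primrec.encode.comp (Primrec.fst.comp Primrec.snd)))
    (Primrec.succ.comp (Primrec.nat_mul.comp (Primrec.const 2) (Primrec.snd.comp Primrec.snd)))

/-- The integer encoding the stack of the number of a list. -/
def listNum [Encodable β] (l : List β) : ℤ := stackCode (trList [listCode l])

theorem listNum_nil [Encodable β] : listNum ([] : List β) = 3 := by
  simp only [listNum, listCode, List.foldr_nil, trList, trNat_zero]
  rfl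

theorem listNum_cons [Encodable β] (i : β) (l : List β) :
    listNum (i :: l) = pushNum (Encodable.encode i) (listNum l) :=
  stackCode_numeral _ _

theorem eq_cons_of_pushNum_eq [Encodable β] {i : β} {v : ℤ} {l : List β}
    (h : pushNum (Encodable.encode i) v = listNum l) : ∃ m, l = i :: m ∧ v = listNum m := by
  rcases l with _ | ⟨j, m⟩
  · rw [listNum_nil] at h
    exact absurd h (pushNum_ne _ _)
  · rw [listNum_cons] at h
    obtain ⟨h1, h2⟩ := pushNum_inj h
    exact ⟨m, by rw [Encodable.encode_injective h1], h2⟩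

theorem listNum_injective [Encodable β] : Function.Injective (listNum : List β → ℤ) := by
  intro l
  induction l with
  | nil =>
    rintro (_ | ⟨j, m⟩) h
    · rfl
    · rw [listNum_nil, listNum_cons] at h
      exact absurd h.symm (pushNum_ne _ _)
  | cons i l ih =>
    intro l' h
    rw [listNum_cons] at h
    obtain ⟨m, rfl, hm⟩ := eq_cons_of_pushNum_eq h
    rw [ih hm]

instance : Finite K' :=
  Finite.of_surjective ![K'.main, .rev, .aux, .stack] fun k => by
    cases k
    exacts [⟨0, rfl⟩, ⟨1, rfl⟩, ⟨2, rfl⟩, ⟨3, rfl⟩]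

/-- The statements occurring in the code of the given labels. -/
def supp (S : Finset Λ') : Set Stmt' := {q | ∃ l ∈ S, q ∈ TM2.stmts₁ (tr l)}

theorem finite_supp (S : Finset Λ') : (supp S).Finite := by
  classical
  refine (S.biUnion fun l => TM2.stmts₁ (tr l)).finite_toSet.subset ?_
  rintro q ⟨l, hl, hq⟩
  exact Finset.mem_coe.2 (Finset.mem_biUnion.2 ⟨l, hl, hq⟩)

theorem tr_mem_supp {S : Finset Λ'} {l : Λ'} (hl : l ∈ S) : tr l ∈ supp S :=
  ⟨l, hl, TM2.stmts₁_self⟩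

theorem next_mem_supp {S : Finset Λ'} (hS : ∀ l ∈ S, TM2.SupportsStmt S (tr l)) {q q' : Stmt'}
    (hq : q ∈ supp S) {v o : Option Γ'} (h : (next q v o).1.1 = some q') : q' ∈ supp S := by
  classical
  obtain ⟨l, hl, hq⟩ := hq
  have hsub : ∀ q'', q'' ∈ TM2.stmts₁ q → q'' ∈ supp S :=
    fun q'' h => ⟨l, hl, TM2.stmts₁_trans hq h⟩
  have hsup := TM2.stmts₁_supportsStmt_mono hq (hS l hl)
  have key : ∀ q₁ : Stmt', q₁ ∈ TM2.stmts₁ q₁ := fun q₁ => TM2.stmts₁_self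
  rcases q with ⟨k, f, q⟩ | ⟨k, f, q⟩ | ⟨k, f, q⟩ | ⟨f, q⟩ | ⟨f, q₁, q₂⟩ | f | _
  case goto =>
    obtain rfl := Option.some.inj h
    exact tr_mem_supp (hsup v)
  case halt => cases h
  case branch =>
    obtain rfl := Option.some.inj h
    refine hsub _ (Finset.mem_insert_of_mem (Finset.mem_union.2 ?_))
    cases f v
    · exact .inr (key _)
    · exact .inl (key _)
  case pop =>
    rcases o with _ | g <;> obtain rfl := Option.some.inj h <;>
      exact hsub _ (Finset.mem_insert_of_mem (key _))
  all_goals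
    obtain rfl := Option.some.inj h
    exact hsub _ (Finset.mem_insert_of_mem (key _))

theorem intStep_none {a b : IntCfg} (h : intStep a = some b) : b.2 none = a.2 none := by
  obtain ⟨⟨_ | q, v⟩, u⟩ := a
  · cases h
  · obtain rfl := Option.some.inj h
    simp

/-- The configurations have a common successor. -/
def Joinable (a b : IntCfg) : Prop :=
  ∃ d, StateTransition.Reaches intStep a d ∧ StateTransition.Reaches intStep b d

theorem joinable_iff_of_intStep {a b s : IntCfg} (h : intStep a = some b) :
    Joinable a s ↔ Joinable b s := by
  constructor
  · rintro ⟨d, h1, h2⟩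
    rcases Relation.ReflTransGen.cases_head h1 with rfl | ⟨b', h3, h4⟩
    · exact ⟨b, .refl, h2.tail h⟩
    · rw [Option.mem_def, h] at h3
      obtain rfl := Option.some.inj h3
      exact ⟨d, h4, h2⟩
  · rintro ⟨d, h1, h2⟩
    exact ⟨d, h1.head h, h2⟩

theorem reaches_of_joinable {a s : IntCfg} (h : intStep a = none) (hj : Joinable a s) :
    StateTransition.Reaches intStep s a := by
  obtain ⟨d, h1, h2⟩ := hj
  rcases Relation.ReflTransGen.cases_head h1 with rfl | ⟨b', h3, -⟩
  · exact h2
  · rw [Option.mem_def, h] at h3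
    cases h3

/-- The integers with the given additional integer and the given main stack, and empty other
stacks. -/
def coords (a b : ℤ) : Option K' → ℤ
  | none => a
  | some .main => b
  | _ => 0

theorem coords_add (a b a' b' : ℤ) : coords a b + coords a' b' = coords (a + a') (b + b') := by
  funext k
  rcases k with _ | _ | _ | _ | _ <;> simp [coords]

theorem stackVec_elim (z : ℤ) (l : List Γ') :
    stackVec z (K'.elim l [] [] []) = coords z (stackCode l) := by
  funext k
  rcases k with _ | _ | _ | _ | _ <;> rfl

variable {α : Type}

/-- The transitions which apply `pushNum e` to the additional integer `v`, the main stack having the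
integer `t * v + s`. -/
def pushEdge (q : Option Stmt' × Option Γ') (t s : ℤ) (e : ℕ) (y : FreeGroup α) :
    ShiftEdge α (Option Stmt' × Option Γ') (Option K') where
  P := ℤ
  fg := inferInstance
  ψ₀ := AddMonoidHom.mk' (fun v => coords v (t * v)) fun v w => by rw [coords_add, mul_add]
  ψ₁ := AddMonoidHom.mk' (fun v => coords (5 ^ (e + 1) * v) (t * (5 ^ (e + 1) * v)))
    fun v w => by rw [coords_add, mul_add, mul_add]
  injective₀ v w h := congrFun h none
  injective₁ v w h := by
    have : (5 : ℤ) ^ (e + 1) * v = 5 ^ (e + 1) * w := congrFun h none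
    exact mul_left_cancel₀ (by positivity) this
  q₀ := q
  q₁ := q
  u₀ := coords 0 s
  u₁ := coords (pushNum e 0) (t * pushNum e 0 + s)
  y := y

theorem pushEdge_src (q : Option Stmt' × Option Γ') (t s : ℤ) (e : ℕ) (y : FreeGroup α) (v : ℤ) :
    (pushEdge q t s e y).src v = (q, coords v (t * v + s)) := by
  refine Prod.ext rfl ((coords_add 0 s v (t * v)).trans ?_)
  rw [zero_add, add_comm s]

theorem pushEdge_tgt (q : Option Stmt' × Option Γ') (t s : ℤ) (e : ℕ) (y : FreeGroup α) (v : ℤ) :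
    (pushEdge q t s e y).tgt v = (q, coords (pushNum e v) (t * pushNum e v + s)) := by
  refine Prod.ext rfl ((coords_add _ _ (5 ^ (e + 1) * v) (t * (5 ^ (e + 1) * v))).trans ?_)
  rw [pushNum_eq e v]
  congr 1
  ring

/-- Multiplication of a coordinate by an integer. -/
def scale (k : Option K') (m : ℤ) : (Option K' → ℤ) →+ (Option K' → ℤ) :=
  AddMonoidHom.mk' (fun p => Function.update p k (m * p k)) fun p r => by
    funext j
    by_cases h : j = k
    · subst h; simp [mul_add]
    · simp [h]

theorem scale_injective (k : Option K') {m : ℤ} (hm : m ≠ 0) : Function.Injective (scale k m) := by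
  intro p r h
  funext j
  have := congrFun h j
  by_cases hj : j = k
  · subst hj
    simpa [scale, hm] using this
  · simpa [scale, hj] using this

theorem single_add_scale (k : Option K') (m n : ℤ) (p : Option K' → ℤ) :
    Pi.single k n + scale k m p = Function.update p k (m * p k + n) := by
  funext j
  by_cases h : j = k
  · subst h; simp [scale, add_comm]
  · simp [scale, h]

/-- The transitions of a statement with given variable and symbol on the stack. -/
def stepEdge (q : Stmt') (v o : Option Γ') :
    ShiftEdge α (Option Stmt' × Option Γ') (Option K') where
  P := Option K' → ℤ
  fg := Module.Finite.iff_addGroup_fg.1 inferInstance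
  ψ₀ := scale (some (key q)) 5
  ψ₁ := scale (some (key q)) (next q v o).2.1
  injective₀ := scale_injective _ (by norm_num)
  injective₁ := scale_injective _ (next_ne_zero q v o)
  q₀ := (some q, v)
  q₁ := (next q v o).1
  u₀ := Pi.single (some (key q)) (digit o)
  u₁ := Pi.single (some (key q)) (next q v o).2.2
  y := 1

theorem stepEdge_src (q : Stmt') (v o : Option Γ') (p : Option K' → ℤ) :
    (stepEdge q v o : ShiftEdge α _ _).src p = ((some q, v),
      Function.update p (some (key q)) (5 * p (some (key q)) + digit o)) :=
  Prod.ext rfl (single_add_scale _ _ _ _)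

theorem stepEdge_tgt (q : Stmt') (v o : Option Γ') (p : Option K' → ℤ) :
    (stepEdge q v o : ShiftEdge α _ _).tgt p = ((next q v o).1,
      Function.update p (some (key q)) ((next q v o).2.1 * p (some (key q)) + (next q v o).2.2)) :=
  Prod.ext rfl (single_add_scale _ _ _ _)

theorem intStep_stepEdge (q : Stmt') (v o : Option Γ') (p : Option K' → ℤ) :
    intStep ((stepEdge q v o : ShiftEdge α _ _).src p) =
      some ((stepEdge q v o : ShiftEdge α _ _).tgt p) := by
  rw [stepEdge_src, stepEdge_tgt]
  simp only [intStep, Function.update_self, top_add, add_digit_ediv, Function.update_idem]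

theorem exists_stepEdge_src (q : Stmt') (v : Option Γ') (u : Option K' → ℤ) :
    ∃ o p, (stepEdge q v o : ShiftEdge α _ _).src p = ((some q, v), u) := by
  refine ⟨top (u (some (key q))), Function.update u (some (key q)) (u (some (key q)) / 5), ?_⟩
  rw [stepEdge_src, Function.update_idem, Function.update_self, ediv_add_digit_top,
    Function.update_eq_self]

/-- The element represented by the input, whose first letter is the last one of the word. -/
def inputWord (l : List (α × Bool)) : FreeGroup α := FreeGroup.mk l.reverse

theorem inputWord_cons (i : α × Bool) (l : List (α × Bool)) :
    inputWord (i :: l) = inputWord l * FreeGroup.mk [i] := by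
  rw [inputWord, List.reverse_cons, ← FreeGroup.mul_mk]; rfl

section Transitions

variable {α : Type} [Primcodable α] (S : Finset Λ') (q₀ : Stmt')

/-- The transitions of a machine, together with those which write a letter on the input, and those
which forget a letter when the computation is over. -/
def transition : ({q // q ∈ supp S} × Option Γ' × Option Γ') ⊕ ((α × Bool) ⊕ (α × Bool)) →
    ShiftEdge α (Option Stmt' × Option Γ') (Option K')
  | .inl (q, v, o) => stepEdge q v o
  | .inr (.inl i) => pushEdge (some q₀, none) 1 0 (Encodable.encode i) (FreeGroup.mk [i])
  | .inr (.inr i) => pushEdge (none, none) 0 3 (Encodable.encode i) 1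

/-- The initial configuration with the given input. -/
def start (l : List (α × Bool)) : IntCfg := ((some q₀, none), coords (listNum l) (listNum l))

/-- The final configuration with the given input. -/
def final (l : List (α × Bool)) : IntCfg := ((none, none), coords (listNum l) 3)

theorem toIntCfg_init (c : ToPartrec.Code) (l : List (α × Bool)) :
    toIntCfg (listNum l) (init c [listCode l]) = start (tr (trNormal c .halt)) l :=
  Prod.ext rfl (stackVec_elim _ _)

theorem toIntCfg_halt (l : List (α × Bool)) : toIntCfg (listNum l) (halt [0]) = final l := by
  refine Prod.ext rfl ((stackVec_elim _ _).trans ?_)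
  rw [show stackCode (trList [0]) = 3 from listNum_nil (β := Bool)]
  rfl

theorem transition_input_src (i : α × Bool) (l : List (α × Bool)) :
    (transition S q₀ (.inr (.inl i))).src (listNum l) = start q₀ l := by
  refine (pushEdge_src _ _ _ _ _ _).trans ?_
  rw [one_mul, add_zero, start]

theorem transition_input_tgt (i : α × Bool) (l : List (α × Bool)) :
    (transition S q₀ (.inr (.inl i))).tgt (listNum l) = start q₀ (i :: l) := by
  refine (pushEdge_tgt _ _ _ _ _ _).trans ?_
  rw [one_mul, add_zero, start, listNum_cons]

theorem transition_final_src (i : α × Bool) (l : List (α × Bool)) :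
    (transition S q₀ (.inr (.inr i))).src (listNum l) = final l := by
  refine (pushEdge_src _ _ _ _ _ _).trans ?_
  rw [zero_mul, zero_add, final]

theorem transition_final_tgt (i : α × Bool) (l : List (α × Bool)) :
    (transition S q₀ (.inr (.inr i))).tgt (listNum l) = final (i :: l) := by
  refine (pushEdge_tgt _ _ _ _ _ _).trans ?_
  rw [zero_mul, zero_add, final, listNum_cons]

variable {S q₀}

open ShiftEdge in
theorem reach_of_reaches (hS : ∀ l ∈ S, TM2.SupportsStmt S (tr l)) {β₀ β₁ a b : IntCfg}
    {w : FreeGroup α} (h : StateTransition.Reaches intStep a b)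
    (ha : ∀ q, a.1.1 = some q → q ∈ supp S) (hw : Reach (transition S q₀) β₀ β₁ a w) :
    Reach (transition S q₀) β₀ β₁ b w := by
  suffices h' : (∀ q, b.1.1 = some q → q ∈ supp S) ∧ Reach (transition S q₀) β₀ β₁ b w from h'.2
  induction h with
  | refl => exact ⟨ha, hw⟩
  | @tail b d _ h ih =>
    obtain ⟨⟨_ | q, v⟩, u⟩ := b
    · cases h
    obtain ⟨hq, hw⟩ := ih
    obtain ⟨o, p, hp⟩ := exists_stepEdge_src (α := α) q v u
    have h2 := intStep_stepEdge (α := α) q v o p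
    rw [hp] at h2
    obtain rfl := Option.some.inj (h.symm.trans h2)
    refine ⟨fun q' hq' => next_mem_supp hS (hq q rfl) hq', ?_⟩
    have := Reach.forward (E := transition S q₀) (e := .inl (⟨q, hq q rfl⟩, v, o)) (p := p)
      (w := w) (by rwa [← hp] at hw)
    rwa [show (transition S q₀ (.inl (⟨q, hq q rfl⟩, v, o))).y = 1 from rfl, mul_one] at this

open ShiftEdge in
theorem reach_start (l : List (α × Bool)) :
    Reach (transition (α := α) S q₀) (start q₀ ([] : List (α × Bool)))
      (final ([] : List (α × Bool))) (start q₀ l) (inputWord l) := by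
  induction l with
  | nil => exact .base₀
  | cons i l ih =>
    rw [← transition_input_src S q₀ i l] at ih
    have := ih.forward
    rw [transition_input_tgt] at this
    rwa [inputWord_cons]

open ShiftEdge in
theorem reach_final (l : List (α × Bool)) :
    Reach (transition (α := α) S q₀) (start q₀ ([] : List (α × Bool)))
      (final ([] : List (α × Bool))) (final l) 1 := by
  induction l with
  | nil => exact .base₁
  | cons i l ih =>
    rw [← transition_final_src S q₀ i l] at ih
    have := ih.forward
    rw [transition_final_tgt] at this
    rwa [show (transition S q₀ (.inr (.inr i))).y = 1 from rfl, mul_one] at this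

end Transitions

section Value

variable {α H : Type} [Primcodable α] [Group H] (q₀ : Stmt') (x : FreeGroup α →* H)

open Classical in
/-- The value of a configuration in the computation from a given input is that of the input. -/
noncomputable def value (a : IntCfg) : H :=
  if h : ∃ l : List (α × Bool), a.2 none = listNum l ∧ Joinable a (start q₀ l) then
    x (inputWord h.choose) else 1

variable {q₀ x}

theorem value_of_joinable {a : IntCfg} {l : List (α × Bool)} (h : a.2 none = listNum l)
    (hj : Joinable a (start q₀ l)) : value q₀ x a = x (inputWord l) := by
  have h1 : ∃ l : List (α × Bool), a.2 none = listNum l ∧ Joinable a (start q₀ l) := ⟨l, h, hj⟩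
  rw [value, dif_pos h1, listNum_injective (h1.choose_spec.1.symm.trans h)]

theorem value_of_not_joinable {a : IntCfg} {l : List (α × Bool)} (h : a.2 none = listNum l)
    (hj : ¬ Joinable a (start q₀ l)) : value q₀ x a = 1 := by
  refine dif_neg ?_
  rintro ⟨l', h1, h2⟩
  rw [listNum_injective (h1.symm.trans h)] at h2
  exact hj h2

theorem value_start (l : List (α × Bool)) : value q₀ x (start q₀ l) = x (inputWord l) :=
  value_of_joinable rfl ⟨_, .refl, .refl⟩

theorem value_eq_of_intStep {a b : IntCfg} (h : intStep a = some b) :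
    value q₀ x a = value q₀ x b := by
  by_cases ha : ∃ l : List (α × Bool), a.2 none = listNum l
  · obtain ⟨l, hl⟩ := ha
    have hl' := (intStep_none h).trans hl
    by_cases hj : Joinable a (start q₀ l)
    · rw [value_of_joinable hl hj, value_of_joinable hl' ((joinable_iff_of_intStep h).1 hj)]
    · rw [value_of_not_joinable hl hj,
        value_of_not_joinable hl' (mt (joinable_iff_of_intStep h).2 hj)]
  · rw [value, value, dif_neg, dif_neg]
    · rintro ⟨l, hl, -⟩
      exact ha ⟨l, (intStep_none h).symm.trans hl⟩
    · rintro ⟨l, hl, -⟩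
      exact ha ⟨l, hl⟩

theorem value_final {l : List (α × Bool)}
    (h : StateTransition.Reaches intStep (start q₀ l) (final l) → x (inputWord l) = 1) :
    value q₀ x (final l) = 1 := by
  by_cases hj : Joinable (final l) (start q₀ l)
  · rw [value_of_joinable rfl hj]
    exact h (reaches_of_joinable rfl hj)
  · exact value_of_not_joinable rfl hj

theorem value_transition {S : Finset Λ'}
    (h : ∀ l, StateTransition.Reaches intStep (start q₀ l) (final l) → x (inputWord l) = 1)
    (e p) :
    (((transition S q₀ e).src p).2 none ∈ Set.range (listNum (β := α × Bool)) ↔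
      ((transition S q₀ e).tgt p).2 none ∈ Set.range (listNum (β := α × Bool))) ∧
    (((transition S q₀ e).src p).2 none ∈ Set.range (listNum (β := α × Bool)) →
      value q₀ x ((transition S q₀ e).tgt p) =
        value q₀ x ((transition S q₀ e).src p) * x (transition S q₀ e).y) := by
  have hpush (i : α × Bool) (v : ℤ) : v ∈ Set.range (listNum (β := α × Bool)) ↔
      pushNum (Encodable.encode i) v ∈ Set.range (listNum (β := α × Bool)) := by
    constructor
    · rintro ⟨l, rfl⟩
      exact ⟨i :: l, listNum_cons i l⟩
    · rintro ⟨l, hl⟩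
      obtain ⟨m, -, rfl⟩ := eq_cons_of_pushNum_eq hl.symm
      exact ⟨m, rfl⟩
  rcases e with ⟨q, v, o⟩ | i | i
  · have hs := intStep_stepEdge (α := α) q v o p
    refine ⟨?_, fun _ => ?_⟩
    · exact (congrArg (· ∈ Set.range (listNum (β := α × Bool))) (intStep_none hs)).to_iff.symm
    · rw [show (transition S q₀ (.inl (q, v, o))).y = 1 from rfl, map_one, mul_one]
      exact (value_eq_of_intStep hs).symm
  · have hsrc : ((transition S q₀ (.inr (.inl i))).src p).2 none = p :=
      congrArg (fun a => a.2 none) (pushEdge_src _ _ _ _ _ p)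
    have htgt : ((transition S q₀ (.inr (.inl i))).tgt p).2 none = pushNum (Encodable.encode i) p :=
      congrArg (fun a => a.2 none) (pushEdge_tgt _ _ _ _ _ p)
    constructor
    · rw [hsrc, htgt]
      exact hpush i p
    · rw [hsrc]
      rintro ⟨l, rfl⟩
      rw [transition_input_src, transition_input_tgt, value_start, value_start, inputWord_cons,
        map_mul]
      rfl
  · have hsrc : ((transition S q₀ (.inr (.inr i))).src p).2 none = p :=
      congrArg (fun a => a.2 none) (pushEdge_src _ _ _ _ _ p)
    have htgt : ((transition S q₀ (.inr (.inr i))).tgt p).2 none = pushNum (Encodable.encode i) p :=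
      congrArg (fun a => a.2 none) (pushEdge_tgt _ _ _ _ _ p)
    constructor
    · rw [hsrc, htgt]
      exact hpush i p
    · rw [hsrc]
      rintro ⟨l, rfl⟩
      rw [transition_final_src, transition_final_tgt, value_final (h _), value_final (h _),
        show (transition S q₀ (.inr (.inr i))).y = 1 from rfl, map_one, mul_one]

end Value

end StackMachine

open StackMachine Turing PartrecToTM2 in
/-- Higman's criterion for recursively enumerable sets of relators. -/
theorem exists_finite_relations {α : Type} [Finite α] [Primcodable α]
    {ρ : ℕ → List (α × Bool)} (hρ : Computable ρ) :
    ∃ (Var : Type) (Rel : Set (FreeGroup (α ⊕ Var))), Rel.Finite ∧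
      (∀ {Γ : Type u} [Group Γ] (f : FreeGroup (α ⊕ Var) →* Γ), (∀ r ∈ Rel, f r = 1) →
        ∀ n, f (FreeGroup.map Sum.inl (FreeGroup.mk (ρ n))) = 1) ∧
      ∀ {H : Type} [Group H] (x : FreeGroup α →* H), (∀ n, x (FreeGroup.mk (ρ n)) = 1) →
        ∃ (K : Type) (_ : Group K) (i : H →* K) (f : FreeGroup (α ⊕ Var) →* K),
          Function.Injective i ∧ (∀ r ∈ Rel, f r = 1) ∧
          ∀ a, f (FreeGroup.of (Sum.inl a)) = i (x (FreeGroup.of a)) := by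
  obtain ⟨c, hc⟩ := exists_code_of_computable (primrec_listCode.to_comp.comp
    (Primrec.list_reverse.to_comp.comp hρ))
  have hreach (l : List (α × Bool)) :
      StateTransition.Reaches intStep (start (tr (trNormal c .halt)) l) (final l) ↔
        ∃ n, l = (ρ n).reverse := by
    rw [← toIntCfg_init, ← toIntCfg_halt]
    constructor
    · intro h
      obtain ⟨v, hv⟩ := exists_mem_eval_of_reaches h
      obtain ⟨-, n, hn : listCode (ρ n).reverse = listCode l⟩ := (hc _ _).1 hv
      exact ⟨n, listNum_injective (by rw [listNum, listNum, hn])⟩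
    · rintro ⟨n, rfl⟩
      exact reaches_of_mem_eval ((hc _ _).2 ⟨rfl, n, rfl⟩) _
  have hS : ∀ l ∈ codeSupp c .halt, TM2.SupportsStmt (codeSupp c .halt) (tr l) :=
    (tr_supports c .halt).2
  have := (finite_supp (codeSupp c .halt)).to_subtype
  obtain ⟨Var, Rel, hfin, hsound, hcomplete⟩ :=
    ShiftEdge.exists_finite_relations_of_edges.{u}
      (transition (α := α) (codeSupp c .halt) (tr (trNormal c .halt)))
      (L := Set.range fun n => FreeGroup.mk (ρ n)) (β₀ := start (tr (trNormal c .halt)) [])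
      (β₁ := final []) (by
        rintro _ ⟨n, rfl⟩
        refine ⟨final (ρ n).reverse, reach_final _, ?_⟩
        refine reach_of_reaches hS ((hreach _).2 ⟨n, rfl⟩) ?_ ?_
        · intro q hq
          obtain rfl := Option.some.inj hq
          exact tr_mem_supp (tr_supports c .halt).1
        · have := reach_start (S := codeSupp c .halt) (q₀ := tr (trNormal c .halt)) (ρ n).reverse
          rwa [inputWord, List.reverse_reverse] at this) (by
        intro H _ x hx
        have hval (l : List (α × Bool)) (h : StateTransition.Reaches intStep
            (start (tr (trNormal c .halt)) l) (final l)) : x (inputWord l) = 1 := by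
          obtain ⟨n, rfl⟩ := (hreach l).1 h
          rw [inputWord, List.reverse_reverse]
          exact hx _ ⟨n, rfl⟩
        refine ⟨{a | a.2 none ∈ Set.range (listNum (β := α × Bool))},
          value (tr (trNormal c .halt)) x, ⟨[], rfl⟩, ⟨[], rfl⟩, ?_, value_final (hval []),
          value_transition hval⟩
        rw [value_start]
        exact map_one x)
  refine ⟨Var, Rel, hfin, fun f hf n => hsound f hf _ ⟨n, rfl⟩, fun x hx => hcomplete x ?_⟩
  rintro _ ⟨n, rfl⟩
  exact hx n

/-- A finite system of equations and one inequation solvable in some group is solvable in every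
locally universal group. -/
theorem IsLocallyUniversal.exists_hom_freeGroup {G : Type u} [Group G] (hG : IsLocallyUniversal G)
    {ι H : Type} [Group H] (f : FreeGroup ι →* H) {Rel : Set (FreeGroup ι)} (hfin : Rel.Finite)
    (hf : ∀ r ∈ Rel, f r = 1) {W : FreeGroup ι} (hW : f W ≠ 1) :
    ∃ f' : FreeGroup ι →* G, (∀ r ∈ Rel, f' r = 1) ∧ f' W ≠ 1 := by
  obtain ⟨I, UU, φ, hφ⟩ := hG (ULift.{u} H)
  let φ' : H →* Germ (UU : Filter I) G := φ.comp MulEquiv.ulift.symm.toMonoidHom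
  have hφ' : Function.Injective φ' := hφ.comp MulEquiv.ulift.symm.injective
  have hrep : ∀ i, ∃ c : I → G, (c : Germ (UU : Filter I) G) = φ' (f (FreeGroup.of i)) :=
    fun i => Quotient.exists_rep _
  choose c hc using hrep
  let F : I → FreeGroup ι →* G := fun a => FreeGroup.lift fun i => c i a
  have hF : (Germ.coeMulHom (UU : Filter I)).comp (MonoidHom.pi F) = φ'.comp f := by
    ext i
    simp only [MonoidHom.comp_apply, ← hc]
    refine congrArg _ ?_
    funext a
    simp [F]
  have hF' (w : FreeGroup ι) : φ' (f w) = ((fun a => F a w : I → G) : Germ (UU : Filter I) G) :=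
    (DFunLike.congr_fun hF w).symm
  have key (w : FreeGroup ι) : f w = 1 ↔ ∀ᶠ a in (UU : Filter I), F a w = 1 := by
    rw [← map_eq_one_iff φ' hφ', hF']
    exact Germ.coe_eq
  have h1 : ∀ᶠ a in (UU : Filter I), ∀ r ∈ Rel, F a r = 1 :=
    (Filter.eventually_all_finite hfin).2 fun r hr => (key r).1 (hf r hr)
  have h2 : ∀ᶠ a in (UU : Filter I), F a W ≠ 1 := by
    rw [Ultrafilter.eventually_not]
    exact fun h => hW ((key W).2 h)
  obtain ⟨a, ha⟩ := (h1.and h2).exists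
  exact ⟨F a, ha⟩

open Classical in
/-- Every group embeds in a group with elements `b`, `g`, `ξ` such that the commutator of `g` with
the conjugate of `b` by `s` is trivial for `s = 1` and is `ξ ≠ 1` otherwise. -/
theorem exists_commutator_witness (S : Type) [Group S] :
    ∃ (H : Type) (_ : Group H) (p : S →* H) (b g ξ : H), ξ ≠ 1 ∧ b * g * b⁻¹ * g⁻¹ = 1 ∧
      ∀ s, s ≠ 1 → p s * b * (p s)⁻¹ * g * p s * b⁻¹ * (p s)⁻¹ * g⁻¹ * ξ⁻¹ = 1 := by
  let X := (S → ZMod 2) × ZMod 2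
  have h2 (a : ZMod 2) : a + a = 0 := CharTwo.add_self_eq_zero a
  let χ : S → ZMod 2 := fun s => if s = 1 then 0 else 1
  let p : S →* Equiv.Perm X := MonoidHom.mk'
    (fun s => ⟨fun v => (fun r => v.1 (s⁻¹ * r), v.2), fun v => (fun r => v.1 (s * r), v.2),
      fun v => by simp, fun v => by simp⟩)
    (fun a b => by ext v <;> simp [mul_assoc])
  let b : Equiv.Perm X := ⟨fun v => (v.1, v.2 + v.1 1), fun v => (v.1, v.2 + v.1 1),
    fun v => by simp [add_assoc, h2], fun v => by simp [add_assoc, h2]⟩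
  let g : Equiv.Perm X := ⟨fun v => (v.1 + χ, v.2), fun v => (v.1 + χ, v.2),
    fun v => by ext <;> simp [add_assoc, h2], fun v => by ext <;> simp [add_assoc, h2]⟩
  let ξ : Equiv.Perm X := ⟨fun v => (v.1, v.2 + 1), fun v => (v.1, v.2 + 1),
    fun v => by simp [add_assoc, h2], fun v => by simp [add_assoc, h2]⟩
  refine ⟨Equiv.Perm X, inferInstance, p, b, g, ξ, fun h => ?_, ?_, fun s hs => ?_⟩
  · have := congrArg (fun e : Equiv.Perm X => (e (0, 0)).2) h
    simp [ξ] at this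
  · ext v <;> simp [b, g, χ, Equiv.Perm.inv_def, add_assoc, h2]
  · have h3 (c : ZMod 2) : 1 + (c + (1 + c)) = 0 := by
      revert c; decide
    ext v <;> simp [p, b, g, ξ, χ, Equiv.Perm.inv_def, add_assoc, h2, hs]
    exact h3 _

/-- The word in the generators of a group, together with letters `b`, `g`, `ξ`, which encodes that
`l` represents the identity (if `c` is true) or that it does not (if `c` is false). -/
def wordRelator {k : ℕ} (c : Bool) (l : List (Fin k × Bool)) : List ((Fin k ⊕ Fin 3) × Bool) :=
  let e : List (Fin k × Bool) → List ((Fin k ⊕ Fin 3) × Bool) :=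
    List.map fun p => (Sum.inl p.1, p.2)
  let e' : List ((Fin k ⊕ Fin 3) × Bool) := ((e l).map fun p => (p.1, !p.2)).reverse
  bif c then e l ++ [(.inr 0, true), (.inr 1, true), (.inr 0, false), (.inr 1, false)]
  else e l ++ ([(.inr 0, true)] ++ (e' ++ ([(.inr 1, true)] ++ (e l ++ ([(.inr 0, false)] ++
    (e' ++ [(.inr 1, false), (.inr 2, false)]))))))

theorem primrec_wordRelator {k : ℕ} : Primrec₂ (wordRelator (k := k)) := by
  have he : Primrec fun q : Bool × List (Fin k × Bool) =>
      q.2.map fun p => ((Sum.inl p.1, p.2) : (Fin k ⊕ Fin 3) × Bool) := by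
    refine Primrec.list_map Primrec.snd (Primrec.pair ?_ ?_)
    · exact Primrec.sumInl.comp (Primrec.fst.comp Primrec.snd)
    · exact Primrec.snd.comp Primrec.snd
  have he' : Primrec fun q : Bool × List (Fin k × Bool) =>
      ((q.2.map fun p => ((Sum.inl p.1, p.2) : (Fin k ⊕ Fin 3) × Bool)).map
        fun p => (p.1, !p.2)).reverse := by
    refine Primrec.list_reverse.comp (Primrec.list_map he (Primrec.pair ?_ ?_))
    · exact Primrec.fst.comp Primrec.snd
    · exact Primrec.not.comp (Primrec.snd.comp Primrec.snd)
  have ha := Primrec.list_append (α := (Fin k ⊕ Fin 3) × Bool)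
  refine Primrec.cond Primrec.fst (ha.comp he (Primrec.const _)) (ha.comp he
    (ha.comp (Primrec.const _) (ha.comp he' (ha.comp (Primrec.const _) (ha.comp he
    (ha.comp (Primrec.const _) (ha.comp he' (Primrec.const _))))))))

theorem lift_wordRelator {k : ℕ} {Γ : Type*} [Group Γ] (f : FreeGroup (Fin k ⊕ Fin 3) →* Γ)
    (c : Bool) (l : List (Fin k × Bool)) :
    f (FreeGroup.mk (wordRelator c l)) =
      let x := f (FreeGroup.map Sum.inl (FreeGroup.mk l))
      let b := f (FreeGroup.of (Sum.inr 0))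
      let g := f (FreeGroup.of (Sum.inr 1))
      let ξ := f (FreeGroup.of (Sum.inr 2))
      bif c then x * (b * g * b⁻¹ * g⁻¹)
      else x * b * x⁻¹ * g * x * b⁻¹ * x⁻¹ * g⁻¹ * ξ⁻¹ := by
  have h1 (a b : List ((Fin k ⊕ Fin 3) × Bool)) :
      FreeGroup.mk (a ++ b) = FreeGroup.mk a * FreeGroup.mk b := FreeGroup.mul_mk.symm
  have h2 (a : (Fin k ⊕ Fin 3) × Bool) (b : List ((Fin k ⊕ Fin 3) × Bool)) :
      FreeGroup.mk (a :: b) = FreeGroup.mk [a] * FreeGroup.mk b :=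
    (FreeGroup.mul_mk (L₁ := [a]) (L₂ := b)).symm
  have h3 (a : Fin k ⊕ Fin 3) : FreeGroup.mk [(a, false)] = (FreeGroup.of a)⁻¹ := rfl
  have h4 (a : Fin k ⊕ Fin 3) : FreeGroup.mk [(a, true)] = FreeGroup.of a := rfl
  have h5 (l : List ((Fin k ⊕ Fin 3) × Bool)) :
      FreeGroup.mk (l.map fun p => (p.1, !p.2)).reverse = (FreeGroup.mk l)⁻¹ := rfl
  cases c
  · simp only [wordRelator, cond_false, h1, h2 _ (_ :: _), h3, h4, h5, FreeGroup.map.mk,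
      map_mul, map_inv, mul_assoc]
  · simp only [wordRelator, cond_true, h1, h2 _ (_ :: _), h3, h4, FreeGroup.map.mk,
      map_mul, map_inv, mul_assoc]

/-- Every finitely generated group with solvable word problem embeds into every locally
universal group. -/
theorem solvable_word_problem_embeds_into_locally_universal
    {S : Type u} [Group S] (hS : HasSolvableWordProblem S)
    {G : Type u} [Group G] (hG : IsLocallyUniversal G) :
    ∃ f : S →* G, Function.Injective f := by
  classical
  obtain ⟨k, π, hπ, hdec, hcomp⟩ := hS
  let c (l : List (Fin k × Bool)) : Bool := decide (π (FreeGroup.mk l) = 1)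
  let w (n : ℕ) : List (Fin k × Bool) := (Encodable.decode n).getD []
  have hw : Computable w := Computable.option_getD Computable.decode (Computable.const _)
  have hρ : Computable fun n => wordRelator (c (w n)) (w n) := by
    refine (primrec_wordRelator (k := k)).to_comp.comp (Computable.comp ?_ hw) hw
    convert hcomp
  have hsurj (l : List (Fin k × Bool)) : ∃ n, w n = l := ⟨Encodable.encode l, by simp [w]⟩
  obtain ⟨Var, Rel, hfin, hforce, hext⟩ := exists_finite_relations.{u} hρ
  obtain ⟨H, _, p, b, g, ξ, hξ, hbg, hs⟩ := exists_commutator_witness (FreeGroup (Fin k) ⧸ π.ker)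
  let x : FreeGroup (Fin k ⊕ Fin 3) →* H :=
    FreeGroup.lift (Sum.elim (fun i => p (QuotientGroup.mk' π.ker (FreeGroup.of i))) ![b, g, ξ])
  have hx (v : FreeGroup (Fin k)) :
      x (FreeGroup.map Sum.inl v) = p (QuotientGroup.mk' π.ker v) := by
    have : x.comp (FreeGroup.map Sum.inl) = p.comp (QuotientGroup.mk' π.ker) := by
      ext i; simp [x]
    exact DFunLike.congr_fun this v
  obtain ⟨K, _, i, f, hi, hfRel, hf⟩ := hext x fun n => by
    rw [lift_wordRelator]
    simp only [hx]
    by_cases h : π (FreeGroup.mk (w n)) = 1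
    · have : QuotientGroup.mk' π.ker (FreeGroup.mk (w n)) = 1 :=
        (QuotientGroup.eq_one_iff _).2 h
      rw [this]
      simpa [c, h, x] using hbg
    · have : QuotientGroup.mk' π.ker (FreeGroup.mk (w n)) ≠ 1 :=
        fun h' => h ((QuotientGroup.eq_one_iff _).1 h')
      simpa [c, h, x] using hs _ this
  obtain ⟨F, hF, hFξ⟩ := hG.exists_hom_freeGroup f hfin hfRel
    (W := FreeGroup.of (Sum.inl (Sum.inr 2))) (by
      rw [hf, Ne, map_eq_one_iff i hi]
      simpa [x] using hξ)
  have hF1 := hforce F hF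
  let F' : FreeGroup (Fin k ⊕ Fin 3) →* G := F.comp (FreeGroup.map Sum.inl)
  have hF2 (l : List (Fin k × Bool)) := (lift_wordRelator F' (c l) l).symm.trans (by
    obtain ⟨n, rfl⟩ := hsurj l
    exact hF1 n)
  let φ : FreeGroup (Fin k) →* G := F'.comp (FreeGroup.map Sum.inl)
  have hbg' := hF2 []
  simp only [show c [] = true by simp [c, ← FreeGroup.one_eq_mk], cond_true,
    ← FreeGroup.one_eq_mk, map_one, one_mul] at hbg'
  have hφ (v : FreeGroup (Fin k)) : π v = 1 ↔ φ v = 1 := by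
    obtain ⟨l, rfl⟩ := Quot.exists_rep v
    change π (FreeGroup.mk l) = 1 ↔ φ (FreeGroup.mk l) = 1
    have h := hF2 l
    by_cases hl : π (FreeGroup.mk l) = 1
    · simp only [c, hl, decide_true, cond_true, hbg', mul_one] at h
      exact iff_of_true hl h
    · simp only [c, hl, decide_false, cond_false] at h
      refine iff_of_false hl fun hl' => hFξ ?_
      rw [show F' (FreeGroup.map Sum.inl (FreeGroup.mk l)) = 1 from hl'] at h
      simp only [one_mul, inv_one, mul_one, hbg', inv_eq_one] at h
      simpa [F'] using h
  refine ⟨π.liftOfSurjective hπ ⟨φ, fun v hv => (hφ v).1 hv⟩, ?_⟩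
  rw [injective_iff_map_eq_one]
  intro s h
  obtain ⟨v, rfl⟩ := hπ s
  rw [MonoidHom.liftOfRightInverse_comp_apply] at h
  exact (hφ v).2 h
end

section
/- Every finitely presented simple group embeds into every locally universal group: if S is a nontrivial simple group isomorphic to the quotient of a free group on finitely many generators by the normal closure of a finite set of relators, and G is a locally universal group, then there is an injective group homomorphism from S into G. -/
open Filter

universe u

/-- A homomorphism from a free group to a group of germs lifts to a group of functions. -/
lemma FreeGroup.exists_lift_germ {α I G : Type*} [Group G] {l : Filter I}
    (φ : FreeGroup α →* Germ l G) :
    ∃ Φ : FreeGroup α →* (I → G), ∀ w, φ w = (Φ w : Germ l G) := by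
  choose a ha using fun j => Quotient.exists_rep (φ (FreeGroup.of j))
  have h : φ = (Germ.coeMulHom l).comp (FreeGroup.lift a) := by
    ext j
    simp only [MonoidHom.comp_apply, FreeGroup.lift_apply_of]
    exact (ha j).symm
  exact ⟨FreeGroup.lift a, fun w => DFunLike.congr_fun h w⟩

/-- If a homomorphism from a finitely presented group to a group of germs does not kill `s`,
then some homomorphism to the base group does not kill `s`. -/
lemma exists_monoidHom_apply_ne_one_of_germ {α I G : Type*} [Group G] {l : Filter I}
    (R : Finset (FreeGroup α))
    (f : FreeGroup α ⧸ Subgroup.normalClosure (R : Set (FreeGroup α)) →* Germ l G)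
    {s : FreeGroup α ⧸ Subgroup.normalClosure (R : Set (FreeGroup α))} (hs : f s ≠ 1) :
    ∃ g : FreeGroup α ⧸ Subgroup.normalClosure (R : Set (FreeGroup α)) →* G, g s ≠ 1 := by
  obtain ⟨w, rfl⟩ := QuotientGroup.mk'_surjective _ s
  obtain ⟨Φ, hΦ⟩ := FreeGroup.exists_lift_germ (f.comp (QuotientGroup.mk' _))
  have hR : ∀ᶠ i in l, ∀ r ∈ R, Φ r i = 1 := by
    refine (Finset.eventually_all R).2 fun r hr => Germ.coe_eq.1 ?_
    have hr' : QuotientGroup.mk' (Subgroup.normalClosure (R : Set (FreeGroup α))) r = 1 :=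
      (QuotientGroup.eq_one_iff r).2 (Subgroup.subset_normalClosure hr)
    rw [← hΦ, MonoidHom.comp_apply, hr', map_one]
    rfl
  have hw : ∃ᶠ i in l, Φ w i ≠ 1 := fun h =>
    hs ((hΦ w).trans (Germ.coe_eq.2 (h.mono fun _ hi => not_not.1 hi)))
  obtain ⟨i, hwi, hRi⟩ := (hw.and_eventually hR).exists
  exact ⟨QuotientGroup.lift _ ((Pi.evalMonoidHom (fun _ => G) i).comp Φ)
    (Subgroup.normalClosure_le_normal (N := MonoidHom.ker _) hRi), hwi⟩

/-- Every nontrivial finitely presented simple group embeds into every locally universal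
group. -/
theorem finitely_presented_simple_embeds_into_locally_universal
    {S : Type u} [Group S] (hsimple : IsSimpleGroup S)
    (hfp : ∃ (k : ℕ) (R : Finset (FreeGroup (Fin k))),
      Nonempty (S ≃* FreeGroup (Fin k) ⧸ Subgroup.normalClosure (R : Set (FreeGroup (Fin k)))))
    {G : Type u} [Group G] (hG : IsLocallyUniversal G) :
    ∃ f : S →* G, Function.Injective f := by
  obtain ⟨k, R, ⟨e⟩⟩ := hfp
  obtain ⟨I, U, f, hf⟩ := hG S
  obtain ⟨s, hs⟩ := exists_ne (1 : S)
  obtain ⟨g, hg⟩ := exists_monoidHom_apply_ne_one_of_germ R (f.comp e.symm.toMonoidHom)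
    (s := e s) (by simpa using (map_ne_one_iff f hf).2 hs)
  refine ⟨g.comp e.toMonoidHom, (MonoidHom.ker_eq_bot_iff _).1 ?_⟩
  refine (MonoidHom.normal_ker _).eq_bot_or_eq_top.resolve_right fun h => hg ?_
  exact MonoidHom.mem_ker.1 (h.ge (Subgroup.mem_top s))
end

section
/- Every existentially closed group is locally universal: if G is an existentially closed group, then for every group H there exist an index set I, an ultrafilter U on I, and an injective group homomorphism from H into the ultrapower G^U. -/
open Filter

universe u

/-- On every finite subset `S` of a group `H`, some map into the existentially closed group `G`
is injective and respects the products that stay in `S`. -/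
theorem IsEC.exists_injOn_map_mul {G : Type u} [Group G] (hG : IsEC G) {H : Type u} [Group H]
    (S : Finset H) :
    ∃ φ : H → G, Set.InjOn φ S ∧
      ∀ a ∈ S, ∀ b ∈ S, a * b ∈ S → φ (a * b) = φ a * φ b := by
  classical
  let e := S.equivFin
  let x : H → FreeGroup (G ⊕ Fin S.card) := fun h =>
    if hh : h ∈ S then FreeGroup.of (Sum.inr (e ⟨h, hh⟩)) else 1
  obtain ⟨c, hE, hN⟩ := hG (G × H) (MonoidHom.inl G H) (fun a b h => congrArg Prod.fst h) S.card
    (((S ×ˢ S).filter fun p => p.1 * p.2 ∈ S).image fun p => x (p.1 * p.2) * (x p.1 * x p.2)⁻¹)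
    (((S ×ˢ S).filter fun p => p.1 ≠ p.2).image fun p => x p.1 * (x p.2)⁻¹) (by
      let b : Fin S.card → G × H := fun j => (1, (e.symm j : H))
      have hx : ∀ h ∈ S,
          FreeGroup.lift (Sum.elim (⇑(MonoidHom.inl G H)) b) (x h) = (1, h) := by
        intro h hh
        simp [x, hh, b]
      refine ⟨b, fun w hw => ?_, fun w hw => ?_⟩
      · simp only [Finset.mem_image, Finset.mem_filter, Finset.mem_product] at hw
        obtain ⟨p, ⟨⟨h₁, h₂⟩, h₃⟩, rfl⟩ := hw
        rw [map_mul, map_inv, map_mul, hx _ h₁, hx _ h₂, hx _ h₃, mul_inv_eq_one]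
        simp
      · simp only [Finset.mem_image, Finset.mem_filter, Finset.mem_product] at hw
        obtain ⟨p, ⟨⟨h₁, h₂⟩, h₃⟩, rfl⟩ := hw
        rw [map_mul, map_inv, hx _ h₁, hx _ h₂, Ne, mul_inv_eq_one]
        simpa using h₃)
  refine ⟨fun h => FreeGroup.lift (Sum.elim id c) (x h), fun a ha b hb hab => ?_,
    fun a ha b hb hab => ?_⟩
  · by_contra hne
    refine hN (x a * (x b)⁻¹) (Finset.mem_image.2 ⟨(a, b), ?_, rfl⟩) ?_
    · simpa using ⟨⟨ha, hb⟩, hne⟩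
    · rw [map_mul, map_inv, mul_inv_eq_one]
      exact hab
  · have h := hE (x (a * b) * (x a * x b)⁻¹) (Finset.mem_image.2 ⟨(a, b), by simp [*], rfl⟩)
    rwa [map_mul, map_inv, mul_inv_eq_one, map_mul] at h

/-- Every existentially closed group is locally universal: every group embeds into some
ultrapower of an e.c. group. -/
theorem ec_is_locally_universal {G : Type u} [Group G] (hG : IsEC G) :
    IsLocallyUniversal G := by
  classical
  intro H _
  choose φ hinj hmul using fun S : Finset H => hG.exists_injOn_map_mul S
  have hle : (Ultrafilter.of (atTop : Filter (Finset H)) : Filter (Finset H)) ≤ atTop :=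
    Ultrafilter.of_le atTop
  have hmem : ∀ a : H, ∀ᶠ S in (Ultrafilter.of (atTop : Filter (Finset H)) : Filter (Finset H)),
      a ∈ S := fun a =>
    hle ((eventually_ge_atTop {a}).mono fun S hS => Finset.singleton_subset_iff.1 hS)
  refine ⟨Finset H, Ultrafilter.of atTop,
    MonoidHom.mk' (fun h => ((fun S => φ S h : Finset H → G) : Germ _ G)) fun a b => ?_,
    fun a b hab => ?_⟩
  · refine Germ.coe_eq.2 ?_
    filter_upwards [hmem a, hmem b, hmem (a * b)] with S ha hb hab
    exact hmul S a ha b hb hab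
  · obtain ⟨S, hS, ha, hb⟩ :=
      ((Germ.coe_eq.1 hab).and ((hmem a).and (hmem b))).exists
    exact hinj S ha hb hS
end

section
/- A group G is existentially closed if and only if: whenever G is a subgroup of a group H (i.e., there is an injective group homomorphism i : G → H), there exist an index set I, an ultrafilter U on I, and an injective group homomorphism j : H → G^U into an ultrapower of G such that j ∘ i coincides with the diagonal embedding of G into G^U (sending g to the germ of the constant function with value g). -/
open Filter

universe u

/-- Over an existentially closed group `G`, every finite subset of an extension `H` admits a
map to `G` that preserves products, non-triviality and the elements of `G`. -/
theorem IsEC.exists_partial_hom {G H : Type u} [Group G] [Group H] (hG : IsEC G) (i : G →* H)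
    (hi : Function.Injective i) (A : Finset H) :
    ∃ c : H → G, (∀ a ∈ A, ∀ b ∈ A, a * b ∈ A → c (a * b) = c a * c b) ∧
      (∀ a ∈ A, a ≠ 1 → c a ≠ 1) ∧ ∀ g, i g ∈ A → c (i g) = g := by
  classical
  let e := A.equivFin
  let x : A → FreeGroup (G ⊕ Fin A.card) := fun a => FreeGroup.of (Sum.inr (e a))
  let mulWord : A × A × A → FreeGroup (G ⊕ Fin A.card) :=
    fun t => x t.2.2 * (x t.1 * x t.2.1)⁻¹
  let constWord : A → FreeGroup (G ⊕ Fin A.card) :=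
    fun a => x a * (FreeGroup.of (Sum.inl (Function.invFun i a)))⁻¹
  obtain ⟨c, hE, hN⟩ := hG H i hi A.card
    ((Finset.univ.filter fun t : A × A × A => (t.2.2 : H) = t.1 * t.2.1).image mulWord ∪
      (Finset.univ.filter fun a : A => ∃ g, i g = a).image constWord)
    ((Finset.univ.filter fun a : A => (a : H) ≠ 1).image x) (by
      refine ⟨fun k => e.symm k, fun w hw => ?_, fun w hw => ?_⟩
      · rcases Finset.mem_union.1 hw with hw | hw
        · obtain ⟨t, ht, rfl⟩ := Finset.mem_image.1 hw
          simp [mulWord, x, (Finset.mem_filter.1 ht).2]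
        · obtain ⟨a, ha, rfl⟩ := Finset.mem_image.1 hw
          simp [constWord, x, Function.invFun_eq (Finset.mem_filter.1 ha).2]
      · obtain ⟨a, ha, rfl⟩ := Finset.mem_image.1 hw
        simpa [x] using (Finset.mem_filter.1 ha).2)
  refine ⟨fun h => if hh : h ∈ A then c (e ⟨h, hh⟩) else 1, fun a ha b hb hab => ?_,
    fun a ha ha1 => ?_, fun g hg => ?_⟩
  · have := hE (mulWord (⟨a, ha⟩, ⟨b, hb⟩, ⟨a * b, hab⟩)) (Finset.mem_union_left _
      (Finset.mem_image_of_mem _ (by simp)))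
    simp only [dif_pos ha, dif_pos hb, dif_pos hab]
    simpa only [mulWord, x, map_mul, map_inv, FreeGroup.lift_apply_of, Sum.elim_inr,
      mul_inv_eq_one] using this
  · have := hN (x ⟨a, ha⟩) (Finset.mem_image_of_mem _ (by simpa using ha1))
    simpa [x, ha] using this
  · have := hE (constWord ⟨i g, hg⟩) (Finset.mem_union_right _
      (Finset.mem_image_of_mem _ (by simp)))
    simp only [dif_pos hg]
    simpa only [constWord, x, map_mul, map_inv, FreeGroup.lift_apply_of, Sum.elim_inr,
      Sum.elim_inl, mul_inv_eq_one, Function.leftInverse_invFun hi g, id] using this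

/-- If `j` restricts to the diagonal embedding of `G`, the image under `j` of the value of a word
is the germ of its pointwise values. -/
theorem map_lift_eq_germ {G H I : Type*} [Group G] [Group H] {l : Filter I}
    (i : G →* H) (j : H →* Germ l G) (hj : ∀ g : G, j (i g) = (↑g : Germ l G))
    {ι : Type*} (b : ι → H) (f : ι → I → G) (hf : ∀ k, (↑(f k) : Germ l G) = j (b k))
    (w : FreeGroup (G ⊕ ι)) :
    j (FreeGroup.lift (Sum.elim i b) w) =
      (↑(fun s => FreeGroup.lift (Sum.elim id fun k => f k s) w) : Germ l G) := by
  have : j.comp (FreeGroup.lift (Sum.elim i b)) = (Germ.coeMulHom l).comp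
      (MonoidHom.pi fun s => FreeGroup.lift (Sum.elim id fun k => f k s)) := by
    ext (g | k)
    · simp only [MonoidHom.comp_apply, FreeGroup.lift_apply_of, Sum.elim_inl, hj]
      refine congrArg (fun φ : I → G => (↑φ : Germ l G)) ?_
      exact funext fun s => (FreeGroup.lift_apply_of (f := Sum.elim id fun k => f k s)
        (x := Sum.inl g)).symm
    · simp only [MonoidHom.comp_apply, FreeGroup.lift_apply_of, Sum.elim_inr, ← hf]
      refine congrArg (fun φ : I → G => (↑φ : Germ l G)) ?_
      exact funext fun s => (FreeGroup.lift_apply_of (f := Sum.elim id fun k => f k s)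
        (x := Sum.inr k)).symm
  exact DFunLike.congr_fun this w

/-- A group `G` is existentially closed if and only if: whenever `G` embeds into a group `H`
via `i`, there is an embedding `j` of `H` into some ultrapower of `G` such that `j ∘ i` is
the diagonal embedding of `G` into that ultrapower. -/
theorem ec_iff_embeds_into_ultrapower_over_diagonal {G : Type u} [Group G] :
    IsEC G ↔
      ∀ (H : Type u) [Group H], ∀ i : G →* H, Function.Injective i →
        ∃ (I : Type u) (UU : Ultrafilter I) (j : H →* Filter.Germ (UU : Filter I) G),
          Function.Injective j ∧
          ∀ g : G, j (i g) = (↑g : Filter.Germ (UU : Filter I) G) := by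
  classical
  constructor
  · intro hG H _ i hi
    choose c hmul hne hconst using hG.exists_partial_hom i hi
    let UU : Ultrafilter (Finset H) := Ultrafilter.of atTop
    have hmem (h : H) : ∀ᶠ A in (UU : Filter (Finset H)), h ∈ A :=
      Ultrafilter.of_le atTop <| (eventually_ge_atTop {h}).mono fun A hA =>
        hA (Finset.mem_singleton_self h)
    let j : H →* Germ (UU : Filter (Finset H)) G :=
      MonoidHom.mk' (fun h => ↑(fun A => c A h)) fun a b => Germ.coe_eq.2 <| by
        filter_upwards [hmem a, hmem b, hmem (a * b)] with A ha hb hab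
        exact hmul A a ha b hb hab
    refine ⟨Finset H, UU, j, (injective_iff_map_eq_one j).2 fun h hh => ?_,
      fun g => Germ.coe_eq.2 ?_⟩
    · by_contra h1
      obtain ⟨A, hA, hA1⟩ := ((hmem h).and (Germ.coe_eq.1 hh)).exists
      exact hne A h hA h1 hA1
    · filter_upwards [hmem (i g)] with A hA
      exact hconst A g hA
  · intro hG H _ i hi m E N ⟨b, hE, hN⟩
    obtain ⟨I, UU, j, hjinj, hj⟩ := hG H i hi
    choose f hf using fun k => Quotient.exists_rep (j (b k))
    have key := map_lift_eq_germ i j hj b f hf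
    have hE' : ∀ᶠ s in (UU : Filter I), ∀ w ∈ E,
        FreeGroup.lift (Sum.elim id fun k => f k s) w = 1 :=
      (eventually_all_finset E).2 fun w hw => Germ.coe_eq.1 <| by
        rw [← key, hE w hw, map_one]
        rfl
    have hN' : ∀ᶠ s in (UU : Filter I), ∀ w ∈ N,
        FreeGroup.lift (Sum.elim id fun k => f k s) w ≠ 1 :=
      (eventually_all_finset N).2 fun w hw => Ultrafilter.eventually_not.2 fun h =>
        hN w hw <| hjinj <| by
          rw [key, map_one]
          exact Germ.coe_eq.2 h
    obtain ⟨s, hs⟩ := (hE'.and hN').exists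
    exact ⟨fun k => f k s, hs⟩
end
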